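/- For every δ > 0 there exists a constant C > 0 depending only on a, b, c and δ such that: for all L > 0 and W ∈ (0, ∞] with W/L ≥ δ, any solution Q ∈ H_∞ of the Euler–Lagrange equation L ΔQ = −aQ − b(Q² − (|Q|²/3)I) + c|Q|²Q in Ω with weak anchoring (L/W) ∂Q/∂ν = Q_s − Q on |x| = 1 satisfies the uniform gradient bound ‖∇(Q − Q_{0,W/L})‖_{L∞(Ω)} ≤ C/√L, where Q_{0,w}(x) = s_*(w/(3+w))(1/r³)(e_r⊗e_r − I/3) + s_*(1 − (w/(1+w))(1/r))(e_z⊗e_z − I/3) with r = |x|. -/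

import Mathlib

open MeasureTheory Filter Metric Real Set
open scoped ENNReal NNReal
noncomputable section

abbrev E3 : Type := EuclideanSpace ℝ (Fin 3)
abbrev Mat3 : Type := Matrix (Fin 3) (Fin 3) ℝ

def isS0 (Q : Mat3) : Prop := Q.IsSymm ∧ Q.trace = 0
def minner (A B : Mat3) : ℝ := (A * B).trace
def mnormSq (A : Mat3) : ℝ := (A * A).trace
def mnorm (A : Mat3) : ℝ := Real.sqrt (mnormSq A)
def outer (u v : E3) : Mat3 := Matrix.of fun i j => u i * v j
def ez : E3 := EuclideanSpace.single 2 1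
def er (x : E3) : E3 := ‖x‖⁻¹ • x
def sstar (a b c : ℝ) : ℝ := (b + Real.sqrt (b ^ 2 + 24 * a * c)) / (4 * c)
def Qinf (a b c : ℝ) : Mat3 := sstar a b c • (outer ez ez - (1 / 3 : ℝ) • (1 : Mat3))
def Qsurf (a b c : ℝ) (x : E3) : Mat3 :=
  sstar a b c • (outer (er x) (er x) - (1 / 3 : ℝ) • (1 : Mat3))
def Omega : Set E3 := {x | 1 < ‖x‖}
def OmegaBar : Set E3 := {x | 1 ≤ ‖x‖}

def pd (g : E3 → ℝ) (k : Fin 3) : E3 → ℝ :=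
  fun x => fderivWithin ℝ g OmegaBar x (EuclideanSpace.single k 1)
def lap3 (g : E3 → ℝ) (x : E3) : ℝ := ∑ k, pd (pd g k) k x
def matLap (Q : E3 → Mat3) (x : E3) : Mat3 := Matrix.of fun i j => lap3 (fun y => Q y i j) x
def gradSq (Q : E3 → Mat3) (x : E3) : ℝ := ∑ i, ∑ j, ∑ k, (pd (fun y => Q y i j) k x) ^ 2
def nuDeriv (Q : E3 → Mat3) (x : E3) : Mat3 :=
  Matrix.of fun i j => fderivWithin ℝ (fun y => Q y i j) OmegaBar x (-(er x))

def gradf (a b c : ℝ) (Q : Mat3) : Mat3 :=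
  (-a) • Q - b • (Q * Q - (mnormSq Q / 3) • (1 : Mat3)) + (c * mnormSq Q) • Q

def gpot (a b c : ℝ) (Q : Mat3) : ℝ :=
  -(a / 2) * (Q * Q).trace - (b / 3) * (Q * Q * Q).trace + (c / 4) * ((Q * Q).trace) ^ 2
def Cconst (a b c : ℝ) : ℝ := -sInf (gpot a b c '' {Q | isS0 Q})
def fpot (a b c : ℝ) (Q : Mat3) : ℝ := gpot a b c Q + Cconst a b c

def RegC (m : ℕ) (Q : E3 → Mat3) : Prop :=
  ∀ i j, ContDiffOn ℝ m (fun x => Q x i j) OmegaBar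

def memH (a b c : ℝ) (Q : E3 → Mat3) : Prop :=
  (∀ x ∈ OmegaBar, isS0 (Q x)) ∧
  IntegrableOn (fun x => gradSq Q x) Omega volume ∧
  IntegrableOn (fun x => mnormSq (Q x - Qinf a b c) / ‖x‖ ^ 2) Omega volume

def isEL (a b c L : ℝ) (Q : E3 → Mat3) : Prop :=
  ∀ x ∈ Omega, L • matLap Q x = gradf a b c (Q x)

def weakAnchor (a b c L W : ℝ) (Q : E3 → Mat3) : Prop :=
  ∀ x : E3, ‖x‖ = 1 → (L / W) • nuDeriv Q x = Qsurf a b c x - Q x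

def coef1 (w : ℝ≥0∞) : ℝ := if w = ⊤ then 1 else w.toReal / (1 + w.toReal)
def coef3 (w : ℝ≥0∞) : ℝ := if w = ⊤ then 1 else w.toReal / (3 + w.toReal)

def Q0 (a b c : ℝ) (w : ℝ≥0∞) (x : E3) : Mat3 :=
  (sstar a b c * coef3 w / ‖x‖ ^ 3) • (outer (er x) (er x) - (1 / 3 : ℝ) • (1 : Mat3))
  + (sstar a b c * (1 - coef1 w / ‖x‖)) • (outer ez ez - (1 / 3 : ℝ) • (1 : Mat3))

def repeatedEig (Q : Mat3) : Prop := ∃ t : ℝ, 2 ≤ Polynomial.rootMultiplicity t (Matrix.charpoly Q)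

def vec3 (p q r : ℝ) : E3 := (WithLp.equiv 2 (Fin 3 → ℝ)).symm ![p, q, r]

open scoped Topology RealInnerProductSpace

/-! ### Second-order calculus on `E3` -/

/-- The standard basis vectors of `E3`. -/
abbrev eb (k : Fin 3) : E3 := EuclideanSpace.single k 1

/-- The Laplacian, as the trace of the Hessian in the standard basis. -/
def lapl (f : E3 → ℝ) (x : E3) : ℝ := ∑ k, fderiv ℝ (fderiv ℝ f) x (eb k) (eb k)

/-- `f` is `C²` at `x` with gradient `g` and Laplacian `l` there. -/
def HasJ (f : E3 → ℝ) (x : E3) (g : E3) (l : ℝ) : Prop :=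
  ContDiffAt ℝ 2 f x ∧ HasFDerivAt f (innerSL ℝ g) x ∧ lapl f x = l

lemma sum_inner_eb (v w : E3) : ∑ k, ⟪v, eb k⟫ * ⟪w, eb k⟫ = ⟪v, w⟫ := by
  simp [PiLp.inner_apply, mul_comm]

lemma sum_sq_inner_eb (v : E3) : ∑ k, ⟪v, eb k⟫ ^ 2 = ‖v‖ ^ 2 := by
  have := sum_inner_eb v v
  rw [real_inner_self_eq_norm_sq] at this
  rw [← this]; simp [sq]

lemma lapl_eq_laplacian (f : E3 → ℝ) : lapl f = Laplacian.laplacian f := by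
  ext x
  rw [InnerProductSpace.laplacian_eq_iteratedFDeriv_orthonormalBasis f
    (EuclideanSpace.basisFun (Fin 3) ℝ)]
  simp [lapl, iteratedFDeriv_two_apply, EuclideanSpace.basisFun_apply]

lemma lapl_eq_sum_basis (f : E3 → ℝ) (v : OrthonormalBasis (Fin 3) ℝ E3) (x : E3) :
    lapl f x = ∑ k, fderiv ℝ (fderiv ℝ f) x (v k) (v k) := by
  rw [lapl_eq_laplacian, InnerProductSpace.laplacian_eq_iteratedFDeriv_orthonormalBasis f v]
  simp [iteratedFDeriv_two_apply]

lemma eventually_differentiableAt {f : E3 → ℝ} {x : E3} (hf : ContDiffAt ℝ 2 f x) :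
    ∀ᶠ y in 𝓝 x, DifferentiableAt ℝ f y :=
  (hf.eventually (by simp)).mono fun _ hy => hy.differentiableAt (by simp)

lemma differentiableAt_fderiv {f : E3 → ℝ} {x : E3} (hf : ContDiffAt ℝ 2 f x) :
    DifferentiableAt ℝ (fderiv ℝ f) x :=
  (hf.fderiv_right (m := 1) (by norm_num)).differentiableAt (by simp)

lemma hasJ_of_contDiffAt {f : E3 → ℝ} {x : E3} (hf : ContDiffAt ℝ 2 f x) :
    HasJ f x ((InnerProductSpace.toDual ℝ E3).symm (fderiv ℝ f x)) (lapl f x) := by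
  refine ⟨hf, ?_, rfl⟩
  have : innerSL ℝ ((InnerProductSpace.toDual ℝ E3).symm (fderiv ℝ f x)) = fderiv ℝ f x := by
    ext v; simp
  rw [this]
  exact (hf.differentiableAt (by simp)).hasFDerivAt

lemma lapl_congr {f g : E3 → ℝ} {x : E3} (h : f =ᶠ[𝓝 x] g) : lapl f x = lapl g x := by
  unfold lapl
  rw [(h.fderiv).fderiv_eq]

namespace HasJ

variable {f f₁ f₂ : E3 → ℝ} {x g g₁ g₂ : E3} {l l₁ l₂ : ℝ}

lemma fderiv_apply (h : HasJ f x g l) (v : E3) : fderiv ℝ f x v = ⟪g, v⟫ := by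
  rw [h.2.1.fderiv]; simp

lemma congr_val (h : HasJ f x g l) {g' : E3} {l' : ℝ} (hg : g = g') (hl : l = l') :
    HasJ f x g' l' := hg ▸ hl ▸ h

lemma congr_fun (h : HasJ f x g l) {f' : E3 → ℝ} (hf : f' =ᶠ[𝓝 x] f) : HasJ f' x g l :=
  ⟨h.1.congr_of_eventuallyEq hf, h.2.1.congr_of_eventuallyEq hf, (lapl_congr hf).trans h.2.2⟩

lemma const (c : ℝ) : HasJ (fun _ => c) x 0 0 := by
  refine ⟨contDiffAt_const, ?_, ?_⟩
  · simpa using hasFDerivAt_const c x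
  · simp [lapl]

lemma add (h₁ : HasJ f₁ x g₁ l₁) (h₂ : HasJ f₂ x g₂ l₂) :
    HasJ (fun y => f₁ y + f₂ y) x (g₁ + g₂) (l₁ + l₂) := by
  refine ⟨h₁.1.add h₂.1, ?_, ?_⟩
  · rw [map_add]; exact h₁.2.1.add h₂.2.1
  · have : fderiv ℝ (fun y => f₁ y + f₂ y) =ᶠ[𝓝 x] fun y => fderiv ℝ f₁ y + fderiv ℝ f₂ y := by
      filter_upwards [eventually_differentiableAt h₁.1, eventually_differentiableAt h₂.1]
        with y hy₁ hy₂
      exact fderiv_fun_add hy₁ hy₂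
    rw [← h₁.2.2, ← h₂.2.2]
    unfold lapl
    rw [this.fderiv_eq,
      fderiv_fun_add (differentiableAt_fderiv h₁.1) (differentiableAt_fderiv h₂.1)]
    simp [Finset.sum_add_distrib]

lemma mul (h₁ : HasJ f₁ x g₁ l₁) (h₂ : HasJ f₂ x g₂ l₂) :
    HasJ (fun y => f₁ y * f₂ y) x (f₁ x • g₂ + f₂ x • g₁)
      (f₁ x * l₂ + f₂ x * l₁ + 2 * ⟪g₁, g₂⟫) := by
  refine ⟨h₁.1.mul h₂.1, ?_, ?_⟩
  · have := h₁.2.1.mul h₂.2.1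
    rw [map_add, map_smul, map_smul]; exact this
  · have : fderiv ℝ (fun y => f₁ y * f₂ y) =ᶠ[𝓝 x]
        fun y => f₁ y • fderiv ℝ f₂ y + f₂ y • fderiv ℝ f₁ y := by
      filter_upwards [eventually_differentiableAt h₁.1, eventually_differentiableAt h₂.1]
        with y hy₁ hy₂
      exact fderiv_fun_mul hy₁ hy₂
    have d₁ := differentiableAt_fderiv h₁.1
    have d₂ := differentiableAt_fderiv h₂.1
    have e₁ := h₁.2.1.differentiableAt
    have e₂ := h₂.2.1.differentiableAt
    rw [← h₁.2.2, ← h₂.2.2, ← sum_inner_eb g₁ g₂]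
    unfold lapl
    rw [this.fderiv_eq, fderiv_fun_add (e₁.fun_smul d₂) (e₂.fun_smul d₁),
      fderiv_fun_smul e₁ d₂, fderiv_fun_smul e₂ d₁]
    simp only [add_apply, smul_apply,
      ContinuousLinearMap.smulRight_apply, smul_eq_mul, h₁.fderiv_apply, h₂.fderiv_apply]
    rw [Finset.mul_sum, Finset.mul_sum, Finset.mul_sum, ← Finset.sum_add_distrib,
      ← Finset.sum_add_distrib]
    refine Finset.sum_congr rfl fun k _ => ?_
    ring

lemma const_mul (c : ℝ) (h : HasJ f x g l) : HasJ (fun y => c * f y) x (c • g) (c * l) :=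
  ((const c).mul h).congr_val (by simp) (by simp)

lemma neg (h : HasJ f x g l) : HasJ (fun y => - f y) x (-g) (-l) := by
  have := (h.const_mul (-1)).congr_val (g' := -g) (l' := -l) (by simp) (by simp)
  exact this.congr_fun (Eventually.of_forall fun y => by simp)

lemma sub (h₁ : HasJ f₁ x g₁ l₁) (h₂ : HasJ f₂ x g₂ l₂) :
    HasJ (fun y => f₁ y - f₂ y) x (g₁ - g₂) (l₁ - l₂) := by
  have := (h₁.add h₂.neg).congr_val (g' := g₁ - g₂) (l' := l₁ - l₂) (by abel) (by ring)
  exact this.congr_fun (Eventually.of_forall fun y => by ring)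

lemma sum {ι : Type*} (s : Finset ι) {F : ι → E3 → ℝ} {G : ι → E3} {Λ : ι → ℝ}
    (h : ∀ i ∈ s, HasJ (F i) x (G i) (Λ i)) :
    HasJ (fun y => ∑ i ∈ s, F i y) x (∑ i ∈ s, G i) (∑ i ∈ s, Λ i) := by
  classical
  induction s using Finset.induction_on with
  | empty => simpa using const 0
  | insert a s ha ih =>
    simp only [Finset.sum_insert ha]
    exact (h a (Finset.mem_insert_self a s)).add
      (ih fun i hi => h i (Finset.mem_insert_of_mem hi))

lemma comp {G G' : ℝ → ℝ} {G'' : ℝ} (h : HasJ f x g l) (hG : ContDiffAt ℝ 2 G (f x))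
    (h₁ : ∀ᶠ y in 𝓝 (f x), HasDerivAt G (G' y) y) (h₂ : HasDerivAt G' G'' (f x)) :
    HasJ (fun y => G (f y)) x (G' (f x) • g) (G'' * ‖g‖ ^ 2 + G' (f x) * l) := by
  refine ⟨hG.comp x h.1, ?_, ?_⟩
  · rw [map_smul]; exact h₁.self_of_nhds.comp_hasFDerivAt x h.2.1
  · have : fderiv ℝ (fun y => G (f y)) =ᶠ[𝓝 x] fun y => G' (f y) • fderiv ℝ f y := by
      filter_upwards [eventually_differentiableAt h.1,
        h.1.continuousAt.eventually h₁] with y hy hy₁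
      exact (hy₁.comp_hasFDerivAt y hy.hasFDerivAt).fderiv
    have d := differentiableAt_fderiv h.1
    have e : HasFDerivAt (fun y => G' (f y)) (G'' • innerSL ℝ g) x := h₂.comp_hasFDerivAt x h.2.1
    rw [← h.2.2, ← sum_sq_inner_eb g]
    unfold lapl
    rw [this.fderiv_eq, fderiv_fun_smul e.differentiableAt d, e.fderiv]
    simp only [add_apply, smul_apply,
      ContinuousLinearMap.smulRight_apply, smul_eq_mul, h.fderiv_apply, innerSL_apply_apply]
    rw [Finset.mul_sum, Finset.mul_sum, ← Finset.sum_add_distrib]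
    refine Finset.sum_congr rfl fun k _ => ?_
    ring

lemma pow (n : ℕ) (h : HasJ f x g l) :
    HasJ (fun y => f y ^ n) x ((n * f x ^ (n - 1)) • g)
      (n * ((n - 1 : ℕ) * f x ^ (n - 1 - 1)) * ‖g‖ ^ 2 + n * f x ^ (n - 1) * l) :=
  h.comp (G := fun t => t ^ n) (G' := fun t => n * t ^ (n - 1))
    (contDiff_id.pow n).contDiffAt (Eventually.of_forall fun y => hasDerivAt_pow n y)
    ((hasDerivAt_pow (n - 1) (f x)).const_mul _)

lemma inner_left (n x : E3) : HasJ (fun y => ⟪n, y⟫) x n 0 := by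
  refine ⟨(innerSL ℝ n).contDiff.contDiffAt, (innerSL ℝ n).hasFDerivAt, ?_⟩
  have : fderiv ℝ (fun y => ⟪n, y⟫) = fun _ => innerSL ℝ n := by
    ext1 y; exact (innerSL ℝ n).fderiv
  simp [lapl, this]

lemma normSq (x : E3) : HasJ (fun y => ‖y‖ ^ 2) x ((2 : ℝ) • x) 6 := by
  have h : ∀ k : Fin 3, HasJ (fun y => ⟪eb k, y⟫ * ⟪eb k, y⟫) x
      (⟪eb k, x⟫ • eb k + ⟪eb k, x⟫ • eb k)
      (⟪eb k, x⟫ * 0 + ⟪eb k, x⟫ * 0 + 2 * ⟪eb k, eb k⟫) :=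
    fun k => (inner_left (eb k) x).mul (inner_left (eb k) x)
  have := HasJ.sum Finset.univ (fun k _ => h k)
  refine (this.congr_val ?_ ?_).congr_fun (Eventually.of_forall fun y => ?_)
  · ext i
    fin_cases i <;> simp [Fin.sum_univ_three, EuclideanSpace.inner_single_left] <;> ring
  · simp; norm_num
  · simp only [EuclideanSpace.norm_sq_eq, EuclideanSpace.inner_single_left]
    refine Finset.sum_congr rfl fun i _ => ?_
    simp [sq]

lemma norm_inv {x : E3} (hx : x ≠ 0) :
    HasJ (fun y => ‖y‖⁻¹) x (-(‖x‖⁻¹ ^ 3) • x) 0 := by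
  have hp : 0 < ‖x‖ := norm_pos_iff.2 hx
  have hq : 0 < ‖x‖ ^ 2 := by positivity
  have hG : ContDiffAt ℝ 2 (fun t : ℝ => (√t)⁻¹) (‖x‖ ^ 2) :=
    (Real.contDiffAt_sqrt hq.ne').inv (Real.sqrt_pos.2 hq).ne'
  have hd : ∀ t : ℝ, 0 < t → HasDerivAt (fun t : ℝ => (√t)⁻¹) (-(1 / 2) * (√t)⁻¹ ^ 3) t := by
    intro t ht
    have hs := (Real.sqrt_pos.2 ht)
    refine ((Real.hasDerivAt_sqrt ht.ne').fun_inv hs.ne').congr_deriv ?_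
    field_simp
  have h₂ : HasDerivAt (fun t : ℝ => -(1 / 2) * (√t)⁻¹ ^ 3)
      (3 / 4 * (√(‖x‖ ^ 2))⁻¹ ^ 5) (‖x‖ ^ 2) := by
    refine (((hd _ hq).fun_pow 3).const_mul (-(1 / 2))).congr_deriv ?_
    push_cast; ring
  have := (normSq x).comp hG ((lt_mem_nhds hq).mono fun t ht => hd t ht) h₂
  refine (this.congr_val ?_ ?_).congr_fun (Eventually.of_forall fun y => ?_)
  · rw [Real.sqrt_sq hp.le, smul_smul]; congr 1; ring
  · rw [Real.sqrt_sq hp.le, norm_smul]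
    field_simp
    norm_num
  · simp only; rw [Real.sqrt_sq (norm_nonneg y)]

end HasJ

lemma lapl_comp_affine {f : E3 → ℝ} (σ : E3 ≃ₗᵢ[ℝ] E3) (c : E3) (s : ℝ) {x : E3}
    (hf : ContDiffAt ℝ 2 f (c + s • σ x)) :
    ContDiffAt ℝ 2 (fun y => f (c + s • σ y)) x ∧
    lapl (fun y => f (c + s • σ y)) x = s ^ 2 * lapl f (c + s • σ x) := by
  set S : E3 →L[ℝ] E3 := s • (σ : E3 →L[ℝ] E3) with hS
  have hA : ∀ y, HasFDerivAt (fun y => c + s • σ y) S y := by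
    intro y
    exact ((σ : E3 →L[ℝ] E3).hasFDerivAt.const_smul s).const_add c
  have hAc : ContDiff ℝ 2 (fun y : E3 => c + s • σ y) := by fun_prop
  refine ⟨hf.comp x hAc.contDiffAt, ?_⟩
  have h1 : fderiv ℝ (fun y => f (c + s • σ y)) =ᶠ[𝓝 x]
      fun y => (fderiv ℝ f (c + s • σ y)).comp S := by
    filter_upwards [hAc.continuous.continuousAt.eventually (eventually_differentiableAt hf)]
      with y hy
    exact (hy.hasFDerivAt.comp y (hA y)).fderiv
  have h2 := (differentiableAt_fderiv hf).hasFDerivAt.comp x (hA x)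
  have h3 := h2.clm_comp (hasFDerivAt_const S x)
  rw [lapl_eq_sum_basis f ((EuclideanSpace.basisFun (Fin 3) ℝ).map σ), lapl, h1.fderiv_eq,
    Finset.mul_sum]
  refine Finset.sum_congr rfl fun k _ => ?_
  have h4 : fderiv ℝ (fun y => (fderiv ℝ f (c + s • σ y)).comp S) x = _ := h3.fderiv
  rw [h4]
  simp [hS, EuclideanSpace.basisFun_apply]
  ring

lemma lapl_nonpos_of_isLocalMax {f : E3 → ℝ} {x : E3} (hf : ContDiffAt ℝ 2 f x)
    (h : IsLocalMax f x) : lapl f x ≤ 0 := by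
  refine Finset.sum_nonpos fun k _ => ?_
  by_contra! hpos
  set γ : ℝ → E3 := fun t => x + t • eb k with hγ
  have hγ0 : γ 0 = x := by simp [hγ]
  have hγd : ∀ t, HasDerivAt γ (eb k) t := by
    intro t
    have := ((hasDerivAt_id t).smul_const (eb k)).const_add x
    rwa [one_smul] at this
  have hγc : ContinuousAt γ 0 := (hγd 0).continuousAt
  have hφ : ∀ᶠ t in 𝓝 (0 : ℝ), HasDerivAt (fun t => f (γ t)) (fderiv ℝ f (γ t) (eb k)) t := by
    have := hγc.tendsto
    rw [hγ0] at this
    filter_upwards [this.eventually (eventually_differentiableAt hf)] with t ht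
    exact ht.hasFDerivAt.comp_hasDerivAt t (hγd t)
  have hmax : IsLocalMax (fun t => f (γ t)) 0 := by
    have := hγc.tendsto
    rw [hγ0] at this
    have h2 := this.eventually h
    filter_upwards [h2] with t ht
    simpa [hγ0] using ht
  have hd : deriv (fun t => f (γ t)) =ᶠ[𝓝 0] fun t => fderiv ℝ f (γ t) (eb k) :=
    hφ.mono fun t ht => ht.deriv
  have h2 : HasDerivAt (fun t => fderiv ℝ f (γ t) (eb k))
      (fderiv ℝ (fderiv ℝ f) x (eb k) (eb k)) 0 := by
    have e := (differentiableAt_fderiv hf).hasFDerivAt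
    rw [← hγ0] at e
    have := (e.comp_hasDerivAt (0 : ℝ) (hγd 0)).clm_apply (hasDerivAt_const (0 : ℝ) (eb k))
    simpa [hγ0] using this
  have hdd : deriv (deriv (fun t => f (γ t))) 0 = fderiv ℝ (fderiv ℝ f) x (eb k) (eb k) := by
    rw [hd.deriv_eq]; exact h2.deriv
  have hmin := isLocalMin_of_deriv_deriv_pos (f := fun t => f (γ t)) (x₀ := 0) (by rwa [hdd])
    hmax.deriv_eq_zero hφ.self_of_nhds.continuousAt
  have hconst : (fun t => f (γ t)) =ᶠ[𝓝 0] fun _ => f (γ 0) := by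
    filter_upwards [hmin, hmax] with t h1 h2
    exact le_antisymm h2 h1
  have : deriv (deriv (fun t => f (γ t))) 0 = 0 := by
    rw [hconst.deriv.deriv_eq]; simp
  rw [hdd] at this
  linarith

/-! ### The exterior domain -/

lemma mem_Omega {x : E3} : x ∈ Omega ↔ 1 < ‖x‖ := Iff.rfl

lemma mem_OmegaBar {x : E3} : x ∈ OmegaBar ↔ 1 ≤ ‖x‖ := Iff.rfl

lemma Omega_subset : Omega ⊆ OmegaBar := fun _ hx => le_of_lt (mem_Omega.1 hx)

lemma isOpen_Omega : IsOpen Omega := isOpen_lt continuous_const continuous_norm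

lemma Omega_mem_nhds {x : E3} (hx : x ∈ Omega) : Omega ∈ 𝓝 x := isOpen_Omega.mem_nhds hx

lemma OmegaBar_mem_nhds {x : E3} (hx : x ∈ Omega) : OmegaBar ∈ 𝓝 x :=
  mem_of_superset (Omega_mem_nhds hx) Omega_subset

lemma ne_zero_of_mem {x : E3} (hx : x ∈ OmegaBar) : x ≠ 0 := by
  rintro rfl
  have := mem_OmegaBar.1 hx
  simp at this
  linarith

lemma uniqueDiffOn_OmegaBar : UniqueDiffOn ℝ OmegaBar := by
  intro x hx
  have hx1 := mem_OmegaBar.1 hx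
  set S : Set E3 := {y | ‖x‖ ^ 2 ≤ ⟪x, y⟫} with hS
  have hSsub : S ⊆ OmegaBar := by
    intro y hy
    have h1 : ‖x‖ ^ 2 ≤ ‖x‖ * ‖y‖ := le_trans hy (real_inner_le_norm x y)
    rw [mem_OmegaBar]
    nlinarith
  have hconv : Convex ℝ S := by
    intro y hy z hz a b ha hb hab
    simp only [hS, mem_ofPred_eq, inner_add_right, inner_smul_right] at *
    have : ‖x‖ ^ 2 = a * ‖x‖ ^ 2 + b * ‖x‖ ^ 2 := by rw [← add_mul, hab, one_mul]
    rw [this]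
    gcongr
  have hint : (interior S).Nonempty := by
    refine ⟨(2 : ℝ) • x, ?_⟩
    have ho : IsOpen {y : E3 | ‖x‖ ^ 2 < ⟪x, y⟫} :=
      isOpen_lt continuous_const (by fun_prop)
    refine interior_maximal
      (show {y : E3 | ‖x‖ ^ 2 < ⟪x, y⟫} ⊆ S from
        fun y (hy : ‖x‖ ^ 2 < ⟪x, y⟫) => show ‖x‖ ^ 2 ≤ ⟪x, y⟫ from hy.le) ho ?_
    simp only [mem_ofPred_eq, inner_smul_right, real_inner_self_eq_norm_sq]
    nlinarith
  have hxS : x ∈ S := by simp [hS]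
  exact (uniqueDiffWithinAt_convex hconv hint (subset_closure hxS)).mono hSsub

lemma contDiffAt_of_mem {u : E3 → ℝ} {n : WithTop ℕ∞} (hu : ContDiffOn ℝ n u OmegaBar) {x : E3}
    (hx : x ∈ Omega) : ContDiffAt ℝ n u x :=
  hu.contDiffAt (OmegaBar_mem_nhds hx)

lemma fderivWithin_eq {u : E3 → ℝ} {x : E3} (hx : x ∈ Omega) :
    fderivWithin ℝ u OmegaBar x = fderiv ℝ u x :=
  fderivWithin_of_mem_nhds (OmegaBar_mem_nhds hx)

lemma pd_eq {u : E3 → ℝ} (k : Fin 3) {x : E3} (hx : x ∈ Omega) :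
    pd u k x = fderiv ℝ u x (eb k) := by
  simp [pd, fderivWithin_eq hx]

lemma lap3_eq {u : E3 → ℝ} {x : E3} (hx : x ∈ Omega) (hu : ContDiffAt ℝ 2 u x) :
    lap3 u x = lapl u x := by
  refine Finset.sum_congr rfl fun k _ => ?_
  rw [pd_eq k hx]
  have h : pd u k =ᶠ[𝓝 x] fun y => fderiv ℝ u y (eb k) := by
    filter_upwards [Omega_mem_nhds hx] with y hy using pd_eq k hy
  rw [h.fderiv_eq]
  have := (differentiableAt_fderiv hu).hasFDerivAt.clm_apply (hasFDerivAt_const (eb k) x)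
  rw [this.fderiv]
  simp

/-- The derivative in the radial direction, `x · ∇u`, one-sided on the unit sphere. -/
def rad (u : E3 → ℝ) (x : E3) : ℝ := fderivWithin ℝ u OmegaBar x x

lemma rad_eq {u : E3 → ℝ} {x : E3} (hx : x ∈ Omega) : rad u x = fderiv ℝ u x x := by
  simp [rad, fderivWithin_eq hx]

lemma smul_mem_OmegaBar {x : E3} (hx : x ∈ OmegaBar) {s : ℝ} (hs : 1 ≤ s) : s • x ∈ OmegaBar := by
  rw [mem_OmegaBar] at *
  rw [norm_smul, Real.norm_of_nonneg (by linarith)]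
  nlinarith

lemma smul_mem_Omega {x : E3} (hx : x ∈ OmegaBar) {s : ℝ} (hs : 1 < s) : s • x ∈ Omega := by
  rw [mem_OmegaBar] at hx
  rw [mem_Omega, norm_smul, Real.norm_of_nonneg (by linarith)]
  nlinarith

lemma hasDerivWithinAt_ray {u : E3 → ℝ} {x : E3} (hx : x ∈ OmegaBar)
    (hu : DifferentiableWithinAt ℝ u OmegaBar x) :
    HasDerivWithinAt (fun s : ℝ => u (s • x)) (rad u x) (Ici 1) 1 := by
  have h1 : HasDerivWithinAt (fun s : ℝ => s • x) x (Ici 1) 1 := by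
    have := (hasDerivAt_id (1 : ℝ)).smul_const x
    rw [one_smul] at this
    exact this.hasDerivWithinAt
  have h2 := hu.hasFDerivWithinAt
  rw [← one_smul ℝ x] at h2
  have h3 := h2.comp_hasDerivWithinAt (1 : ℝ) h1 (fun s hs => smul_mem_OmegaBar hx hs)
  have h4 : HasDerivWithinAt (fun s : ℝ => u (s • x))
      (fderivWithin ℝ u OmegaBar ((1 : ℝ) • x) x) (Ici 1) 1 := h3
  rw [one_smul] at h4
  exact h4

lemma deriv_nonpos_of_right_max {F : ℝ → ℝ} {F' a : ℝ} (h : HasDerivWithinAt F F' (Ici a) a)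
    (hmax : ∀ᶠ s in 𝓝[>] a, F s ≤ F a) : F' ≤ 0 := by
  have h1 := (hasDerivWithinAt_iff_tendsto_slope.1 h)
  have h2 : Ici a \ {a} = Ioi a := by
    ext; simp only [Set.mem_sdiff, mem_Ici, mem_singleton_iff, mem_Ioi]
    exact ⟨fun h => lt_of_le_of_ne h.1 (Ne.symm h.2), fun h => ⟨h.le, h.ne'⟩⟩
  rw [h2] at h1
  refine le_of_tendsto h1 ?_
  filter_upwards [hmax, self_mem_nhdsWithin] with s hs hsa
  rw [slope_def_field]
  exact div_nonpos_of_nonpos_of_nonneg (by linarith) (by have : a < s := hsa; linarith)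

/-- At a one-sided radial maximum, the radial derivative is nonpositive. -/
lemma rad_nonpos_of_max {u : E3 → ℝ} {x : E3} {p : ℝ → ℝ} {p' : ℝ} (hx : x ∈ OmegaBar)
    (hu : DifferentiableWithinAt ℝ u OmegaBar x) (hp : HasDerivAt p p' 1)
    (hmax : ∀ᶠ s in 𝓝[>] (1 : ℝ), u (s • x) - p s ≤ u x - p 1) : rad u x ≤ p' := by
  have := deriv_nonpos_of_right_max ((hasDerivWithinAt_ray hx hu).sub hp.hasDerivWithinAt)
    (by simpa using hmax)
  linarith

/-! ### Reflections -/

/-- Reflection across the plane orthogonal to a unit vector `n`. -/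
def planeRefl (n : E3) : E3 ≃ₗᵢ[ℝ] E3 := (ℝ ∙ n)ᗮ.reflection

lemma planeRefl_apply {n : E3} (hn : ‖n‖ = 1) (x : E3) : planeRefl n x = x - (2 * ⟪n, x⟫) • n := by
  rw [planeRefl, Submodule.reflection_orthogonal_apply, Submodule.reflection_singleton_apply]
  simp [hn, two_smul, two_mul, add_smul]

/-! ### The interior gradient estimate -/

lemma interior_grad_aux {u : E3 → ℝ} {d m N : ℝ} (hd : 0 < d) (hN : 0 < N)
    (hu : ∀ x, ‖x‖ ≤ d → ContDiffAt ℝ 2 u x) (hm : ∀ x, ‖x‖ ≤ d → |u x| ≤ m)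
    (hΔ : ∀ x, ‖x‖ ≤ d → |lapl u x| ≤ N) {n : E3} (hn : ‖n‖ = 1) :
    fderiv ℝ u 0 n ≤ 3 * m / d + N * d := by
  have hm0 : 0 ≤ m := (abs_nonneg _).trans (hm 0 (by simpa using hd.le))
  set α := 2 * m / d ^ 2 with hα
  have hα0 : 0 ≤ α := by positivity
  set γ := 3 * α + 2 * N with hγ
  have hγ0 : 0 < γ := by positivity
  set β := γ * d with hβ
  set σ := planeRefl n with hσ
  set w : E3 → ℝ := fun x => u x - u ((0 : E3) + (1 : ℝ) • σ x)
    - (α * ‖x‖ ^ 2 + β * ⟪n, x⟫ - γ * (⟪n, x⟫ * ⟪n, x⟫)) with hw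
  have hσn : ∀ x, ‖(0 : E3) + (1 : ℝ) • σ x‖ = ‖x‖ := fun x => by simp
  have hJ : ∀ x, ‖x‖ ≤ d → ContDiffAt ℝ 2 w x ∧ lapl w x =
      lapl u x - lapl u ((0 : E3) + (1 : ℝ) • σ x) - (6 * α - 2 * γ) := by
    intro x hx
    have h1 := lapl_comp_affine σ 0 1 (hu ((0 : E3) + (1 : ℝ) • σ x) (by rwa [hσn]))
    have h2 := ((hasJ_of_contDiffAt (hu x hx)).sub (hasJ_of_contDiffAt h1.1)).sub
      ((((HasJ.normSq x).const_mul α).add ((HasJ.inner_left n x).const_mul β)).sub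
        (((HasJ.inner_left n x).mul (HasJ.inner_left n x)).const_mul γ))
    refine ⟨h2.1, h2.2.2.trans ?_⟩
    rw [h1.2, real_inner_self_eq_norm_sq, hn]
    ring
  set K : Set E3 := closedBall 0 d ∩ {x | 0 ≤ ⟪n, x⟫} with hK
  have hKc : IsCompact K := (isCompact_closedBall 0 d).inter_right
    (isClosed_le continuous_const (by fun_prop))
  have hKn : ∀ x ∈ K, ‖x‖ ≤ d := fun x hx => by simpa using hx.1
  have h0K : (0 : E3) ∈ K := by simp [hK, hd.le]
  obtain ⟨y, hyK, hy⟩ := hKc.exists_isMaxOn ⟨0, h0K⟩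
    (fun x hx => (hJ x (hKn x hx)).1.continuousAt.continuousWithinAt)
  have hwy : w y ≤ 0 := by
    by_contra! hpos
    have hyd := hKn y hyK
    have ht0 : 0 ≤ ⟪n, y⟫ := hyK.2
    have htle : ⟪n, y⟫ ≤ ‖y‖ := by simpa [hn] using real_inner_le_norm n y
    have htpos : 0 < ⟪n, y⟫ := by
      refine lt_of_le_of_ne ht0 fun h => ?_
      have : σ y = y := by rw [hσ, planeRefl_apply hn, ← h]; simp
      simp only [hw, this, ← h] at hpos
      have : 0 ≤ α * ‖y‖ ^ 2 := by positivity
      simp at hpos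
      linarith
    have hylt : ‖y‖ < d := by
      refine lt_of_le_of_ne hyd fun h => ?_
      have h1 := abs_le.1 (hm y hyd)
      have h2 := abs_le.1 (hm ((0 : E3) + (1 : ℝ) • σ y) (by rwa [hσn]))
      have h3 : α * d ^ 2 = 2 * m := by rw [hα]; field_simp
      have h4 : 0 ≤ γ * ⟪n, y⟫ * (d - ⟪n, y⟫) :=
        mul_nonneg (mul_nonneg hγ0.le ht0) (by linarith)
      simp only [hw, h] at hpos
      nlinarith
    have hnhds : K ∈ 𝓝 y := by
      refine inter_mem ?_ ?_
      · exact mem_of_superset (isOpen_ball.mem_nhds (by simpa using hylt)) ball_subset_closedBall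
      · exact mem_of_superset ((isOpen_lt continuous_const
          (show Continuous fun x : E3 => ⟪n, x⟫ by fun_prop)).mem_nhds htpos)
          fun x (hx : 0 < ⟪n, x⟫) => show 0 ≤ ⟪n, x⟫ from hx.le
    have hl := lapl_nonpos_of_isLocalMax (hJ y hyd).1 (hy.isLocalMax hnhds)
    rw [(hJ y hyd).2] at hl
    have h1 := abs_le.1 (hΔ y hyd)
    have h2 := abs_le.1 (hΔ ((0 : E3) + (1 : ℝ) • σ y) (by rwa [hσn]))
    linarith
  have hder : HasDerivAt (fun s : ℝ => w (s • n)) (2 * fderiv ℝ u 0 n - β) 0 := by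
    have hu0 := ((hu 0 (by simpa using hd.le)).differentiableAt (by simp)).hasFDerivAt
    have e1 : HasDerivAt (fun s : ℝ => s • n) n 0 := by
      have := (hasDerivAt_id (0 : ℝ)).smul_const n
      rwa [one_smul] at this
    have e2 : HasDerivAt (fun s : ℝ => s • (-n)) (-n) 0 := by
      have := (hasDerivAt_id (0 : ℝ)).smul_const (-n)
      rwa [one_smul] at this
    have hu1 : HasFDerivAt u (fderiv ℝ u 0) ((0 : ℝ) • n) := by simpa using hu0
    have hu2 : HasFDerivAt u (fderiv ℝ u 0) ((0 : ℝ) • (-n)) := by simpa using hu0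
    have f1 := (hu1.comp_hasDerivAt (0 : ℝ) e1).sub (hu2.comp_hasDerivAt (0 : ℝ) e2)
    have f2 : HasDerivAt (fun s : ℝ => α * s ^ 2 + β * s - γ * (s * s)) β 0 := by
      have := (((hasDerivAt_id (0 : ℝ)).pow 2).const_mul α).add
        ((hasDerivAt_id (0 : ℝ)).const_mul β) |>.sub
        (((hasDerivAt_id (0 : ℝ)).mul (hasDerivAt_id (0 : ℝ))).const_mul γ)
      refine this.congr_deriv ?_
      simp
    refine ((f1.sub f2).congr_deriv ?_).congr_of_eventuallyEq (Eventually.of_forall fun s => ?_)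
    · simp; ring
    · have hs : σ (s • n) = s • (-n) := by
        rw [hσ, planeRefl_apply hn, inner_smul_right, real_inner_self_eq_norm_sq, hn, ← sub_smul]
        rw [smul_neg, ← neg_smul]; congr 1; ring
      simp only [hw, hs]
      simp [norm_smul, hn, inner_smul_right]
  have hle := deriv_nonpos_of_right_max (hder.hasDerivWithinAt (s := Ici 0)) (by
    have hs : ∀ᶠ s in 𝓝[>] (0 : ℝ), s < d := nhdsWithin_le_nhds (gt_mem_nhds hd)
    filter_upwards [hs, self_mem_nhdsWithin] with s hsd hs0
    have hs0' : (0 : ℝ) < s := hs0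
    have hmem : s • n ∈ K := by
      refine ⟨by simp [norm_smul, hn, abs_of_pos hs0', hsd.le], ?_⟩
      simp [inner_smul_right, hn, hs0'.le]
    have h1 : w (s • n) ≤ w y := hy hmem
    have h2 : w ((0 : ℝ) • n) = 0 := by simp [hw]
    rw [h2]; linarith)
  have hβ' : β = 6 * m / d + 2 * (N * d) := by
    rw [hβ, hγ, hα]; field_simp; ring
  have : 2 * (3 * m / d) = 6 * m / d := by ring
  linarith

lemma interior_grad {u : E3 → ℝ} {x₁ : E3} {d m N : ℝ} (hd : 0 < d) (hN : 0 < N)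
    (hu : ∀ x, ‖x - x₁‖ ≤ d → ContDiffAt ℝ 2 u x) (hm : ∀ x, ‖x - x₁‖ ≤ d → |u x| ≤ m)
    (hΔ : ∀ x, ‖x - x₁‖ ≤ d → |lapl u x| ≤ N) {n : E3} (hn : ‖n‖ = 1) :
    |fderiv ℝ u x₁ n| ≤ 3 * m / d + N * d := by
  set v : E3 → ℝ := fun y => u (x₁ + (1 : ℝ) • LinearIsometryEquiv.refl ℝ E3 y) with hv
  have hx : ∀ y : E3, ‖y‖ ≤ d → ‖x₁ + (1 : ℝ) • LinearIsometryEquiv.refl ℝ E3 y - x₁‖ ≤ d := by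
    intro y hy; simpa using hy
  have hC : ∀ y, ‖y‖ ≤ d → ContDiffAt ℝ 2 v y ∧ lapl v y =
      1 ^ 2 * lapl u (x₁ + (1 : ℝ) • LinearIsometryEquiv.refl ℝ E3 y) := fun y hy =>
    lapl_comp_affine (LinearIsometryEquiv.refl ℝ E3) x₁ 1 (hu _ (hx y hy))
  have hfd : fderiv ℝ v 0 = fderiv ℝ u x₁ := by
    have : v = fun y => u (x₁ + y) := by ext; simp [hv]
    rw [this, fderiv_comp_add_left]; simp
  have key : ∀ n : E3, ‖n‖ = 1 → fderiv ℝ v 0 n ≤ 3 * m / d + N * d := fun n hn =>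
    interior_grad_aux hd hN (fun y hy => (hC y hy).1) (fun y hy => hm _ (hx y hy))
      (fun y hy => by rw [(hC y hy).2, one_pow, one_mul]; exact hΔ _ (hx y hy)) hn
  rw [← hfd, abs_le]
  have h1 := key n hn
  have h2 := key (-n) (by simpa using hn)
  rw [map_neg] at h2
  exact ⟨by linarith, h1⟩

/-! ### Gradient estimates up to the boundary -/

/-- `u` satisfies the Robin condition `κ ∂ᵣu = u` on the unit sphere, and `|u| ≤ m`, `|Δu| ≤ N`
in the annulus `1 < |x| < 1 + 2H`. -/
structure RobinAnnulus (u : E3 → ℝ) (κ H m N : ℝ) : Prop where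
  smooth : ContDiffOn ℝ 2 u OmegaBar
  kappa_nonneg : 0 ≤ κ
  robin : ∀ x, ‖x‖ = 1 → κ * rad u x = u x
  H_pos : 0 < H
  H_le : H ≤ 1 / 10
  N_pos : 0 < N
  bound : ∀ x, 1 ≤ ‖x‖ → ‖x‖ ≤ 1 + 2 * H → |u x| ≤ m
  lapl_bound : ∀ x, 1 < ‖x‖ → ‖x‖ < 1 + 2 * H → |lapl u x| ≤ N

lemma continuousOn_rad {u : E3 → ℝ} (hu : ContDiffOn ℝ 2 u OmegaBar) :
    ContinuousOn (rad u) OmegaBar :=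
  (hu.continuousOn_fderivWithin uniqueDiffOn_OmegaBar (by simp)).clm_apply continuousOn_id

lemma forall_nonpos_of_max {K : Set E3} (hK : IsCompact K) {w : E3 → ℝ} (hw : ContinuousOn w K)
    (h : ∀ y ∈ K, IsMaxOn w K y → w y ≤ 0) : ∀ y ∈ K, w y ≤ 0 := by
  intro y hy
  obtain ⟨z, hz, hmax⟩ := hK.exists_isMaxOn ⟨y, hy⟩ hw
  exact (hmax hy).trans (h z hz hmax)

lemma isCompact_annulus (a b : ℝ) : IsCompact {x : E3 | a ≤ ‖x‖ ∧ ‖x‖ ≤ b} := by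
  have : {x : E3 | a ≤ ‖x‖ ∧ ‖x‖ ≤ b} = closedBall 0 b ∩ {x | a ≤ ‖x‖} := by
    ext x; simp [and_comm]
  rw [this]
  exact (isCompact_closedBall 0 b).inter_right (isClosed_le continuous_const continuous_norm)

lemma annulus_mem_nhds {a b : ℝ} {x : E3} (h1 : a < ‖x‖) (h2 : ‖x‖ < b) :
    {x : E3 | a ≤ ‖x‖ ∧ ‖x‖ ≤ b} ∈ 𝓝 x := by
  filter_upwards [continuous_norm.continuousAt.eventually (lt_mem_nhds h1),
    continuous_norm.continuousAt.eventually (gt_mem_nhds h2)] with y hy1 hy2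
  exact ⟨hy1.le, hy2.le⟩

lemma rad_neg {u : E3 → ℝ} {x : E3} (hx : x ∈ OmegaBar) : rad (fun y => -u y) x = -rad u x := by
  simp [rad, fderivWithin_fun_neg (uniqueDiffOn_OmegaBar x hx)]

lemma RobinAnnulus.neg {u : E3 → ℝ} {κ H m N : ℝ} (h : RobinAnnulus u κ H m N) :
    RobinAnnulus (fun x => -u x) κ H m N where
  smooth := h.smooth.neg
  kappa_nonneg := h.kappa_nonneg
  robin x hx := by rw [rad_neg hx.ge, mul_neg, h.robin x hx]
  H_pos := h.H_pos
  H_le := h.H_le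
  N_pos := h.N_pos
  bound x hx hx' := by rw [abs_neg]; exact h.bound x hx hx'
  lapl_bound x hx hx' := by
    rw [(hasJ_of_contDiffAt (contDiffAt_of_mem h.smooth hx)).neg.2.2, abs_neg]
    exact h.lapl_bound x hx hx'

namespace RobinAnnulus

variable {u : E3 → ℝ} {κ H m N : ℝ}

lemma m_nonneg (h : RobinAnnulus u κ H m N) : 0 ≤ m :=
  (abs_nonneg _).trans (h.bound (eb 0) (by simp) (by simpa using h.H_pos.le))

lemma contDiffAt (h : RobinAnnulus u κ H m N) {x : E3} (hx : 1 < ‖x‖) : ContDiffAt ℝ 2 u x :=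
  contDiffAt_of_mem h.smooth hx

lemma differentiableWithinAt (h : RobinAnnulus u κ H m N) {x : E3} (hx : 1 ≤ ‖x‖) :
    DifferentiableWithinAt ℝ u OmegaBar x :=
  h.smooth.differentiableOn (by simp) x hx

lemma grad_le_of_interior (h : RobinAnnulus u κ H m N) {p : E3} (h1 : 1 + H / 2 ≤ ‖p‖)
    (h2 : ‖p‖ ≤ 1 + H) {n : E3} (hn : ‖n‖ = 1) :
    |fderiv ℝ u p n| ≤ 12 * m / H + N * H / 4 := by
  have hH := h.H_pos
  have hb : ∀ x, ‖x - p‖ ≤ H / 4 → 1 < ‖x‖ ∧ ‖x‖ < 1 + 2 * H := by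
    intro x hx
    have e1 := norm_sub_norm_le p x
    have e2 := norm_sub_norm_le x p
    rw [norm_sub_rev] at e1
    constructor <;> linarith
  have := interior_grad (u := u) (x₁ := p) (d := H / 4) (m := m) (by positivity) h.N_pos
    (fun x hx => h.contDiffAt (hb x hx).1)
    (fun x hx => h.bound x (hb x hx).1.le (hb x hx).2.le)
    (fun x hx => h.lapl_bound x (hb x hx).1 (hb x hx).2) hn
  refine this.trans (le_of_eq ?_)
  field_simp; ring

/-- On the unit sphere, the radial derivative is controlled by the data. -/
lemma rad_le_sphere_aux (h : RobinAnnulus u κ H m N) {x : E3} (hx : ‖x‖ = 1) :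
    rad u x ≤ 2 * (m / H + N * H) := by
  have hH := h.H_pos
  have hH1 := h.H_le
  have hN := h.N_pos
  have hm := h.m_nonneg
  set K₀ := 2 * (m / H + N * H) with hK₀
  have hK₀p : 0 < K₀ := by positivity
  set γ := (N + 3 * K₀) / 4 with hγ
  set w : E3 → ℝ := fun x => u x - (κ * K₀ + K₀ / 2 * (‖x‖ ^ 2 - 1)
    - γ * ((‖x‖ ^ 2 - 1) * (‖x‖ ^ 2 - 1))) with hw
  set K : Set E3 := {x | 1 ≤ ‖x‖ ∧ ‖x‖ ≤ 1 + H} with hK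
  have hKsub : K ⊆ OmegaBar := fun x hx => hx.1
  have key : ∀ y ∈ K, w y ≤ 0 := by
    refine forall_nonpos_of_max (isCompact_annulus _ _) ?_ fun y hy hmax => ?_
    · have := h.smooth.continuousOn.mono hKsub
      fun_prop
    by_contra! hpos
    rcases hy.1.eq_or_lt with h1 | h1
    · have hr : rad u y ≤ K₀ := by
        have hp : HasDerivAt (fun s : ℝ => κ * K₀ + K₀ / 2 * (s ^ 2 - 1)
            - γ * ((s ^ 2 - 1) * (s ^ 2 - 1))) K₀ 1 := by
          have e := ((hasDerivAt_id (1 : ℝ)).fun_pow 2).sub_const 1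
          refine (((e.const_mul (K₀ / 2)).const_add (κ * K₀)).fun_sub
            ((e.fun_mul e).const_mul γ)).congr_deriv ?_
          simp
        refine rad_nonpos_of_max hy.1 (h.differentiableWithinAt hy.1) hp ?_
        have : ∀ᶠ s in 𝓝[>] (1 : ℝ), s < 1 + H := nhdsWithin_le_nhds (gt_mem_nhds (by linarith))
        filter_upwards [this, self_mem_nhdsWithin] with s hs hs1
        have hs1' : (1 : ℝ) < s := hs1
        have hn : ‖s • y‖ = s := by
          rw [norm_smul, ← h1, mul_one, Real.norm_of_nonneg (by linarith)]
        have hle : w (s • y) ≤ w y := hmax (show s • y ∈ K from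
          ⟨by rw [hn]; exact hs1'.le, by rw [hn]; exact hs.le⟩)
        simp only [hw, hn, ← h1] at hle
        exact hle
      have e := h.robin y h1.symm
      have := mul_le_mul_of_nonneg_left hr h.kappa_nonneg
      simp only [hw, ← h1] at hpos
      norm_num at hpos
      linarith
    rcases hy.2.eq_or_lt with h2 | h2
    · have e := (abs_le.1 (h.bound y hy.1 (by linarith))).2
      have e2 : K₀ * H = 2 * m + 2 * N * H ^ 2 := by rw [hK₀]; field_simp
      simp only [hw, h2] at hpos
      have e3 : 0 ≤ κ * K₀ := mul_nonneg h.kappa_nonneg hK₀p.le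
      have e4 : ((1 + H) ^ 2 - 1) * ((1 + H) ^ 2 - 1) ≤ 4.41 * H ^ 2 := by
        have : 0 ≤ (1 + H) ^ 2 - 1 := by nlinarith
        have : (1 + H) ^ 2 - 1 ≤ 2.1 * H := by nlinarith
        nlinarith
      have e5 : γ * (((1 + H) ^ 2 - 1) * ((1 + H) ^ 2 - 1)) ≤ γ * (4.41 * H ^ 2) :=
        mul_le_mul_of_nonneg_left e4 (by positivity)
      have e6 : K₀ * H ^ 2 ≤ K₀ * H / 10 := by nlinarith
      have e7 : K₀ * H ≤ K₀ / 2 * ((1 + H) ^ 2 - 1) := by nlinarith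
      have e8 : γ * (4.41 * H ^ 2) = 1.1025 * (N * H ^ 2) + 3.3075 * (K₀ * H ^ 2) := by
        rw [hγ]; ring
      have e9 : 0 ≤ N * H ^ 2 := by positivity
      linarith
    · have hq := (HasJ.normSq y).sub (HasJ.const (x := y) 1)
      have hJ := (hasJ_of_contDiffAt (h.contDiffAt h1)).sub
        (((HasJ.const (κ * K₀)).add (hq.const_mul (K₀ / 2))).sub ((hq.mul hq).const_mul γ))
      have hl := lapl_nonpos_of_isLocalMax hJ.1 (hmax.isLocalMax (annulus_mem_nhds h1 h2))
      rw [hJ.2.2] at hl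
      simp only [sub_zero, inner_smul_left, inner_smul_right, real_inner_self_eq_norm_sq,
        conj_trivial] at hl
      have e := abs_le.1 (h.lapl_bound y h1 (by linarith))
      have e1 : 0 ≤ γ * (‖y‖ ^ 2 - 1) := mul_nonneg (by positivity) (by nlinarith)
      nlinarith
  rcases h.kappa_nonneg.eq_or_lt with h0 | h0
  · have hp : HasDerivAt (fun s : ℝ => K₀ / 2 * (s ^ 2 - 1)
        - γ * ((s ^ 2 - 1) * (s ^ 2 - 1))) K₀ 1 := by
      have e := ((hasDerivAt_id (1 : ℝ)).fun_pow 2).sub_const 1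
      refine ((e.const_mul (K₀ / 2)).fun_sub ((e.fun_mul e).const_mul γ)).congr_deriv ?_
      simp
    refine rad_nonpos_of_max hx.ge (h.differentiableWithinAt hx.ge) hp ?_
    have : ∀ᶠ s in 𝓝[>] (1 : ℝ), s < 1 + H := nhdsWithin_le_nhds (gt_mem_nhds (by linarith))
    filter_upwards [this, self_mem_nhdsWithin] with s hs hs1
    have hs1' : (1 : ℝ) < s := hs1
    have hn : ‖s • x‖ = s := by
      rw [norm_smul, hx, mul_one, Real.norm_of_nonneg (by linarith)]
    have hle : w (s • x) ≤ 0 := key (s • x)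
      ⟨by rw [hn]; exact hs1'.le, by rw [hn]; exact hs.le⟩
    have hu0 : u x = 0 := by rw [← h.robin x hx, ← h0, zero_mul]
    simp only [hw, hn, ← h0] at hle
    rw [hu0]
    norm_num at hle ⊢
    linarith
  · have hle := key x ⟨hx.ge, by linarith⟩
    simp only [hw, hx] at hle
    have e := h.robin x hx
    norm_num at hle
    rw [← e] at hle
    exact le_of_mul_le_mul_left hle h0

lemma rad_le_sphere (h : RobinAnnulus u κ H m N) {x : E3} (hx : ‖x‖ = 1) :
    |rad u x| ≤ 2 * (m / H + N * H) := by
  rw [abs_le]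
  have h1 := h.rad_le_sphere_aux hx
  have h2 := h.neg.rad_le_sphere_aux hx
  rw [rad_neg hx.ge] at h2
  exact ⟨by linarith, h1⟩

end RobinAnnulus

lemma tangential_barrier_lower {t q G M N H : ℝ} (ht0 : 0 ≤ t) (htH : t ≤ H) (hq1 : 1 ≤ q)
    (hq2 : q ≤ 1.21) (hN : 0 < N) (hG : 0 ≤ G) (hM : 0 ≤ M) :
    t * G * 3.58 + t * M * 3.58 + t * (N * H) * 1.58
      ≤ (2 * G + 2 * M + 2 * (N * H)) * (t * (3 - q)) - 2 * N * (t * t * (2 - q)) := by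
  have hH : 0 ≤ H := ht0.trans htH
  have e0 : 0 ≤ 2 * G + 2 * M + 2 * (N * H) := by positivity
  have e1 : (2 * G + 2 * M + 2 * (N * H)) * 1.79 ≤ (2 * G + 2 * M + 2 * (N * H)) * (3 - q) :=
    mul_le_mul_of_nonneg_left (by linarith) e0
  have e2 : N * (t * (2 - q)) ≤ N * H := by
    refine mul_le_mul_of_nonneg_left ?_ hN.le
    nlinarith
  have := mul_le_mul_of_nonneg_left (sub_le_sub e1 (mul_le_mul_of_nonneg_left e2 zero_le_two)) ht0
  linarith

namespace RobinAnnulus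

variable {u : E3 → ℝ} {κ H m N : ℝ}

/-- Comparison of `u` with its reflection near the spherical part `|x| = 1 + H`. -/
lemma sub_refl_le (h : RobinAnnulus u κ H m N) {n y : E3} (hn : ‖n‖ = 1) (hy : ‖y‖ = 1 + H)
    (ht0 : 0 ≤ ⟪n, y⟫) (htH : ⟪n, y⟫ ≤ H) :
    u y - u (planeRefl n y) ≤ 2 * (12 * m / H + N * H / 4) * ⟪n, y⟫ := by
  have hH := h.H_pos
  set t := ⟪n, y⟫ with ht
  set p : ℝ → E3 := fun s => planeRefl n y + (s * (2 * t)) • n with hp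
  have hpn : ∀ s ∈ Icc (0 : ℝ) 1, 1 + H / 2 ≤ ‖p s‖ ∧ ‖p s‖ ≤ 1 + H := by
    intro s hs
    have e : ‖p s‖ ^ 2 = (1 + H) ^ 2 - 4 * t ^ 2 * (s * (1 - s)) := by
      have : p s = y - (2 * t * (1 - s)) • n := by
        simp only [hp, planeRefl_apply hn, ← ht]; module
      rw [this, norm_sub_sq_real, inner_smul_right, norm_smul, hn, real_inner_comm, ← ht, hy,
        Real.norm_eq_abs, mul_one, sq_abs]
      ring
    have e1 : 0 ≤ s * (1 - s) := mul_nonneg hs.1 (by linarith [hs.2])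
    have e2 : s * (1 - s) ≤ 1 / 4 := by nlinarith [sq_nonneg (s - 1 / 2)]
    have e3 : t ^ 2 ≤ H ^ 2 := by gcongr
    constructor
    · refine le_of_sq_le_sq ?_ (norm_nonneg _)
      rw [e]
      have : t ^ 2 * (s * (1 - s)) ≤ H ^ 2 * (1 / 4) := by gcongr
      nlinarith [h.H_le]
    · refine le_of_sq_le_sq ?_ (by positivity)
      rw [e]
      nlinarith [mul_nonneg (sq_nonneg t) e1]
  have hd : ∀ s ∈ Icc (0 : ℝ) 1, HasDerivWithinAt (fun s => u (p s))
      (fderiv ℝ u (p s) ((2 * t) • n)) (Icc 0 1) s := by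
    intro s hs
    have h1 := ((h.contDiffAt (x := p s) (by linarith [(hpn s hs).1])).differentiableAt
      (by simp)).hasFDerivAt
    have h2 : HasDerivAt p ((2 * t) • n) s := by
      have := (((hasDerivAt_id s).mul_const (2 * t)).smul_const n).const_add (planeRefl n y)
      rwa [one_mul] at this
    exact (h1.comp_hasDerivAt s h2).hasDerivWithinAt
  have hb : ∀ s ∈ Icc (0 : ℝ) 1,
      ‖fderiv ℝ u (p s) ((2 * t) • n)‖ ≤ 2 * (12 * m / H + N * H / 4) * t := by
    intro s hs
    rw [map_smul, smul_eq_mul, norm_mul, Real.norm_of_nonneg (by linarith), Real.norm_eq_abs]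
    have := h.grad_le_of_interior (hpn s hs).1 (hpn s hs).2 hn
    nlinarith
  have := (convex_Icc (0 : ℝ) 1).norm_image_sub_le_of_norm_hasDerivWithin_le hd hb
    (left_mem_Icc.2 zero_le_one) (right_mem_Icc.2 zero_le_one)
  have h1 : p 1 = y := by simp only [hp, planeRefl_apply hn, ← ht]; module
  have h0 : p 0 = planeRefl n y := by simp [hp]
  rw [h1, h0, sub_zero, norm_one, mul_one] at this
  exact (le_abs_self _).trans this

lemma tangential_grad_aux (h : RobinAnnulus u κ H m N) {x n : E3} (hn : ‖n‖ = 1)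
    (hx : 1 < ‖x‖) (hx' : ‖x‖ < 1 + H) (hnx : ⟪n, x⟫ = 0) :
    fderiv ℝ u x n ≤ 30 * (m / H + N * H) := by
  have hH := h.H_pos
  have hH1 := h.H_le
  have hN := h.N_pos
  have hm := h.m_nonneg
  set G := 12 * m / H + N * H / 4 with hG
  have hGp : 0 < G := by positivity
  set β := 2 * G + 2 * (m / H) + 2 * (N * H) with hβ
  have hβp : 0 < β := by positivity
  set σ := planeRefl n with hσ
  have hσn : ∀ x, ‖(0 : E3) + (1 : ℝ) • σ x‖ = ‖x‖ := fun x => by simp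
  have hσ0 : ∀ x, (0 : E3) + (1 : ℝ) • σ x = σ x := fun x => by simp
  set w : E3 → ℝ := fun x => u x - u ((0 : E3) + (1 : ℝ) • σ x)
    - (β * (⟪n, x⟫ * (3 - ‖x‖ ^ 2)) - 2 * N * (⟪n, x⟫ * ⟪n, x⟫ * (2 - ‖x‖ ^ 2))) with hw
  set K : Set E3 := {x | 1 ≤ ‖x‖ ∧ ‖x‖ ≤ 1 + H} ∩ {x | 0 ≤ ⟪n, x⟫ ∧ ⟪n, x⟫ ≤ H} with hK
  have hin : Continuous fun x : E3 => ⟪n, x⟫ := by fun_prop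
  have hKc : IsCompact K := by
    refine (isCompact_annulus _ _).inter_right ?_
    exact (isClosed_le continuous_const hin).inter (isClosed_le hin continuous_const)
  have key : ∀ y ∈ K, w y ≤ 0 := by
    refine forall_nonpos_of_max hKc ?_ fun y hy hmax => ?_
    · have h1 : ContinuousOn u K := h.smooth.continuousOn.mono fun y hy => hy.1.1
      have h2 : ContinuousOn (fun x => u ((0 : E3) + (1 : ℝ) • σ x)) K := by
        refine h.smooth.continuousOn.comp (by fun_prop) fun y hy => ?_
        rw [mem_OmegaBar, hσn]; exact hy.1.1
      exact (h1.sub h2).sub (by fun_prop)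
    by_contra! hpos
    obtain ⟨⟨hy1, hy2⟩, ht0, htH⟩ := hy
    set t := ⟪n, y⟫ with ht
    have hry : ‖y‖ ^ 2 ≤ 1.21 := by nlinarith
    have hry1 : 1 ≤ ‖y‖ ^ 2 := by nlinarith
    have b1 := abs_le.1 (h.bound y hy1 (by linarith))
    have b2 := abs_le.1 (h.bound (σ y) (by simpa using hy1)
      (by simpa using hy2.trans (by linarith)))
    have hwy : w y = u y - u (σ y) - (β * (t * (3 - ‖y‖ ^ 2))
        - 2 * N * (t * t * (2 - ‖y‖ ^ 2))) := by simp only [hw, hσ0, ← ht]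
    rw [hwy] at hpos
    have hψ := tangential_barrier_lower ht0 htH hry1 hry hN hGp.le (show 0 ≤ m / H by positivity)
    rw [← hβ] at hψ
    have p1 : 0 ≤ t * (m / H) := by positivity
    have p2 : 0 ≤ t * (N * H) := by positivity
    have p3 : 0 ≤ t * G := by positivity
    rcases ht0.eq_or_lt with h0 | h0
    · have : σ y = y := by rw [hσ, planeRefl_apply hn, ← ht, ← h0]; simp
      rw [this, ← h0] at hpos
      simp at hpos
    rcases htH.eq_or_lt with h1 | h1
    · have e1 : t * (m / H) = m := by rw [h1]; field_simp
      linarith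
    rcases hy2.eq_or_lt with h2 | h2
    · have e := h.sub_refl_le hn h2 ht0 htH
      rw [← ht, ← hσ, ← hG] at e
      have e4 : 0 < t * G := by positivity
      linarith
    have hts : ∀ᶠ s in 𝓝 (1 : ℝ), s * t < H := by
      have : ContinuousAt (fun s : ℝ => s * t) 1 := by fun_prop
      exact this.eventually (gt_mem_nhds (by simpa using h1))
    rcases hy1.eq_or_lt with h3 | h3
    · have hsy : (σ y) ∈ OmegaBar := by rw [mem_OmegaBar]; simpa using hy1
      have d1 := (hasDerivWithinAt_ray hy1 (h.differentiableWithinAt hy1)).sub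
        (hasDerivWithinAt_ray hsy (h.differentiableWithinAt hsy))
      have d2 : HasDerivAt (fun s : ℝ => β * (s * t * (3 - s ^ 2))
          - 2 * N * (s * t * (s * t) * (2 - s ^ 2))) 0 1 := by
        have e1 := (hasDerivAt_id (1 : ℝ)).mul_const t
        have e2 := (hasDerivAt_id (1 : ℝ)).fun_pow 2
        refine (((e1.fun_mul (e2.const_sub 3)).const_mul (β)).fun_sub
          (((e1.fun_mul e1).fun_mul (e2.const_sub 2)).const_mul (2 * N))).congr_deriv ?_
        simp; ring
      have hle := deriv_nonpos_of_right_max (d1.sub d2.hasDerivWithinAt) (by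
        have : ∀ᶠ s in 𝓝[>] (1 : ℝ), s < 1 + H := nhdsWithin_le_nhds (gt_mem_nhds (by linarith))
        filter_upwards [this, self_mem_nhdsWithin, nhdsWithin_le_nhds hts] with s hs hs1 hst
        have hs1' : (1 : ℝ) < s := hs1
        have hn : ‖s • y‖ = s := by
          rw [norm_smul, ← h3, mul_one, Real.norm_of_nonneg (by linarith)]
        have hi : ⟪n, s • y⟫ = s * t := by rw [inner_smul_right]
        have hle : w (s • y) ≤ w y := hmax (show s • y ∈ K from
          ⟨⟨by rw [hn]; exact hs1'.le, by rw [hn]; exact hs.le⟩,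
            ⟨by rw [hi]; positivity, by rw [hi]; exact hst.le⟩⟩)
        rw [hwy] at hle
        simp only [hw, hn, hi, hσ0, map_smul] at hle
        simp only [Pi.sub_apply, one_smul, one_mul, one_pow]
        rw [← h3] at hle
        simpa using hle)
      rw [sub_zero] at hle
      have e1 := h.robin y h3.symm
      have e2 := h.robin (σ y) (by simpa using h3.symm)
      have := mul_nonpos_of_nonneg_of_nonpos h.kappa_nonneg hle
      rw [mul_sub, e1, e2] at this
      have e4 : 0 < t * G := by positivity
      linarith
    · have hJ1 := hasJ_of_contDiffAt (h.contDiffAt h3)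
      have hsy : 1 < ‖(0 : E3) + (1 : ℝ) • σ y‖ := by rw [hσn]; exact h3
      have hC := lapl_comp_affine σ 0 1 (h.contDiffAt hsy)
      have hJ2 := hasJ_of_contDiffAt hC.1
      have hi := HasJ.inner_left n y
      have hq := HasJ.normSq y
      have hJ := (hJ1.sub hJ2).sub
        (((hi.mul ((HasJ.const 3).sub hq)).const_mul (β)).sub
          (((hi.mul hi).mul ((HasJ.const 2).sub hq)).const_mul (2 * N)))
      have hnh : K ∈ 𝓝 y := by
        refine inter_mem (annulus_mem_nhds h3 h2) ?_
        filter_upwards [hin.continuousAt.eventually (lt_mem_nhds h0),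
          hin.continuousAt.eventually (gt_mem_nhds h1)] with z hz1 hz2
        exact ⟨hz1.le, hz2.le⟩
      have hl := lapl_nonpos_of_isLocalMax hJ.1 (hmax.isLocalMax hnh)
      rw [hJ.2.2, hC.2] at hl
      have l1 := abs_le.1 (h.lapl_bound y h3 (by linarith))
      have l2 := abs_le.1 (h.lapl_bound ((0 : E3) + (1 : ℝ) • σ y) hsy
        (by rw [hσn]; linarith))
      simp only [inner_sub_right, inner_add_left, inner_smul_left, inner_smul_right,
        real_inner_self_eq_norm_sq, conj_trivial, ← ht, hn, inner_zero_right] at hl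
      have e1 : t * t ≤ 0.01 := by nlinarith
      have e2 : 0 < β * t := by positivity
      have e3 := mul_le_mul_of_nonneg_left e1 hN.le
      have e4 := mul_le_mul_of_nonneg_left hry hN.le
      ring_nf at hl e3 e4 e2 l1 l2
      linarith
  have hσnn : ∀ s : ℝ, σ (x + s • n) = x + s • (-n) := by
    intro s
    rw [hσ, planeRefl_apply hn, inner_add_right, inner_smul_right, real_inner_self_eq_norm_sq, hn,
      hnx]
    module
  have hu0 := ((h.contDiffAt hx).differentiableAt (by simp)).hasFDerivAt
  have e : ∀ v : E3, HasDerivAt (fun s : ℝ => x + s • v) v 0 := by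
    intro v
    have := ((hasDerivAt_id (0 : ℝ)).smul_const v).const_add x
    rwa [one_smul] at this
  have hu1 : ∀ v : E3, HasFDerivAt u (fderiv ℝ u x) (x + (0 : ℝ) • v) := by simpa using hu0
  have f1 := ((hu1 n).comp_hasDerivAt (0 : ℝ) (e n)).sub
    ((hu1 (-n)).comp_hasDerivAt (0 : ℝ) (e (-n)))
  have hns : ∀ s : ℝ, ‖x + s • n‖ ^ 2 = ‖x‖ ^ 2 + s ^ 2 := by
    intro s
    rw [norm_add_sq_real, inner_smul_right, real_inner_comm, hnx, norm_smul, hn,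
      Real.norm_eq_abs, mul_one, sq_abs]
    ring
  have f2 : HasDerivAt (fun s : ℝ => β * (s * (3 - (‖x‖ ^ 2 + s ^ 2)))
      - 2 * N * (s * s * (2 - (‖x‖ ^ 2 + s ^ 2)))) (β * (3 - ‖x‖ ^ 2)) 0 := by
    have i1 := hasDerivAt_id (0 : ℝ)
    have i2 := (i1.fun_pow 2).const_add (‖x‖ ^ 2)
    refine (((i1.fun_mul (i2.const_sub 3)).const_mul (β)).fun_sub
      (((i1.fun_mul i1).fun_mul (i2.const_sub 2)).const_mul (2 * N))).congr_deriv ?_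
    simp
  have hle := deriv_nonpos_of_right_max ((f1.sub f2).hasDerivWithinAt (s := Ici 0)) (by
    have hc : ContinuousAt (fun s : ℝ => ‖x + s • n‖) 0 := by fun_prop
    have c1 := hc.eventually (gt_mem_nhds (show ‖x + (0 : ℝ) • n‖ < 1 + H by simpa using hx'))
    have c2 := hc.eventually (lt_mem_nhds (show 1 < ‖x + (0 : ℝ) • n‖ by simpa using hx))
    filter_upwards [nhdsWithin_le_nhds c1, nhdsWithin_le_nhds c2,
      nhdsWithin_le_nhds (gt_mem_nhds hH), self_mem_nhdsWithin] with s hs1 hs2 hsH hs0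
    have hs0' : (0 : ℝ) < s := hs0
    have hi : ⟪n, x + s • n⟫ = s := by
      rw [inner_add_right, inner_smul_right, real_inner_self_eq_norm_sq, hn, hnx]; ring
    have := key (x + s • n) ⟨⟨hs2.le, hs1.le⟩,
      ⟨by rw [hi]; exact hs0'.le, by rw [hi]; exact hsH.le⟩⟩
    simp only [hw, hσ0, hσnn, hi, hns] at this
    simpa using this)
  have e2 : β = 26 * (m / H) + 2.5 * (N * H) := by rw [hβ, hG]; ring
  have e3 : 0 ≤ m / H := by positivity
  have e4 : 0 < N * H := by positivity
  have e5 : β * (3 - ‖x‖ ^ 2) ≤ β * 2 := by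
    refine mul_le_mul_of_nonneg_left ?_ (by positivity)
    nlinarith
  simp only [map_neg] at hle
  linarith

lemma tangential_grad (h : RobinAnnulus u κ H m N) {x n : E3} (hn : ‖n‖ = 1)
    (hx : 1 < ‖x‖) (hx' : ‖x‖ < 1 + H) (hnx : ⟪n, x⟫ = 0) :
    |fderiv ℝ u x n| ≤ 30 * (m / H + N * H) := by
  have h1 := h.tangential_grad_aux hn hx hx' hnx
  have h2 := h.tangential_grad_aux (n := -n) (by simpa using hn) hx hx' (by simpa using hnx)
  rw [map_neg] at h2
  exact abs_le.2 ⟨by linarith, h1⟩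

end RobinAnnulus

/-! ### Dilations and the radial derivative -/

lemma dilation_sub_eq {u : E3 → ℝ} (hu : ContDiffOn ℝ 2 u OmegaBar) {x : E3} (hx : x ∈ OmegaBar)
    {l : ℝ} (hl : 1 < l) :
    ∃ s ∈ Ioo 1 l, u (l • x) - u x = (l - 1) * (rad u (s • x) / s) := by
  have hc : ContinuousOn (fun s : ℝ => u (s • x)) (Icc 1 l) :=
    hu.continuousOn.comp (by fun_prop) fun s hs => smul_mem_OmegaBar hx hs.1
  have hd : ∀ s ∈ Ioo 1 l, HasDerivAt (fun s : ℝ => u (s • x)) (rad u (s • x) / s) s := by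
    intro s hs
    have hm := smul_mem_Omega hx hs.1
    have h1 := ((contDiffAt_of_mem hu hm).differentiableAt (by simp)).hasFDerivAt
    have h2 : HasDerivAt (fun s : ℝ => s • x) x s := by
      have := (hasDerivAt_id s).smul_const x
      rwa [one_smul] at this
    refine (h1.comp_hasDerivAt s h2).congr_deriv ?_
    have : (0 : ℝ) < s := by linarith [hs.1]
    rw [rad_eq hm, map_smul, smul_eq_mul]
    field_simp
  obtain ⟨s, hs, e⟩ := exists_hasDerivAt_eq_slope _ _ hl hc hd
  refine ⟨s, hs, ?_⟩
  have : l - 1 ≠ 0 := by linarith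
  rw [e]
  simp only [one_smul]
  field_simp

lemma abs_dilation_sub_le {u : E3 → ℝ} (hu : ContDiffOn ℝ 2 u OmegaBar) {x : E3}
    (hx : x ∈ OmegaBar) {l K : ℝ} (hl : 1 < l) (hK : ∀ s ∈ Ioo 1 l, |rad u (s • x)| ≤ K) :
    |u (l • x) - u x| ≤ (l - 1) * K := by
  obtain ⟨s, hs, e⟩ := dilation_sub_eq hu hx hl
  rw [e, abs_mul, abs_of_pos (by linarith)]
  refine mul_le_mul_of_nonneg_left ?_ (by linarith)
  rw [abs_div, abs_of_pos (by linarith [hs.1] : 0 < s)]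
  exact (div_le_self (abs_nonneg _) hs.1.le).trans (hK s hs)

/-- A maximum principle for difference quotients under dilations. -/
lemma dilation_sub_le {u : E3 → ℝ} {H l K Λ : ℝ} (hu : ContDiffOn ℝ 2 u OmegaBar) (hH : 0 < H)
    (hH1 : H ≤ 1 / 10) (hl : 1 < l) (hΛ : 0 < Λ)
    (hin : ∀ x, ‖x‖ = 1 → |u (l • x) - u x| ≤ (l - 1) * K)
    (hout : ∀ x, 1 ≤ ‖x‖ → l * ‖x‖ = 1 + H → |u (l • x) - u x| ≤ (l - 1) * K)
    (hg : ∀ x, 1 < ‖x‖ → l * ‖x‖ < 1 + H →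
      |l ^ 2 * lapl u (l • x) - lapl u x| ≤ (l - 1) * Λ)
    {x : E3} (hx : 1 ≤ ‖x‖) (hx' : l * ‖x‖ ≤ 1 + H) :
    u (l • x) - u x ≤ (l - 1) * (K + H ^ 2 * Λ) := by
  have hl0 : 0 < l - 1 := by linarith
  set w : E3 → ℝ := fun x => u ((0 : E3) + l • LinearIsometryEquiv.refl ℝ E3 x) - u x -
    ((l - 1) * K + (l - 1) * Λ / 4 * ((‖x‖ ^ 2 - 1) * ((1 + H) ^ 2 - ‖x‖ ^ 2))) with hw
  have hlx : ∀ x : E3, (0 : E3) + l • LinearIsometryEquiv.refl ℝ E3 x = l • x := by simp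
  have hnl : ∀ x : E3, ‖l • x‖ = l * ‖x‖ := fun x => by
    rw [norm_smul, Real.norm_of_nonneg (by linarith)]
  set R := (1 + H) / l with hR
  have hRl : ∀ x : E3, ‖x‖ ≤ R ↔ l * ‖x‖ ≤ 1 + H := fun x => by
    rw [hR, le_div_iff₀ (by linarith), mul_comm]
  have hRl' : ∀ x : E3, ‖x‖ < R ↔ l * ‖x‖ < 1 + H := fun x => by
    rw [hR, lt_div_iff₀ (by linarith), mul_comm]
  have key : ∀ y ∈ {x : E3 | 1 ≤ ‖x‖ ∧ ‖x‖ ≤ R}, w y ≤ 0 := by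
    refine forall_nonpos_of_max (isCompact_annulus _ _) ?_ fun y hy hmax => ?_
    · have h1 : ContinuousOn u {x : E3 | 1 ≤ ‖x‖ ∧ ‖x‖ ≤ R} :=
        hu.continuousOn.mono fun y hy => hy.1
      have h2 : ContinuousOn (fun x => u ((0 : E3) + l • LinearIsometryEquiv.refl ℝ E3 x))
          {x : E3 | 1 ≤ ‖x‖ ∧ ‖x‖ ≤ R} := by
        refine hu.continuousOn.comp (by fun_prop) fun y hy => ?_
        rw [hlx]; exact smul_mem_OmegaBar hy.1 hl.le
      exact (h2.sub h1).sub (by fun_prop)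
    obtain ⟨hy1, hy2⟩ := hy
    have hyl := (hRl y).1 hy2
    have hyH : ‖y‖ ≤ 1 + H := by nlinarith
    have hψ : 0 ≤ (l - 1) * Λ / 4 * ((‖y‖ ^ 2 - 1) * ((1 + H) ^ 2 - ‖y‖ ^ 2)) := by
      have e1 : 0 ≤ ‖y‖ ^ 2 - 1 := by nlinarith
      have e2 : 0 ≤ (1 + H) ^ 2 - ‖y‖ ^ 2 := by nlinarith
      positivity
    rcases hy1.eq_or_lt with h1 | h1
    · have := (abs_le.1 (hin y h1.symm)).2
      simp only [hw, hlx]; linarith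
    rcases hy2.eq_or_lt with h2 | h2
    · have : l * ‖y‖ = 1 + H := by rw [h2, hR]; field_simp
      have := (abs_le.1 (hout y hy1 this)).2
      simp only [hw, hlx]; linarith
    exfalso
    have hyl := (hRl' y).1 h2
    have hC := lapl_comp_affine (LinearIsometryEquiv.refl ℝ E3) 0 l (x := y) (f := u) (by
      rw [hlx]; exact contDiffAt_of_mem hu (smul_mem_Omega hy1 hl))
    have hq := HasJ.normSq y
    have hJ := ((hasJ_of_contDiffAt hC.1).sub (hasJ_of_contDiffAt (contDiffAt_of_mem hu h1))).sub
      ((HasJ.const ((l - 1) * K)).add (((hq.sub (HasJ.const 1)).mul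
        ((HasJ.const ((1 + H) ^ 2)).sub hq)).const_mul ((l - 1) * Λ / 4)))
    have hle := lapl_nonpos_of_isLocalMax hJ.1 (hmax.isLocalMax (annulus_mem_nhds h1 h2))
    rw [hJ.2.2, hC.2, hlx] at hle
    simp only [sub_zero, zero_sub, inner_neg_right, inner_smul_left, inner_smul_right,
      real_inner_self_eq_norm_sq, conj_trivial] at hle
    have e := (abs_le.1 (hg y h1 hyl)).1
    have e1 : 0 < (l - 1) * Λ := by positivity
    have e2 : (1 + H) ^ 2 ≤ 1.21 := by nlinarith
    have e3 : 1 ≤ ‖y‖ ^ 2 := by nlinarith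
    have e4 : (l - 1) * Λ * (6 * (1 + (1 + H) ^ 2) - 20 * ‖y‖ ^ 2) ≤ (l - 1) * Λ * (-6.5) :=
      mul_le_mul_of_nonneg_left (by linarith) e1.le
    linarith
  have := key x ⟨hx, (hRl x).2 hx'⟩
  simp only [hw, hlx] at this
  have e1 : (‖x‖ ^ 2 - 1) * ((1 + H) ^ 2 - ‖x‖ ^ 2) ≤ 4 * H ^ 2 := by
    have e2 : (‖x‖ ^ 2 - 1) * ((1 + H) ^ 2 - ‖x‖ ^ 2) ≤ ((1 + H) ^ 2 - 1) ^ 2 / 4 := by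
      nlinarith [sq_nonneg (‖x‖ ^ 2 - 1 - ((1 + H) ^ 2 - ‖x‖ ^ 2))]
    have e3 : ((1 + H) ^ 2 - 1) ^ 2 ≤ (3 * H) ^ 2 := by
      apply pow_le_pow_left₀ <;> nlinarith
    nlinarith
  have := mul_le_mul_of_nonneg_left e1 (show 0 ≤ (l - 1) * Λ / 4 by positivity)
  linarith

/-- If `Δu` varies in a controlled way under dilations, then `x · ∇u` is controlled by its values
at the boundary of the annulus. -/
lemma abs_rad_le_of_dilation {u : E3 → ℝ} {H K Λ : ℝ} (hu : ContDiffOn ℝ 2 u OmegaBar) (hH : 0 < H)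
    (hH1 : H ≤ 1 / 10) (hΛ : 0 < Λ)
    (hin : ∀ x, ‖x‖ = 1 → |rad u x| ≤ K) (hout : ∀ x, ‖x‖ = 1 + H → |rad u x| ≤ K)
    (hg : ∀ l, 1 < l → ∀ x, 1 < ‖x‖ → l * ‖x‖ < 1 + H →
      |l ^ 2 * lapl u (l • x) - lapl u x| ≤ (l - 1) * Λ)
    {x : E3} (hx : 1 < ‖x‖) (hx' : ‖x‖ < 1 + H) : |rad u x| ≤ K + H ^ 2 * Λ := by
  refine le_of_forall_pos_le_add fun η hη => ?_
  have hunif := (isCompact_annulus 1 (1 + H)).uniformContinuousOn_of_continuous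
    ((continuousOn_rad hu).mono fun y hy => hy.1)
  obtain ⟨δ, hδ, hδ'⟩ := Metric.uniformContinuousOn_iff.1 hunif η hη
  have hnear : ∀ p q : E3, 1 ≤ ‖p‖ → ‖p‖ ≤ 1 + H → 1 ≤ ‖q‖ → ‖q‖ ≤ 1 + H → ‖p - q‖ < δ →
      |rad u q| ≤ K → |rad u p| ≤ K + η := by
    intro p q hp hp' hq hq' hpq hKq
    have := hδ' p ⟨hp, hp'⟩ q ⟨hq, hq'⟩ (by rwa [dist_eq_norm])
    rw [Real.dist_eq] at this
    have := abs_sub_abs_le_abs_sub (rad u p) (rad u q)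
    linarith
  have hD : ∀ l : ℝ, 1 < l → l < 1 + δ / 2 → l ≤ 1 + H → l * ‖x‖ ≤ 1 + H →
      ∀ v : E3 → ℝ, ContDiffOn ℝ 2 v OmegaBar → (∀ x ∈ OmegaBar, |rad v x| = |rad u x|) →
      (∀ x ∈ Omega, ∀ y ∈ Omega, |l ^ 2 * lapl v y - lapl v x| = |l ^ 2 * lapl u y - lapl u x|) →
      v (l • x) - v x ≤ (l - 1) * (K + η + H ^ 2 * Λ) := by
    intro l hl hlδ hlH hlx v hv hvr hvl
    have hnl : ∀ s : ℝ, 1 < s → ∀ x : E3, ‖s • x‖ = s * ‖x‖ := fun s hs x => by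
      rw [norm_smul, Real.norm_of_nonneg (by linarith)]
    refine dilation_sub_le hv hH hH1 hl hΛ (fun z hz => ?_) (fun z hz hz' => ?_)
      (fun z hz hz' => ?_) hx.le hlx
    · refine abs_dilation_sub_le hv hz.ge hl fun s hs => ?_
      rw [hvr _ (smul_mem_OmegaBar hz.ge hs.1.le)]
      refine hnear _ z ?_ ?_ hz.ge (by linarith) ?_ (hin z hz)
      · rw [hnl s hs.1, hz]; linarith [hs.1]
      · rw [hnl s hs.1, hz]; linarith [hs.2]
      · have : s • z - z = (s - 1) • z := by module
        rw [this, norm_smul, hz, Real.norm_of_nonneg (by linarith [hs.1])]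
        linarith [hs.2]
    · refine abs_dilation_sub_le hv hz hl fun s hs => ?_
      have hzH : ‖z‖ ≤ 1 + H := by nlinarith
      rw [hvr _ (smul_mem_OmegaBar hz hs.1.le)]
      refine hnear _ (l • z) ?_ ?_ ?_ ?_ ?_ (hout _ (by rw [hnl l hl, hz']))
      · rw [hnl s hs.1]; nlinarith [hs.1]
      · rw [hnl s hs.1]; nlinarith [hs.2]
      · rw [hnl l hl]; linarith
      · rw [hnl l hl]; linarith
      · have : s • z - l • z = -((l - s) • z) := by module
        rw [this, norm_neg, norm_smul, Real.norm_of_nonneg (by linarith [hs.2])]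
        nlinarith [hs.1, hs.2]
    · rw [hvl z hz _ (smul_mem_Omega hz.le hl)]
      exact hg l hl z hz hz'
  have hev : ∀ᶠ l in 𝓝[>] (1 : ℝ), 1 < l ∧ l < 1 + δ / 2 ∧ l ≤ 1 + H ∧ l * ‖x‖ ≤ 1 + H := by
    have hc : ContinuousAt (fun l : ℝ => l * ‖x‖) 1 := by fun_prop
    have := hc.eventually (gt_mem_nhds (show 1 * ‖x‖ < 1 + H by linarith))
    filter_upwards [self_mem_nhdsWithin,
      nhdsWithin_le_nhds (gt_mem_nhds (show (1 : ℝ) < 1 + δ / 2 by linarith)),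
      nhdsWithin_le_nhds (gt_mem_nhds (show (1 : ℝ) < 1 + H by linarith)),
      nhdsWithin_le_nhds this] with l h1 h2 h3 h4
    exact ⟨h1, h2, h3.le, h4.le⟩
  have hone : ∀ v : E3 → ℝ, ContDiffOn ℝ 2 v OmegaBar → (∀ x ∈ OmegaBar, |rad v x| = |rad u x|) →
      (∀ l : ℝ, ∀ x ∈ Omega, ∀ y ∈ Omega,
        |l ^ 2 * lapl v y - lapl v x| = |l ^ 2 * lapl u y - lapl u x|) →
      rad v x ≤ K + H ^ 2 * Λ + η := by
    intro v hv hvr hvl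
    have hp : HasDerivAt (fun s : ℝ => (s - 1) * (K + η + H ^ 2 * Λ)) (K + H ^ 2 * Λ + η) 1 := by
      refine (((hasDerivAt_id (1 : ℝ)).sub_const 1).mul_const _).congr_deriv ?_
      ring
    refine rad_nonpos_of_max hx.le (hv.differentiableOn (by simp) x hx.le) hp ?_
    filter_upwards [hev] with l hl
    have := hD l hl.1 hl.2.1 hl.2.2.1 hl.2.2.2 v hv hvr (hvl l)
    simp only [sub_self, zero_mul, sub_zero]
    linarith
  have h1 := hone u hu (fun _ _ => rfl) (fun _ _ _ _ _ => rfl)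
  have h2 := hone (fun y => -u y) hu.neg (fun x hx => by rw [rad_neg hx, abs_neg])
    (fun l x hx y hy => by
      rw [(hasJ_of_contDiffAt (contDiffAt_of_mem hu hx)).neg.2.2,
        (hasJ_of_contDiffAt (contDiffAt_of_mem hu hy)).neg.2.2, ← abs_neg]
      congr 1; ring)
  rw [rad_neg hx.le] at h2
  exact abs_le.2 ⟨by linarith, h1⟩

/-- Gradient bound near the sphere for a system of functions with Robin conditions whose
Laplacians are coupled in a Lipschitz way. -/
theorem system_grad_annulus {ι : Type*} [Finite ι] {u : ι → E3 → ℝ} {κ H m N P C₀ : ℝ}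
    (h : ∀ i, RobinAnnulus (u i) κ H m N) (hP : 0 ≤ P) (hPH : H ^ 2 * P ≤ 1 / 2) (hC₀ : 0 ≤ C₀)
    (hg : ∀ M : ℝ, (∀ i x, 1 < ‖x‖ → ‖x‖ < 1 + H → |rad (u i) x| ≤ M) →
      ∀ i l, 1 < l → ∀ x, 1 < ‖x‖ → l * ‖x‖ < 1 + H →
      |l ^ 2 * lapl (u i) (l • x) - lapl (u i) x| ≤ (l - 1) * (3 * N + P * (M + C₀)))
    (i : ι) {x n : E3} (hx : 1 < ‖x‖) (hx' : ‖x‖ < 1 + H) (hn : ‖n‖ = 1) :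
    |fderiv ℝ (u i) x n| ≤ 60 * (m / H + N * H) + 2 * C₀ * (H ^ 2 * P) := by
  have hH := (h i).H_pos
  have hH1 := (h i).H_le
  have hN := (h i).N_pos
  have hm := (h i).m_nonneg
  set K := 14 * (m / H + N * H) with hK
  have hmH : 0 ≤ m / H := by positivity
  have hNH : 0 ≤ N * H := by positivity
  have hin : ∀ j x, ‖x‖ = 1 → |rad (u j) x| ≤ K := fun j x hx => by
    have := (h j).rad_le_sphere hx
    linarith
  have hout : ∀ j x, ‖x‖ = 1 + H → |rad (u j) x| ≤ K := fun j x hx => by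
    have hx0 : x ≠ 0 := by rintro rfl; simp at hx; linarith
    have hxO : x ∈ Omega := by rw [mem_Omega, hx]; linarith
    have hnx : ‖(‖x‖⁻¹ • x)‖ = 1 := by rw [norm_smul, norm_inv, norm_norm]; field_simp
    have := (h j).grad_le_of_interior (by linarith) hx.le hnx
    rw [map_smul, smul_eq_mul, ← rad_eq hxO, abs_mul, abs_inv, abs_norm, hx] at this
    rw [inv_mul_le_iff₀ (by linarith)] at this
    rw [hK]
    have e1 : 12 * m / H + N * H / 4 = 12 * (m / H) + N * H / 4 := by ring
    rw [e1] at this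
    nlinarith
  have hrad : ∃ M, 0 ≤ M ∧ ∀ j x, 1 < ‖x‖ → ‖x‖ < 1 + H → |rad (u j) x| ≤ M := by
    have hb : ∀ j, ∃ M, ∀ x ∈ {x : E3 | 1 ≤ ‖x‖ ∧ ‖x‖ ≤ 1 + H}, ‖rad (u j) x‖ ≤ M := fun j =>
      (isCompact_annulus _ _).exists_bound_of_continuousOn
        ((continuousOn_rad (h j).smooth).mono fun y hy => hy.1)
    choose M hM using hb
    obtain ⟨M', hM'⟩ := (Set.finite_range M).bddAbove
    refine ⟨max M' 0, le_max_right _ _, fun j x hx hx' => ?_⟩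
    exact ((hM j x ⟨hx.le, hx'.le⟩).trans (hM' ⟨j, rfl⟩)).trans (le_max_left _ _)
  set B := 2 * K + 6 * (H ^ 2 * N) + 2 * C₀ * (H ^ 2 * P) with hB
  have hK0 : 0 ≤ K := by positivity
  have hstep : ∀ M, 0 ≤ M → (∀ j x, 1 < ‖x‖ → ‖x‖ < 1 + H → |rad (u j) x| ≤ M) →
      ∀ j x, 1 < ‖x‖ → ‖x‖ < 1 + H → |rad (u j) x| ≤ M / 2 + B / 2 := by
    intro M hM0 hM j x hx hx'
    have := abs_rad_le_of_dilation (h j).smooth hH hH1 (Λ := 3 * N + P * (M + C₀))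
      (by positivity) (hin j) (hout j) (hg M hM j) hx hx'
    have e : H ^ 2 * P * M ≤ 1 / 2 * M := mul_le_mul_of_nonneg_right hPH hM0
    rw [hB]
    linarith
  obtain ⟨M, hM0, hM⟩ := hrad
  have hB0 : 0 ≤ B := by positivity
  have hiter : ∀ k : ℕ, ∀ j x, 1 < ‖x‖ → ‖x‖ < 1 + H → |rad (u j) x| ≤ M * (1 / 2) ^ k + B := by
    intro k
    induction k with
    | zero => intro j x hx hx'; simpa using (hM j x hx hx').trans (by linarith)
    | succ k ih =>
      intro j x hx hx'
      refine (hstep _ (by positivity) ih j x hx hx').trans (le_of_eq ?_)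
      rw [pow_succ]; ring
  have hradB : |rad (u i) x| ≤ B := by
    have ht : Tendsto (fun k : ℕ => M * (1 / 2 : ℝ) ^ k + B) atTop (𝓝 (M * 0 + B)) :=
      ((tendsto_pow_atTop_nhds_zero_of_lt_one (by norm_num) (by norm_num)).const_mul M).add_const B
    rw [mul_zero, zero_add] at ht
    exact ge_of_tendsto' ht fun k => hiter k i x hx hx'
  have hxp : 0 < ‖x‖ := by linarith
  set v := n - (⟪x, n⟫ / ‖x‖ ^ 2) • x with hv
  have hvx : ⟪v, x⟫ = 0 := by
    rw [hv, inner_sub_left, inner_smul_left, real_inner_self_eq_norm_sq, real_inner_comm]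
    simp; field_simp; ring
  have hnv : n = v + (⟪x, n⟫ / ‖x‖ ^ 2) • x := by rw [hv]; abel
  have hxn : |⟪x, n⟫| ≤ ‖x‖ := by simpa [hn] using abs_real_inner_le_norm x n
  have hvn : ‖v‖ ≤ 1 := by
    have : ‖n‖ ^ 2 = ‖v‖ ^ 2 + ‖(⟪x, n⟫ / ‖x‖ ^ 2) • x‖ ^ 2 := by
      conv_lhs => rw [hnv]
      rw [norm_add_sq_real, inner_smul_right, hvx]; ring
    rw [hn] at this
    nlinarith [sq_nonneg ‖(⟪x, n⟫ / ‖x‖ ^ 2) • x‖, norm_nonneg v]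
  have htan : |fderiv ℝ (u i) x v| ≤ 30 * (m / H + N * H) := by
    by_cases hv0 : v = 0
    · rw [hv0, map_zero, abs_zero]; positivity
    have hvp : 0 < ‖v‖ := norm_pos_iff.2 hv0
    have h1 : ‖(‖v‖⁻¹ • v)‖ = 1 := by rw [norm_smul, norm_inv, norm_norm]; field_simp
    have h2 := (h i).tangential_grad h1 hx hx' (by rw [inner_smul_left, hvx, mul_zero])
    rw [map_smul, smul_eq_mul, abs_mul, abs_inv, abs_norm, inv_mul_le_iff₀ hvp] at h2
    refine h2.trans ?_
    have : 0 ≤ 30 * (m / H + N * H) := by positivity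
    nlinarith
  have hrx : |fderiv ℝ (u i) x ((⟪x, n⟫ / ‖x‖ ^ 2) • x)| ≤ B := by
    rw [map_smul, smul_eq_mul, abs_mul, ← rad_eq hx]
    have : |⟪x, n⟫ / ‖x‖ ^ 2| ≤ 1 := by
      rw [abs_div, abs_of_pos (by positivity : 0 < ‖x‖ ^ 2), div_le_one (by positivity)]
      nlinarith
    calc _ ≤ 1 * |rad (u i) x| := by gcongr
      _ ≤ B := by linarith
  rw [hnv, map_add]
  refine (abs_add_le _ _).trans ((add_le_add htan hrx).trans ?_)
  have : H ^ 2 * N ≤ N * H / 10 := by nlinarith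
  rw [hB, hK]
  linarith

/-! ### The bulk potential and its gradient -/

lemma isS0.trace_mul_self {Q : Mat3} (h : isS0 Q) : (Q * Q).trace = ∑ i, ∑ j, Q i j ^ 2 := by
  simp only [Matrix.trace, Matrix.diag, Matrix.mul_apply]
  refine Finset.sum_congr rfl fun i _ => Finset.sum_congr rfl fun j _ => ?_
  rw [h.1.apply i j, sq]

lemma isS0.mnormSq_eq {Q : Mat3} (h : isS0 Q) : mnormSq Q = ∑ i, ∑ j, Q i j ^ 2 :=
  h.trace_mul_self

lemma isS0.mnormSq_nonneg {Q : Mat3} (h : isS0 Q) : 0 ≤ mnormSq Q := by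
  rw [h.mnormSq_eq]; positivity

lemma isS0.sq_le_mnormSq {Q : Mat3} (h : isS0 Q) (i j : Fin 3) : Q i j ^ 2 ≤ mnormSq Q := by
  rw [h.mnormSq_eq]
  calc Q i j ^ 2 ≤ ∑ j, Q i j ^ 2 :=
        Finset.single_le_sum (f := fun j => Q i j ^ 2) (fun _ _ => sq_nonneg _) (Finset.mem_univ j)
    _ ≤ _ := Finset.single_le_sum (f := fun i => ∑ j, Q i j ^ 2)
        (fun _ _ => Finset.sum_nonneg fun _ _ => sq_nonneg _) (Finset.mem_univ i)

lemma isS0.mnormSq_le {Q : Mat3} (h : isS0 Q) {B : ℝ} (hB : ∀ i j, |Q i j| ≤ B) :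
    mnormSq Q ≤ 9 * B ^ 2 := by
  rw [h.mnormSq_eq]
  calc ∑ i, ∑ j, Q i j ^ 2 ≤ ∑ _i : Fin 3, ∑ _j : Fin 3, B ^ 2 :=
        Finset.sum_le_sum fun i _ => Finset.sum_le_sum fun j _ =>
          sq_le_sq' (abs_le.1 (hB i j)).1 (abs_le.1 (hB i j)).2
    _ = 9 * B ^ 2 := by simp; ring

lemma isS0.sub {P Q : Mat3} (hP : isS0 P) (hQ : isS0 Q) : isS0 (P - Q) :=
  ⟨hP.1.sub hQ.1, by rw [Matrix.trace_sub, hP.2, hQ.2, sub_zero]⟩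

lemma isS0.trace_cube_sq_le {Q : Mat3} (h : isS0 Q) :
    6 * (Q * Q * Q).trace ^ 2 ≤ (Q * Q).trace ^ 3 := by
  have hA : Q.IsHermitian := by
    rw [Matrix.IsHermitian, Matrix.conjTranspose_eq_transpose_of_trivial]
    exact h.1
  set D := Matrix.diagonal hA.eigenvalues with hD
  have hspec := hA.spectral_theorem
  set U := hA.eigenvectorUnitary
  have hQ : Q = Unitary.conjStarAlgAut ℝ _ U D := by
    rw [hD]; convert hspec using 2; rfl
  have htr : ∀ M : Mat3, (Unitary.conjStarAlgAut ℝ _ U M).trace = M.trace := by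
    intro M
    rw [Unitary.conjStarAlgAut_apply, Matrix.trace_mul_comm, ← mul_assoc]
    simp
  have h1 : Q.trace = D.trace := by conv_lhs => rw [hQ, htr]
  have h2 : (Q * Q).trace = (D * D).trace := by
    conv_lhs => rw [hQ, ← map_mul, htr]
  have h3 : (Q * Q * Q).trace = (D * D * D).trace := by
    conv_lhs => rw [hQ, ← map_mul, ← map_mul, htr]
  rw [h.2] at h1
  rw [h2, h3]
  simp only [hD, Matrix.diagonal_mul_diagonal, Matrix.trace_diagonal, Fin.sum_univ_three] at h1 ⊢
  set p := hA.eigenvalues 0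
  set q := hA.eigenvalues 1
  have hr : hA.eigenvalues 2 = -p - q := by linarith
  rw [hr]
  nlinarith [sq_nonneg ((p - q) * (2 * p + q) * (p + 2 * q))]

section Stationary

variable {a b c : ℝ}

lemma sstar_eq (ha : 0 ≤ a) (hc : 0 < c) :
    2 * c * sstar a b c ^ 2 = b * sstar a b c + 3 * a := by
  have h : √(b ^ 2 + 24 * a * c) ^ 2 = b ^ 2 + 24 * a * c := Real.sq_sqrt (by positivity)
  rw [sstar]
  set r := √(b ^ 2 + 24 * a * c)
  field_simp
  linear_combination 2 * h

lemma sstar_pos (hb : 0 < b) (hc : 0 < c) : 0 < sstar a b c := by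
  have := Real.sqrt_nonneg (b ^ 2 + 24 * a * c)
  rw [sstar]; positivity

lemma le_sstar (ha : 0 ≤ a) (hb : 0 < b) (hc : 0 < c) : b ≤ 2 * c * sstar a b c := by
  have h1 := sstar_eq (b := b) ha hc
  have h2 := sstar_pos (a := a) hb hc
  nlinarith

lemma isS0_Qinf : isS0 (Qinf a b c) := by
  constructor
  · ext i j; simp [Qinf, outer, Matrix.one_apply, mul_comm, eq_comm]
  · simp [Qinf, outer, Matrix.trace, Fin.sum_univ_three, ez]; ring

lemma gradf_Qinf (ha : 0 ≤ a) (hc : 0 < c) : gradf a b c (Qinf a b c) = 0 := by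
  have h := sstar_eq (b := b) ha hc
  have hQ : Qinf a b c = Matrix.diagonal
      ![-sstar a b c / 3, -sstar a b c / 3, 2 * sstar a b c / 3] := by
    ext i j
    fin_cases i <;> fin_cases j <;> simp [Qinf, outer, ez] <;> ring
  set s := sstar a b c
  ext i j
  rw [hQ]
  fin_cases i <;> fin_cases j <;>
    simp [gradf, mnormSq, Matrix.diagonal_mul_diagonal, Fin.sum_univ_three] <;>
    first
    | linear_combination (-(s / 9)) * h
    | linear_combination (2 * s / 9) * h

lemma gpot_Qinf_le (ha : 0 ≤ a) (hb : 0 < b) (hc : 0 < c) {Q : Mat3} (hQ : isS0 Q) :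
    gpot a b c (Qinf a b c) ≤ gpot a b c Q := by
  have h := sstar_eq (b := b) ha hc
  have hs := sstar_pos (a := a) hb hc
  have hle := le_sstar ha hb hc
  have hQi : Qinf a b c = Matrix.diagonal
      ![-sstar a b c / 3, -sstar a b c / 3, 2 * sstar a b c / 3] := by
    ext i j
    fin_cases i <;> fin_cases j <;> simp [Qinf, outer, ez] <;> ring
  have hval : gpot a b c (Qinf a b c) = -a * sstar a b c ^ 2 / 3 - 2 * b * sstar a b c ^ 3 / 27
      + c * sstar a b c ^ 4 / 9 := by
    rw [hQi]
    simp [gpot, Matrix.diagonal_mul_diagonal, Fin.sum_univ_three]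
    ring
  have hcube := hQ.trace_cube_sq_le
  have h0 : 0 ≤ (Q * Q).trace := hQ.mnormSq_nonneg
  rw [hval, gpot]
  set s := sstar a b c
  set Φ := (Q * Q).trace
  set τ := (Q * Q * Q).trace
  set t := √(3 * Φ / 2) with ht
  have ht2 : Φ = 2 * t ^ 2 / 3 := by rw [ht, Real.sq_sqrt (by positivity)]; ring
  have ht0 : 0 ≤ t := Real.sqrt_nonneg _
  have hτ : τ ≤ 2 * t ^ 3 / 9 := by
    refine le_of_sq_le_sq ?_ (by positivity)
    rw [ht2] at hcube
    nlinarith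
  have hτ' := mul_le_mul_of_nonneg_left hτ hb.le
  have e3a : a = (2 * c * s ^ 2 - b * s) / 3 := by linarith
  have key : 0 ≤ (t - s) ^ 2 * (c * t ^ 2 / 9 + (2 * (c * s) / 9 - 2 * b / 27) * t
      + s / 27 * (3 * (c * s) - b)) := by
    refine mul_nonneg (sq_nonneg _) ?_
    have e1 : 0 ≤ 2 * (c * s) / 9 - 2 * b / 27 := by linarith
    have e2 : 0 ≤ 3 * (c * s) - b := by nlinarith
    positivity
  rw [ht2, e3a]
  nlinarith

/-- `Q · f(Q)` controls `|Q|⁴` once `|Q|` is large. -/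
lemma exists_coercive (ha : 0 ≤ a) (hb : 0 < b) (hc : 0 < c) : ∃ M : ℝ, 0 < M ∧ ∀ Q : Mat3, isS0 Q →
    M ≤ mnormSq Q → c / 2 * mnormSq Q ^ 2 ≤ ∑ i, ∑ j, Q i j * gradf a b c Q i j := by
  refine ⟨4 * (a + b ^ 2 / c + 1) / c, by positivity, fun Q hQ hM => ?_⟩
  have hsum : ∑ i, ∑ j, Q i j * gradf a b c Q i j
      = -a * mnormSq Q - b * (Q * Q * Q).trace + c * mnormSq Q ^ 2 := by
    have h1 : ∑ i, ∑ j, Q i j * gradf a b c Q i j = (gradf a b c Q * Q).trace := by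
      simp only [Matrix.trace, Matrix.diag, Matrix.mul_apply]
      refine Finset.sum_congr rfl fun i _ => Finset.sum_congr rfl fun j _ => ?_
      rw [hQ.1.apply i j, mul_comm]
    rw [h1]
    simp [gradf, add_mul, sub_mul, mnormSq, hQ.2]
    ring
  have hcube := hQ.trace_cube_sq_le
  have h0 := hQ.mnormSq_nonneg
  rw [hsum]
  change 6 * (Q * Q * Q).trace ^ 2 ≤ mnormSq Q ^ 3 at hcube
  set Φ := mnormSq Q
  set τ := (Q * Q * Q).trace
  have e1 : 4 * (a + b ^ 2 / c + 1) ≤ c * Φ := by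
    rwa [div_le_iff₀ hc, mul_comm Φ] at hM
  have hΦp : 0 < Φ := by
    have : 0 < 4 * (a + b ^ 2 / c + 1) := by positivity
    by_contra! hneg
    nlinarith
  have e2 : b * τ ≤ c / 4 * Φ ^ 2 := by
    refine le_of_sq_le_sq ?_ (by positivity)
    have e3 : b ^ 2 / c * 4 ≤ c * Φ := by nlinarith
    have e4 : 4 * b ^ 2 ≤ c ^ 2 * Φ := by
      have := mul_le_mul_of_nonneg_left e3 hc.le
      field_simp at this
      linarith
    have e5 : b ^ 2 * (6 * τ ^ 2) ≤ b ^ 2 * Φ ^ 3 := mul_le_mul_of_nonneg_left hcube (sq_nonneg b)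
    have e6 : 4 * b ^ 2 * Φ ^ 3 ≤ c ^ 2 * Φ * Φ ^ 3 := mul_le_mul_of_nonneg_right e4 (by positivity)
    nlinarith
  have e3 : 4 * a ≤ c * Φ := by
    have : 0 ≤ b ^ 2 / c := by positivity
    linarith
  nlinarith

end Stationary

lemma contDiff_gradf (a b c : ℝ) (i j : Fin 3) :
    ContDiff ℝ 1 fun q : Fin 3 → Fin 3 → ℝ => gradf a b c (Matrix.of q) i j := by
  simp only [gradf, mnormSq, Matrix.trace, Matrix.diag, Matrix.mul_apply, Matrix.add_apply,
    Matrix.sub_apply, Matrix.smul_apply, Matrix.of_apply, smul_eq_mul]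
  fun_prop

lemma contDiff_gpot (a b c : ℝ) :
    ContDiff ℝ 1 fun q : Fin 3 → Fin 3 → ℝ => gpot a b c (Matrix.of q) := by
  simp only [gpot, Matrix.trace, Matrix.diag, Matrix.mul_apply, Matrix.of_apply]
  fun_prop

lemma lipschitz_of_contDiff {f : (Fin 3 → Fin 3 → ℝ) → ℝ} (hf : ContDiff ℝ 1 f) (B : ℝ) :
    ∃ C, 0 ≤ C ∧ ∀ p q : Fin 3 → Fin 3 → ℝ, ‖p‖ ≤ B → ‖q‖ ≤ B → |f p - f q| ≤ C * ‖p - q‖ := by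
  obtain ⟨C, hC⟩ := (isCompact_closedBall (0 : Fin 3 → Fin 3 → ℝ) B).exists_bound_of_continuousOn
    (hf.continuous_fderiv (by simp)).continuousOn
  refine ⟨max C 0, le_max_right _ _, fun p q hp hq => ?_⟩
  exact (convex_closedBall (0 : Fin 3 → Fin 3 → ℝ) B).norm_image_sub_le_of_norm_fderiv_le
    (fun x _ => hf.differentiable (by simp) x) (fun x hx => (hC x hx).trans (le_max_left _ _))
    (by simpa using hq) (by simpa using hp)

lemma norm_le_of_entries {p : Fin 3 → Fin 3 → ℝ} {B : ℝ} (hB : ∀ i j, |p i j| ≤ B) : ‖p‖ ≤ B := by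
  have h0 : 0 ≤ B := (abs_nonneg _).trans (hB 0 0)
  exact (pi_norm_le_iff_of_nonneg h0).2 fun i => (pi_norm_le_iff_of_nonneg h0).2 fun j => hB i j

/-- `f` is Lipschitz on bounded sets of matrices. -/
lemma exists_gradf_lipschitz (a b c B : ℝ) : ∃ C, 0 ≤ C ∧ ∀ P Q : Mat3, (∀ i j, |P i j| ≤ B) →
    (∀ i j, |Q i j| ≤ B) → ∀ d, (∀ i j, |P i j - Q i j| ≤ d) →
    ∀ i j, |gradf a b c P i j - gradf a b c Q i j| ≤ C * d := by
  choose C hC0 hC using fun i j => lipschitz_of_contDiff (contDiff_gradf a b c i j) B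
  refine ⟨∑ i, ∑ j, C i j, Finset.sum_nonneg fun i _ => Finset.sum_nonneg fun j _ => hC0 i j,
    fun P Q hP hQ d hd i j => ?_⟩
  have h := hC i j P Q (norm_le_of_entries hP) (norm_le_of_entries hQ)
  let p : Fin 3 → Fin 3 → ℝ := P
  let q : Fin 3 → Fin 3 → ℝ := Q
  have hd' : ‖p - q‖ ≤ d := norm_le_of_entries hd
  refine h.trans (mul_le_mul ?_ hd' (norm_nonneg _)
    (Finset.sum_nonneg fun i _ => Finset.sum_nonneg fun j _ => hC0 i j))
  calc C i j ≤ ∑ j, C i j :=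
        Finset.single_le_sum (f := fun j => C i j) (fun _ _ => hC0 _ _) (Finset.mem_univ j)
    _ ≤ _ := Finset.single_le_sum (f := fun i => ∑ j, C i j)
        (fun _ _ => Finset.sum_nonneg fun _ _ => hC0 _ _) (Finset.mem_univ i)

lemma hasDerivAt_gpot_line (a b c : ℝ) {A D : Mat3} (hD : isS0 D) :
    HasDerivAt (fun s : ℝ => gpot a b c (A + s • D)) (∑ i, ∑ j, gradf a b c A i j * D i j) 0 := by
  have h2 : ∀ s : ℝ, ((A + s • D) * (A + s • D)).trace
      = (A * A).trace + s * (2 * (A * D).trace) + s ^ 2 * (D * D).trace := by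
    intro s
    simp only [add_mul, mul_add, Matrix.trace_add, Matrix.smul_mul, Matrix.mul_smul,
      Matrix.trace_smul, smul_eq_mul, Matrix.trace_mul_comm D A]
    ring
  have h3 : ∀ s : ℝ, ((A + s • D) * (A + s • D) * (A + s • D)).trace
      = (A * A * A).trace + s * (3 * (A * A * D).trace) + s ^ 2 * (3 * (A * D * D).trace)
        + s ^ 3 * (D * D * D).trace := by
    intro s
    have e1 : (A * D * A).trace = (A * A * D).trace := by
      rw [Matrix.trace_mul_comm, ← mul_assoc]
    have e2 : (D * A * A).trace = (A * A * D).trace := by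
      rw [mul_assoc, Matrix.trace_mul_comm]
    have e3 : (D * A * D).trace = (A * D * D).trace := by
      rw [Matrix.trace_mul_comm, ← mul_assoc, Matrix.trace_mul_comm, ← mul_assoc]
    have e4 : (D * D * A).trace = (A * D * D).trace := by
      rw [Matrix.trace_mul_comm, ← mul_assoc]
    simp only [add_mul, mul_add, Matrix.trace_add, Matrix.smul_mul, Matrix.mul_smul,
      Matrix.trace_smul, smul_eq_mul, e1, e2, e3, e4]
    ring
  have hsum : ∑ i, ∑ j, gradf a b c A i j * D i j
      = -a * (A * D).trace - b * (A * A * D).trace + c * (A * A).trace * (A * D).trace := by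
    have h1 : ∑ i, ∑ j, gradf a b c A i j * D i j = (gradf a b c A * D).trace := by
      simp only [Matrix.trace, Matrix.diag, Matrix.mul_apply]
      refine Finset.sum_congr rfl fun i _ => Finset.sum_congr rfl fun j _ => ?_
      rw [hD.1.apply i j]
    rw [h1]
    simp [gradf, add_mul, sub_mul, mnormSq, hD.2]
  rw [hsum]
  simp only [gpot, h2, h3]
  have i1 := hasDerivAt_id (0 : ℝ)
  have q2 := ((i1.mul_const (2 * (A * D).trace)).const_add (A * A).trace).fun_add
    ((i1.fun_pow 2).mul_const (D * D).trace)
  have q3 := (((i1.mul_const (3 * (A * A * D).trace)).const_add (A * A * A).trace).fun_add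
    ((i1.fun_pow 2).mul_const (3 * (A * D * D).trace))).fun_add
    ((i1.fun_pow 3).mul_const (D * D * D).trace)
  refine (((q2.const_mul (-(a / 2))).fun_sub (q3.const_mul (b / 3))).fun_add
    ((q2.fun_pow 2).const_mul (c / 4))).congr_deriv ?_
  simp
  ring

lemma hasDerivAt_gpot_line_at (a b c : ℝ) (A : Mat3) {D : Mat3} (hD : isS0 D) (s : ℝ) :
    HasDerivAt (fun r : ℝ => gpot a b c (A + r • D))
      (∑ i, ∑ j, gradf a b c (A + s • D) i j * D i j) s := by
  have h : HasDerivAt (fun r : ℝ => gpot a b c (A + s • D + r • D))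
      (∑ i, ∑ j, gradf a b c (A + s • D) i j * D i j) (s - s) := by
    rw [sub_self]
    exact hasDerivAt_gpot_line a b c hD
  have h2 := HasDerivAt.comp_sub_const s s h
  have e : (fun r : ℝ => gpot a b c (A + r • D))
      = fun r : ℝ => gpot a b c (A + s • D + (r - s) • D) := by
    funext r
    rw [add_assoc, ← add_smul, add_sub_cancel]
  rw [e]
  exact h2

lemma gpot_fderiv_apply (a b c : ℝ) (p d : Fin 3 → Fin 3 → ℝ) (hd : isS0 (Matrix.of d)) :
    fderiv ℝ (fun q : Fin 3 → Fin 3 → ℝ => gpot a b c (Matrix.of q)) p d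
      = ∑ i, ∑ j, gradf a b c (Matrix.of p) i j * d i j := by
  have e : HasDerivAt (fun s : ℝ => p + s • d) d 0 := by
    have := ((hasDerivAt_id (0 : ℝ)).smul_const d).const_add p
    rwa [one_smul] at this
  have h : HasFDerivAt (fun q : Fin 3 → Fin 3 → ℝ => gpot a b c (Matrix.of q))
      (fderiv ℝ (fun q : Fin 3 → Fin 3 → ℝ => gpot a b c (Matrix.of q)) p) (p + (0 : ℝ) • d) := by
    rw [zero_smul, add_zero]
    exact ((contDiff_gpot a b c).differentiable (by simp) p).hasFDerivAt
  have h1 := HasFDerivAt.comp_hasDerivAt (0 : ℝ) h e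
  have h2 : HasDerivAt (fun s : ℝ => gpot a b c (Matrix.of (p + s • d)))
      (∑ i, ∑ j, gradf a b c (Matrix.of p) i j * d i j) 0 :=
    hasDerivAt_gpot_line a b c (A := Matrix.of p) hd
  exact h1.unique h2

lemma hasFDerivAt_gpot (a b c : ℝ) {Q : E3 → Mat3} {Q' : Fin 3 → Fin 3 → E3 →L[ℝ] ℝ} {x : E3}
    (hQ : ∀ i j, HasFDerivAt (fun y => Q y i j) (Q' i j) x)
    (h1 : ∀ v, isS0 (Matrix.of fun i j => Q' i j v)) :
    HasFDerivAt (fun y => gpot a b c (Q y)) (∑ i, ∑ j, gradf a b c (Q x) i j • Q' i j) x := by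
  let q : E3 → Fin 3 → Fin 3 → ℝ := fun y i j => Q y i j
  have h := ((contDiff_gpot a b c).differentiable (by simp) (q x)).hasFDerivAt
  have hq : HasFDerivAt q
      (ContinuousLinearMap.pi fun i => ContinuousLinearMap.pi fun j => Q' i j) x :=
    hasFDerivAt_pi.2 fun i => hasFDerivAt_pi.2 fun j => hQ i j
  have hc : HasFDerivAt (fun y => gpot a b c (Q y)) _ x := h.comp x hq
  refine hc.congr_fderiv ?_
  ext v
  refine (gpot_fderiv_apply a b c (q x) (fun i j => Q' i j v) (h1 v)).trans ?_
  simp only [sum_apply, smul_apply, smul_eq_mul]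
  rfl

/-- Near the ground state, the bulk energy is quadratic. -/
lemma exists_gpot_sub_le (a b c : ℝ) (ha : 0 ≤ a) (hc : 0 < c) (B : ℝ) :
    ∃ C, 0 ≤ C ∧ ∀ Q : Mat3, isS0 Q → (∀ i j, |Q i j| ≤ B) →
    gpot a b c Q - gpot a b c (Qinf a b c) ≤ C * mnormSq (Q - Qinf a b c) := by
  obtain ⟨B', hB', hB''⟩ : ∃ B', B ≤ B' ∧ ∀ i j, |Qinf a b c i j| ≤ B' := by
    obtain ⟨B₁, h⟩ := (Set.finite_range fun p : Fin 3 × Fin 3 => |Qinf a b c p.1 p.2|).bddAbove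
    exact ⟨max B B₁, le_max_left _ _, fun i j => (h ⟨(i, j), rfl⟩).trans (le_max_right _ _)⟩
  obtain ⟨C, hC0, hC⟩ := exists_gradf_lipschitz a b c B'
  refine ⟨9 * C, by positivity, fun Q hQ hQB => ?_⟩
  set P := Qinf a b c with hP
  set D := Q - P with hD
  have hD0 : isS0 D := hQ.sub (isS0_Qinf (a := a) (b := b) (c := c))
  have hd := hasDerivAt_gpot_line_at a b c P hD0
  have hc' : ContinuousOn (fun s : ℝ => gpot a b c (P + s • D)) (Icc 0 1) := fun s _ =>
    (hd s).continuousAt.continuousWithinAt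
  obtain ⟨s, hs, e⟩ := exists_hasDerivAt_eq_slope _ _ zero_lt_one hc' fun s _ => hd s
  have hP1 : P + (1 : ℝ) • D = Q := by rw [hD]; module
  rw [hP1] at e
  simp only [zero_smul, add_zero, sub_zero, div_one] at e
  rw [← e]
  have hm : ∀ i j, |D i j| ≤ √(mnormSq D) := fun i j =>
    Real.abs_le_sqrt (hD0.sq_le_mnormSq i j)
  have hsq : √(mnormSq D) ^ 2 = mnormSq D := Real.sq_sqrt hD0.mnormSq_nonneg
  have hb1 : ∀ i j, |(P + s • D) i j| ≤ B' := by
    intro i j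
    have : (P + s • D) i j = (1 - s) * P i j + s * Q i j := by
      simp [hD]; ring
    rw [this]
    calc |(1 - s) * P i j + s * Q i j| ≤ |(1 - s) * P i j| + |s * Q i j| := abs_add_le _ _
      _ = (1 - s) * |P i j| + s * |Q i j| := by
          rw [abs_mul, abs_mul, abs_of_nonneg (by linarith [hs.2] : 0 ≤ 1 - s), abs_of_pos hs.1]
      _ ≤ (1 - s) * B' + s * B' := by
          have h1 := hB'' i j
          have h2 := (hQB i j).trans hB'
          have := hs.1; have := hs.2
          gcongr
      _ = B' := by ring
  have hf : ∀ i j, |gradf a b c (P + s • D) i j| ≤ C * √(mnormSq D) := by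
    intro i j
    have := hC (P + s • D) P hb1 hB'' (√(mnormSq D)) (fun i j => by
      have : (P + s • D) i j - P i j = s * D i j := by simp
      rw [this, abs_mul, abs_of_pos hs.1]
      have := hm i j
      have := hs.2
      nlinarith [abs_nonneg (D i j)]) i j
    rwa [gradf_Qinf ha hc, Matrix.zero_apply, sub_zero] at this
  calc ∑ i, ∑ j, gradf a b c (P + s • D) i j * D i j
      ≤ ∑ _i : Fin 3, ∑ _j : Fin 3, C * √(mnormSq D) * √(mnormSq D) := by
        refine Finset.sum_le_sum fun i _ => Finset.sum_le_sum fun j _ => ?_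
        refine (le_abs_self _).trans ?_
        rw [abs_mul]
        exact mul_le_mul (hf i j) (hm i j) (abs_nonneg _) ((abs_nonneg _).trans (hf i j))
    _ = 9 * C * mnormSq D := by rw [← hsq]; simp; ring

/-! ### The uniform bound -/

lemma keller_osserman_numeric {R q r w : ℝ} (hR : 1 ≤ R) (hq₀ : 0 ≤ q - 1) (hq : q - 1 ≤ R ^ 2)
    (hr : 0 < r) (hrR : r ≤ R ^ 4) (hw : 0 < w) :
    r ^ 2 * w * (6 * (r ^ 4)⁻¹ * (16 * (q - 1) ^ 2 * q) + 2 * (r ^ 3)⁻¹ * (8 * q + 12 * (q - 1)))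
      ≤ w * (248 * R ^ 6) / r ^ 2 := by
  have hR2 : 1 ≤ R ^ 2 := one_le_pow₀ hR
  have e₁ : r ^ 2 * w * (6 * (r ^ 4)⁻¹ * (16 * (q - 1) ^ 2 * q)
      + 2 * (r ^ 3)⁻¹ * (8 * q + 12 * (q - 1)))
      = w * (96 * (q - 1) ^ 2 * q + r * (16 * q + 24 * (q - 1))) / r ^ 2 := by
    field_simp
    ring
  have a₁ : (q - 1) ^ 2 ≤ (R ^ 2) ^ 2 := pow_le_pow_left₀ hq₀ hq 2
  have a₂ : (q - 1) ^ 2 * q ≤ (R ^ 2) ^ 2 * (2 * R ^ 2) :=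
    mul_le_mul a₁ (by linarith) (by linarith) (by positivity)
  have a₃ : r * (16 * q + 24 * (q - 1)) ≤ R ^ 4 * (56 * R ^ 2) :=
    mul_le_mul hrR (by linarith) (by linarith) (by positivity)
  have e₂ : 96 * (q - 1) ^ 2 * q + r * (16 * q + 24 * (q - 1)) ≤ 248 * R ^ 6 := by
    linarith [show (R ^ 2) ^ 2 * (2 * R ^ 2) = 2 * R ^ 6 by ring,
      show R ^ 4 * (56 * R ^ 2) = 56 * R ^ 6 by ring]
  rw [e₁]
  gcongr

/-- A Keller–Osserman bound: a solution of `ΔΦ ≥ k Φ²` on `{Φ ≥ M}` that increases radially on the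
part of the unit sphere where `Φ > M` satisfies `Φ ≤ M`, regardless of its behaviour at infinity. -/
lemma le_of_keller_osserman {Φ : E3 → ℝ} {k M : ℝ} (hk : 0 < k) (hM : 0 ≤ M)
    (hΦ : ContDiffOn ℝ 2 Φ OmegaBar) (hΔ : ∀ x ∈ Omega, M ≤ Φ x → k * Φ x ^ 2 ≤ lapl Φ x)
    (hb : ∀ x, ‖x‖ = 1 → M < Φ x → 0 < rad Φ x) {x : E3} (hx : x ∈ OmegaBar) : Φ x ≤ M := by
  have key : ∀ R : ℝ, 1 ≤ R → ‖x‖ ^ 2 - 1 ≤ R ^ 2 →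
      (R ^ 4 - (‖x‖ ^ 2 - 1) ^ 2) ^ 2 * (Φ x - M) ≤ 248 * R ^ 6 / k := by
    intro R hR hxR
    set ρ : E3 → ℝ := fun y => R ^ 4 - (‖y‖ ^ 2 - 1) ^ 2 with hρ
    have hnn : 0 ≤ 248 * R ^ 6 / k := by positivity
    have hsq : √(R ^ 2 + 1) ^ 2 = R ^ 2 + 1 := Real.sq_sqrt (by positivity)
    have hK := isCompact_annulus 1 √(R ^ 2 + 1)
    have hKmem : ∀ y, y ∈ {y : E3 | 1 ≤ ‖y‖ ∧ ‖y‖ ≤ √(R ^ 2 + 1)} ↔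
        1 ≤ ‖y‖ ∧ ‖y‖ ^ 2 - 1 ≤ R ^ 2 := by
      intro y
      show (1 ≤ ‖y‖ ∧ ‖y‖ ≤ √(R ^ 2 + 1)) ↔ _
      rw [Real.le_sqrt (norm_nonneg _) (by positivity), sub_le_iff_le_add]
    have hcont : ContinuousOn (fun y => ρ y ^ 2 * (Φ y - M))
        {y : E3 | 1 ≤ ‖y‖ ∧ ‖y‖ ≤ √(R ^ 2 + 1)} := by
      refine ContinuousOn.mul (by fun_prop) ((hΦ.continuousOn.mono fun y hy => ?_).sub
        continuousOn_const)
      exact ((hKmem y).1 hy).1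
    obtain ⟨z, hz, hmax⟩ := hK.exists_isMaxOn ⟨x, (hKmem x).2 ⟨hx, hxR⟩⟩ hcont
    have hxz := hmax ((hKmem x).2 ⟨hx, hxR⟩)
    change ρ x ^ 2 * (Φ x - M) ≤ ρ z ^ 2 * (Φ z - M) at hxz
    refine le_trans hxz ?_
    by_contra! hpos
    have hz' := (hKmem z).1 hz
    have hP : 0 < ρ z ^ 2 * (Φ z - M) := hnn.trans_lt hpos
    have hρz : 0 < ρ z ^ 2 := lt_of_le_of_ne (sq_nonneg _) fun h => by simp [← h] at hP
    have hw : 0 < Φ z - M := (pos_iff_pos_of_mul_pos hP).1 hρz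
    have hq0 : 0 ≤ ‖z‖ ^ 2 - 1 := by nlinarith [hz'.1]
    have hR2 : 1 ≤ R ^ 2 := one_le_pow₀ hR
    have hρ0 : 0 ≤ ρ z := by
      simp only [hρ]; nlinarith [hz'.2]
    have hρp : 0 < ρ z := lt_of_le_of_ne hρ0 fun h => by simp [← h] at hρz
    have hqlt : ‖z‖ ^ 2 - 1 < R ^ 2 := by
      refine lt_of_le_of_ne hz'.2 fun h => ?_
      simp only [hρ, h] at hρp
      nlinarith
    set P := ρ z ^ 2 * (Φ z - M) with hPdef
    have hcmp : ∀ y, 1 ≤ ‖y‖ → ‖y‖ ^ 2 - 1 < R ^ 2 → Φ y - M ≤ P * ρ y ^ (-2 : ℤ) := by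
      intro y hy1 hy2
      have hy3 : 0 ≤ ‖y‖ ^ 2 - 1 := by nlinarith
      have hρy : 0 < ρ y := by
        have : (‖y‖ ^ 2 - 1) ^ 2 < (R ^ 2) ^ 2 := pow_lt_pow_left₀ hy2 hy3 two_ne_zero
        simp only [hρ]
        linarith [show (R ^ 2) ^ 2 = R ^ 4 by ring]
      have := hmax ((hKmem y).2 ⟨hy1, hy2.le⟩)
      change ρ y ^ 2 * (Φ y - M) ≤ P at this
      rw [zpow_neg, ← div_eq_mul_inv, le_div_iff₀ (by positivity)]
      rw [mul_comm]; exact_mod_cast this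
    have hzeq : Φ z - M = P * ρ z ^ (-2 : ℤ) := by
      rw [hPdef, zpow_neg, mul_comm (ρ z ^ 2), mul_assoc]
      norm_cast
      rw [mul_inv_cancel₀ hρz.ne', mul_one]
    rcases eq_or_lt_of_le hz'.1 with h1 | h1
    · have hr := hb z h1.symm (by linarith)
      have hp : HasDerivAt (fun s : ℝ => P * (R ^ 4 - (s ^ 2 - 1) ^ 2) ^ (-2 : ℤ)) 0 1 := by
        have e1 : HasDerivAt (fun s : ℝ => R ^ 4 - (s ^ 2 - 1) ^ 2) 0 1 :=
          (((((hasDerivAt_id (1 : ℝ)).fun_pow 2).sub_const 1).fun_pow 2).const_sub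
            (R ^ 4)).congr_deriv (by simp)
        have e2 := (hasDerivAt_zpow (-2) (R ^ 4 - ((1 : ℝ) ^ 2 - 1) ^ 2)
          (Or.inl (by simp; positivity))).comp (1 : ℝ) e1
        exact (e2.const_mul P).congr_deriv (by simp)
      have := rad_nonpos_of_max (x := z) (mem_OmegaBar.2 hz'.1)
        ((hΦ.differentiableOn (by simp)) z hz'.1) hp ?_
      · linarith
      · have hc : ∀ᶠ s : ℝ in 𝓝[>] 1, s ^ 2 - 1 < R ^ 2 := by
          refine Filter.Eventually.filter_mono nhdsWithin_le_nhds ?_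
          exact ContinuousAt.eventually_lt (by fun_prop) continuousAt_const (by simp; positivity)
        filter_upwards [hc, self_mem_nhdsWithin] with s hs hs1
        have hs1' : 1 < s := hs1
        have hns : ‖s • z‖ = s := by
          rw [norm_smul, ← h1, Real.norm_of_nonneg (by linarith), mul_one]
        have := hcmp (s • z) (by rw [hns]; exact hs1'.le) (by rwa [hns])
        simp only [hρ, hns, ← h1] at this hzeq ⊢
        linarith
    · have hzΩ : z ∈ Omega := h1
      have hJρ : HasJ ρ z (0 - ((2 : ℝ) * (‖z‖ ^ 2 - 1)) • ((2 : ℝ) • z - 0))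
          (0 - (2 * ‖(2 : ℝ) • z - 0‖ ^ 2 + 2 * (‖z‖ ^ 2 - 1) * (6 - 0))) := by
        refine ((HasJ.const (R ^ 4)).sub
          (((HasJ.normSq z).sub (HasJ.const 1)).pow 2)).congr_val ?_ ?_ <;> norm_num
      have hJ := (hJρ.comp (G := fun t => t ^ (-2 : ℤ)) (G' := fun t => -2 * t ^ (-3 : ℤ))
        (G'' := 6 * ρ z ^ (-4 : ℤ)) ?_ ?_ ?_).const_mul P
      rotate_left
      · have e : (fun t : ℝ => t ^ (-2 : ℤ)) = fun t => (t ^ 2)⁻¹ := by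
          funext t; rw [zpow_neg]; norm_cast
        rw [e]
        exact (contDiffAt_id.pow 2).inv (pow_ne_zero 2 hρp.ne')
      · filter_upwards [lt_mem_nhds hρp] with y hy
        simpa using hasDerivAt_zpow (-2) y (Or.inl hy.ne')
      · exact ((hasDerivAt_zpow (-3) (ρ z) (Or.inl hρp.ne')).const_mul (-2)).congr_deriv
          (by norm_num; ring)
      have hΦz := contDiffAt_of_mem hΦ hzΩ
      have hD := ((hasJ_of_contDiffAt hΦz).sub (HasJ.const M)).sub hJ
      have hloc : IsLocalMax (fun y => Φ y - M - P * ρ y ^ (-2 : ℤ)) z := by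
        have e1 : ∀ᶠ y in 𝓝 z, ‖y‖ ^ 2 - 1 < R ^ 2 :=
          ContinuousAt.eventually_lt (by fun_prop) continuousAt_const hqlt
        filter_upwards [Omega_mem_nhds hzΩ, e1] with y hy1 hy2
        have := hcmp y (Omega_subset hy1) hy2
        linarith
      have hle := lapl_nonpos_of_isLocalMax hD.1 hloc
      rw [hD.2.2] at hle
      have hLap := hΔ z hzΩ (by linarith)
      have hnum := keller_osserman_numeric (w := Φ z - M) hR hq0 hqlt.le hρp
        (by simp only [hρ]; linarith [sq_nonneg (‖z‖ ^ 2 - 1)]) hw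
      have e1 : P * (6 * ρ z ^ (-4 : ℤ) * ‖0 - ((2 : ℝ) * (‖z‖ ^ 2 - 1)) • ((2 : ℝ) • z - 0)‖ ^ 2
          + -2 * ρ z ^ (-3 : ℤ) * (0 - (2 * ‖(2 : ℝ) • z - 0‖ ^ 2 + 2 * (‖z‖ ^ 2 - 1) * (6 - 0))))
          = ρ z ^ 2 * (Φ z - M) * (6 * (ρ z ^ 4)⁻¹ * (16 * (‖z‖ ^ 2 - 1) ^ 2 * ‖z‖ ^ 2)
          + 2 * (ρ z ^ 3)⁻¹ * (8 * ‖z‖ ^ 2 + 12 * (‖z‖ ^ 2 - 1))) := by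
        have z3 : ρ z ^ (-3 : ℤ) = (ρ z ^ 3)⁻¹ := by rw [zpow_neg]; norm_cast
        have z4 : ρ z ^ (-4 : ℤ) = (ρ z ^ 4)⁻¹ := by rw [zpow_neg]; norm_cast
        rw [hPdef, z3, z4]
        simp only [sub_zero, zero_sub, norm_neg, norm_smul, mul_pow, Real.norm_eq_abs, sq_abs]
        ring
      rw [e1] at hle
      have h2 : k * (Φ z - M) ^ 2 ≤ lapl Φ z := by
        refine le_trans (mul_le_mul_of_nonneg_left ?_ hk.le) hLap
        exact pow_le_pow_left₀ hw.le (by linarith) 2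
      have e5 : k * (Φ z - M) ^ 2 ≤ (Φ z - M) * (248 * R ^ 6) / ρ z ^ 2 := by linarith
      rw [le_div_iff₀ hρz] at e5
      rw [div_lt_iff₀ hk] at hpos
      have e6 := mul_lt_mul_of_pos_left hpos hw
      rw [hPdef] at e6
      linarith
  by_contra! hlt
  have hlim : Tendsto (fun R : ℝ => 248 * (R ^ 2)⁻¹ / k) atTop (𝓝 (248 * 0 / k)) :=
    ((tendsto_inv_atTop_zero.comp (tendsto_pow_atTop two_ne_zero)).const_mul 248).div_const k
  have hlim2 : Tendsto (fun R : ℝ => (1 - (‖x‖ ^ 2 - 1) ^ 2 * (R ^ 4)⁻¹) ^ 2 * (Φ x - M)) atTop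
      (𝓝 ((1 - (‖x‖ ^ 2 - 1) ^ 2 * 0) ^ 2 * (Φ x - M))) :=
    ((((tendsto_inv_atTop_zero.comp (tendsto_pow_atTop four_ne_zero)).const_mul _).const_sub
      1).pow 2).mul_const _
  have := le_of_tendsto_of_tendsto hlim2 hlim ?_
  · simp at this; linarith
  · filter_upwards [eventually_ge_atTop (max 1 ‖x‖)] with R hR
    have h1 : 1 ≤ R := (le_max_left _ _).trans hR
    have h2 : ‖x‖ ≤ R := (le_max_right _ _).trans hR
    have h3 := key R h1 (by nlinarith [norm_nonneg x])
    have hR0 : 0 < R := by linarith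
    have e1 : (1 - (‖x‖ ^ 2 - 1) ^ 2 * (R ^ 4)⁻¹) ^ 2 * (Φ x - M)
        = ((R ^ 4 - (‖x‖ ^ 2 - 1) ^ 2) ^ 2 * (Φ x - M)) / R ^ 8 := by
      field_simp
    have e2 : 248 * (R ^ 2)⁻¹ / k = (248 * R ^ 6 / k) / R ^ 8 := by
      field_simp
    rw [e1, e2]
    gcongr

/-- The Euler–Lagrange system with weak anchoring, together with the properties that are used
below. The number `κ` is `L / W`, which vanishes for strong anchoring. -/
structure LdGSol (a b c L κ : ℝ) (Q : E3 → Mat3) : Prop where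
  a_nonneg : 0 ≤ a
  b_pos : 0 < b
  c_pos : 0 < c
  L_pos : 0 < L
  kappa_nonneg : 0 ≤ κ
  reg : RegC 2 Q
  mem : memH a b c Q
  el : isEL a b c L Q
  anchor : ∀ x : E3, ‖x‖ = 1 → κ • nuDeriv Q x = Qsurf a b c x - Q x

section Entries

variable {a b c L κ : ℝ} {Q : E3 → Mat3}

lemma LdGSol.lapl_entry (h : LdGSol a b c L κ Q) {x : E3} (hx : x ∈ Omega) (i j : Fin 3) :
    L * lapl (fun y => Q y i j) x = gradf a b c (Q x) i j := by
  have := congrFun₂ (h.el x hx) i j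
  rw [← this, Matrix.smul_apply, matLap, Matrix.of_apply, smul_eq_mul,
    lap3_eq hx (contDiffAt_of_mem (h.reg i j) hx)]

lemma LdGSol.rad_entry (h : LdGSol a b c L κ Q) {x : E3} (hx : ‖x‖ = 1) (i j : Fin 3) :
    κ * rad (fun y => Q y i j) x = Q x i j - Qsurf a b c x i j := by
  have := congrFun₂ (h.anchor x hx) i j
  rw [Matrix.smul_apply, nuDeriv, Matrix.of_apply, er, hx, inv_one, one_smul, map_neg, smul_eq_mul,
    Matrix.sub_apply] at this
  rw [rad]
  linarith

lemma mnormSq_Qsurf {x : E3} (hx : ‖x‖ = 1) :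
    ∑ i, ∑ j, Qsurf a b c x i j ^ 2 = 2 * sstar a b c ^ 2 / 3 := by
  have h : x 0 ^ 2 + x 1 ^ 2 + x 2 ^ 2 = 1 := by
    have := EuclideanSpace.norm_sq_eq x
    rw [hx, Fin.sum_univ_three] at this
    simpa using this.symm
  simp only [Qsurf, er, hx, outer, Fin.sum_univ_three, inv_one, one_smul]
  simp
  have h2 : x 2 ^ 2 = 1 - x 0 ^ 2 - x 1 ^ 2 := by linarith
  linear_combination (sstar a b c ^ 2 * (x 0 ^ 2 + x 1 ^ 2 + x 2 ^ 2 + 1 - 2 / 3)) * h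

lemma LdGSol.mnormSq_le (h : LdGSol a b c L κ Q) {M : ℝ}
    (hM : ∀ Q : Mat3, isS0 Q → M ≤ mnormSq Q →
      c / 2 * mnormSq Q ^ 2 ≤ ∑ i, ∑ j, Q i j * gradf a b c Q i j)
    {x : E3} (hx : x ∈ OmegaBar) : mnormSq (Q x) ≤ max M (2 * sstar a b c ^ 2 / 3) := by
  set Φ : E3 → ℝ := fun y => ∑ i, ∑ j, Q y i j ^ 2 with hΦ
  have hΦeq : ∀ y ∈ OmegaBar, Φ y = mnormSq (Q y) := fun y hy => ((h.mem.1 y hy).mnormSq_eq).symm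
  have hL := h.L_pos
  have hc := h.c_pos
  rw [← hΦeq x hx]
  refine le_of_keller_osserman (k := c / L) (by positivity)
    (le_max_of_le_right (by positivity)) ?_ ?_ ?_ hx
  · exact ContDiffOn.sum fun i _ => ContDiffOn.sum fun j _ => (h.reg i j).pow 2
  · intro y hy hMy
    have hJ := HasJ.sum Finset.univ fun i _ => HasJ.sum Finset.univ fun j _ =>
      (hasJ_of_contDiffAt (contDiffAt_of_mem (h.reg i j) hy)).pow 2
    have hl : lapl Φ y = _ := hJ.2.2
    have hy' := Omega_subset hy
    rw [hΦeq y hy'] at hMy ⊢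
    have := hM (Q y) (h.mem.1 y hy') ((le_max_left _ _).trans hMy)
    rw [div_mul_eq_mul_div, div_le_iff₀ hL, hl]
    have hsum : 2 * ∑ i, ∑ j, Q y i j * gradf a b c (Q y) i j
        ≤ (∑ i, ∑ j, (((2 : ℕ) : ℝ) * (((2 - 1 : ℕ) : ℝ) * Q y i j ^ (2 - 1 - 1))
          * ‖(InnerProductSpace.toDual ℝ E3).symm (fderiv ℝ (fun y => Q y i j) y)‖ ^ 2
          + ((2 : ℕ) : ℝ) * Q y i j ^ (2 - 1) * lapl (fun y => Q y i j) y)) * L := by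
      rw [Finset.mul_sum, Finset.sum_mul]
      refine Finset.sum_le_sum fun i _ => ?_
      rw [Finset.mul_sum, Finset.sum_mul]
      refine Finset.sum_le_sum fun j _ => ?_
      rw [← h.lapl_entry hy]
      have : 0 ≤ 2 * ‖(InnerProductSpace.toDual ℝ E3).symm (fderiv ℝ (fun y => Q y i j) y)‖ ^ 2
          * L :=
        by positivity
      have e : lapl (fun y => Q y i j) y = lapl (fun x => Q x i j) y := rfl
      norm_num at this ⊢
      linear_combination this
    linarith
  · intro y hy hMy
    have hy' : y ∈ OmegaBar := mem_OmegaBar.2 hy.ge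
    have hd : HasFDerivWithinAt Φ (∑ i, ∑ j, ((2 : ℕ) • Q y i j ^ (2 - 1)) •
        fderivWithin ℝ (fun y => Q y i j) OmegaBar y) OmegaBar y :=
      HasFDerivWithinAt.fun_sum fun i _ => HasFDerivWithinAt.fun_sum fun j _ =>
        (((h.reg i j).differentiableOn (by simp)) y hy').hasFDerivWithinAt.pow 2
    have hr : rad Φ y = ∑ i, ∑ j, 2 * Q y i j * rad (fun y => Q y i j) y := by
      rw [rad, hd.fderivWithin (uniqueDiffOn_OmegaBar y hy')]
      simp [rad]
    have hk : κ * rad Φ y = ∑ i, ∑ j, 2 * Q y i j * (Q y i j - Qsurf a b c y i j) := by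
      rw [hr, Finset.mul_sum]
      refine Finset.sum_congr rfl fun i _ => ?_
      rw [Finset.mul_sum]
      refine Finset.sum_congr rfl fun j _ => ?_
      rw [← h.rad_entry hy]; ring
    have hge : Φ y - 2 * sstar a b c ^ 2 / 3 ≤ κ * rad Φ y := by
      rw [hk, ← mnormSq_Qsurf hy, ← Finset.sum_sub_distrib]
      refine Finset.sum_le_sum fun i _ => ?_
      rw [← Finset.sum_sub_distrib]
      refine Finset.sum_le_sum fun j _ => ?_
      nlinarith [sq_nonneg (Q y i j - Qsurf a b c y i j)]
    have hpos : 0 < κ * rad Φ y := by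
      have := (le_max_right M (2 * sstar a b c ^ 2 / 3)).trans_lt hMy
      linarith
    exact (pos_iff_pos_of_mul_pos hpos).1
      (lt_of_le_of_ne h.kappa_nonneg fun e => by simp [← e] at hpos)

/-- Solutions are bounded in terms of `a`, `b`, `c` only. -/
lemma exists_entry_bound (ha : 0 ≤ a) (hb : 0 < b) (hc : 0 < c) : ∃ B : ℝ, 1 ≤ B ∧
    ∀ (L κ : ℝ) (Q : E3 → Mat3), LdGSol a b c L κ Q → ∀ x ∈ OmegaBar, ∀ i j, |Q x i j| ≤ B := by
  obtain ⟨M, -, hM⟩ := exists_coercive ha hb hc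
  refine ⟨max 1 √(max M (2 * sstar a b c ^ 2 / 3)), le_max_left _ _, fun L κ Q h x hx i j =>
    (Real.abs_le_sqrt ?_).trans (le_max_right _ _)⟩
  exact ((h.mem.1 x hx).sq_le_mnormSq i j).trans (h.mnormSq_le hM hx)

end Entries

/-! ### The harmonic reference field -/

/-- The decaying quadrupole harmonic attached to a pair of directions. -/
def quadHarm (n m x : E3) : ℝ := ⟪n, x⟫ * ⟪m, x⟫ * ‖x‖⁻¹ ^ 5 - ⟪n, m⟫ / 3 * ‖x‖⁻¹ ^ 3

lemma norm_mul_norm_inv {x : E3} (hx : x ≠ 0) : ‖x‖ * ‖x‖⁻¹ = 1 :=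
  mul_inv_cancel₀ (norm_ne_zero_iff.2 hx)

lemma abs_quadHarm_le {n m x : E3} (hn : ‖n‖ = 1) (hm : ‖m‖ = 1) (hx : x ≠ 0) :
    |quadHarm n m x| ≤ 2 * ‖x‖⁻¹ ^ 3 := by
  have h := norm_mul_norm_inv hx
  have hρ : 0 ≤ ‖x‖⁻¹ := by positivity
  have h1 : |⟪n, x⟫| ≤ ‖x‖ := by simpa [hn] using abs_real_inner_le_norm n x
  have h2 : |⟪m, x⟫| ≤ ‖x‖ := by simpa [hm] using abs_real_inner_le_norm m x
  have h3 : |⟪n, m⟫| ≤ 1 := by simpa [hm, hn] using abs_real_inner_le_norm n m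
  have e1 : |⟪n, x⟫ * ⟪m, x⟫ * ‖x‖⁻¹ ^ 5| ≤ ‖x‖ * ‖x‖ * ‖x‖⁻¹ ^ 5 := by
    rw [abs_mul, abs_mul, abs_of_nonneg (pow_nonneg hρ 5)]
    gcongr
  have e2 : |⟪n, m⟫ / 3 * ‖x‖⁻¹ ^ 3| ≤ 1 / 3 * ‖x‖⁻¹ ^ 3 := by
    rw [abs_mul, abs_div, abs_of_nonneg (pow_nonneg hρ 3), abs_of_pos (three_pos (α := ℝ))]
    gcongr
  have e3 : ‖x‖ * ‖x‖ * ‖x‖⁻¹ ^ 5 = ‖x‖⁻¹ ^ 3 := by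
    linear_combination (‖x‖⁻¹ ^ 3 * (‖x‖ * ‖x‖⁻¹ + 1)) * h
  have := abs_sub (⟪n, x⟫ * ⟪m, x⟫ * ‖x‖⁻¹ ^ 5) (⟪n, m⟫ / 3 * ‖x‖⁻¹ ^ 3)
  have h0 : 0 ≤ ‖x‖⁻¹ ^ 3 := pow_nonneg hρ 3
  rw [quadHarm]
  linarith

lemma hasJ_quadHarm {n m x : E3} (hn : ‖n‖ = 1) (hm : ‖m‖ = 1) (hx : x ≠ 0) :
    ∃ g, HasJ (quadHarm n m) x g 0 ∧ ⟪g, x⟫ = -3 * quadHarm n m x ∧ ‖g‖ ≤ 8 * ‖x‖⁻¹ ^ 4 := by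
  have h := norm_mul_norm_inv hx
  have hρ : 0 ≤ ‖x‖⁻¹ := by positivity
  have h1 : |⟪n, x⟫| ≤ ‖x‖ := by simpa [hn] using abs_real_inner_le_norm n x
  have h2 : |⟪m, x⟫| ≤ ‖x‖ := by simpa [hm] using abs_real_inner_le_norm m x
  have h3 : |⟪n, m⟫| ≤ 1 := by simpa [hm, hn] using abs_real_inner_le_norm n m
  have hJ := (((HasJ.inner_left n x).mul (HasJ.inner_left m x)).mul ((HasJ.norm_inv hx).pow 5)).sub
    (((HasJ.norm_inv hx).pow 3).const_mul (⟪n, m⟫ / 3))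
  set p := ⟪n, x⟫
  set q := ⟪m, x⟫
  set δ := ⟪n, m⟫
  set ρ := ‖x‖⁻¹
  set r := ‖x‖
  have hxx : ⟪x, x⟫ = r ^ 2 := real_inner_self_eq_norm_sq x
  refine ⟨(ρ ^ 5 * p) • m + (ρ ^ 5 * q) • n + (-5 * (p * q) * ρ ^ 7 + δ * ρ ^ 5) • x,
    hJ.congr_val ?_ ?_, ?_, ?_⟩
  · norm_num
    module
  · simp only [norm_neg, norm_smul, norm_pow, inner_add_left, inner_smul_left,
      inner_smul_right, conj_trivial, neg_smul, smul_neg, inner_neg_right, mul_pow]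
    have e : ⟪m, x⟫ = q := rfl
    have e' : ⟪n, x⟫ = p := rfl
    have hx' : ‖x‖ = r := rfl
    rw [e, e', hx', Real.norm_of_nonneg hρ]
    norm_num
    linear_combination ((20 * p * q * ρ ^ 7 - 2 * δ * ρ ^ 5) * (r * ρ + 1)) * h
  · have e : ⟪m, x⟫ = q := rfl
    have e' : ⟪n, x⟫ = p := rfl
    simp only [inner_add_left, inner_smul_left, hxx, quadHarm, conj_trivial, e, e']
    have h5 : ρ ^ 7 * r ^ 2 = ρ ^ 5 := by linear_combination (ρ ^ 5 * (r * ρ + 1)) * h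
    have h6 : ρ ^ 5 * r ^ 2 = ρ ^ 3 := by linear_combination (ρ ^ 3 * (r * ρ + 1)) * h
    linear_combination (-5 * (p * q)) * h5 + δ * h6
  · have e1 : ‖(ρ ^ 5 * p) • m‖ ≤ ρ ^ 5 * r := by
      rw [norm_smul, hm, mul_one, norm_mul, Real.norm_of_nonneg (pow_nonneg hρ 5)]
      exact mul_le_mul_of_nonneg_left h1 (pow_nonneg hρ 5)
    have e2 : ‖(ρ ^ 5 * q) • n‖ ≤ ρ ^ 5 * r := by
      rw [norm_smul, hn, mul_one, norm_mul, Real.norm_of_nonneg (pow_nonneg hρ 5)]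
      exact mul_le_mul_of_nonneg_left h2 (pow_nonneg hρ 5)
    have e3 : ‖(-5 * (p * q) * ρ ^ 7 + δ * ρ ^ 5) • x‖
        ≤ (5 * (r * r) * ρ ^ 7 + 1 * ρ ^ 5) * r := by
      rw [norm_smul]
      refine mul_le_mul_of_nonneg_right ((norm_add_le _ _).trans (add_le_add ?_ ?_)) (norm_nonneg x)
      · rw [norm_mul, norm_mul, norm_mul, Real.norm_of_nonneg (pow_nonneg hρ 7), norm_neg,
          Real.norm_of_nonneg (by norm_num : (0 : ℝ) ≤ 5)]
        have hr : 0 ≤ r := norm_nonneg x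
        have h1' : ‖p‖ ≤ r := h1
        have h2' : ‖q‖ ≤ r := h2
        gcongr
      · rw [norm_mul, Real.norm_of_nonneg (pow_nonneg hρ 5)]
        exact mul_le_mul_of_nonneg_right h3 (pow_nonneg hρ 5)
    have e4 : ρ ^ 5 * r = ρ ^ 4 := by linear_combination ρ ^ 4 * h
    have e5 : (5 * (r * r) * ρ ^ 7 + 1 * ρ ^ 5) * r = 6 * ρ ^ 4 := by
      linear_combination (5 * ρ ^ 4 * (r ^ 2 * ρ ^ 2 + r * ρ + 1) + ρ ^ 4) * h
    refine (norm_add₃_le ..).trans ?_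
    linarith

/-- The three-parameter family of harmonic functions to which the entries of the reference field
and their radial derivatives belong. -/
def refHarm (α β γ : ℝ) (n m x : E3) : ℝ := α * quadHarm n m x + β * ‖x‖⁻¹ + γ

lemma norm_inv_le_one {x : E3} (hx : x ∈ OmegaBar) : ‖x‖⁻¹ ≤ 1 := inv_le_one_of_one_le₀ hx

lemma abs_refHarm_sub_le (α β γ : ℝ) {n m x : E3} (hn : ‖n‖ = 1) (hm : ‖m‖ = 1)
    (hx : x ∈ OmegaBar) : |refHarm α β γ n m x - γ| ≤ (2 * |α| + |β|) * ‖x‖⁻¹ := by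
  have hρ : 0 ≤ ‖x‖⁻¹ := by positivity
  have h1 := abs_quadHarm_le hn hm (ne_zero_of_mem hx)
  have h2 : ‖x‖⁻¹ ^ 3 ≤ ‖x‖⁻¹ := pow_le_of_le_one hρ (norm_inv_le_one hx) (by norm_num)
  rw [refHarm, add_sub_cancel_right]
  refine (abs_add_le _ _).trans ?_
  rw [abs_mul, abs_mul, abs_of_nonneg hρ, add_mul]
  have h3 : |α| * |quadHarm n m x| ≤ |α| * (2 * ‖x‖⁻¹) := by gcongr; linarith
  linarith

lemma hasJ_refHarm (α β γ : ℝ) {n m x : E3} (hn : ‖n‖ = 1) (hm : ‖m‖ = 1) (hx : x ∈ OmegaBar) :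
    ∃ g, HasJ (refHarm α β γ n m) x g 0 ∧ ⟪g, x⟫ = refHarm (-3 * α) (-β) 0 n m x ∧
      ‖g‖ ≤ (8 * |α| + |β|) * ‖x‖⁻¹ ^ 2 := by
  have hx0 := ne_zero_of_mem hx
  have h := norm_mul_norm_inv hx0
  have hρ : 0 ≤ ‖x‖⁻¹ := by positivity
  obtain ⟨g, hg, hgx, hgn⟩ := hasJ_quadHarm hn hm hx0
  have hJ := ((hg.const_mul α).add ((HasJ.norm_inv hx0).const_mul β)).add (HasJ.const γ)
  refine ⟨_, hJ.congr_val rfl (by simp), ?_, ?_⟩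
  · have hxx : ⟪x, x⟫ = ‖x‖ ^ 2 := real_inner_self_eq_norm_sq x
    simp only [inner_add_left, inner_smul_left, hxx, hgx, refHarm, conj_trivial, inner_zero_left]
    linear_combination (-β * ‖x‖⁻¹ * (‖x‖ * ‖x‖⁻¹ + 1)) * h
  · rw [add_zero]
    refine (norm_add_le _ _).trans ?_
    rw [norm_smul, norm_smul, norm_smul, norm_neg, Real.norm_of_nonneg (pow_nonneg hρ 3),
      Real.norm_eq_abs, Real.norm_eq_abs, add_mul]
    have h2 : ‖x‖⁻¹ ^ 4 ≤ ‖x‖⁻¹ ^ 2 := pow_le_pow_of_le_one hρ (norm_inv_le_one hx) (by norm_num)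
    have h3 : |α| * ‖g‖ ≤ |α| * (8 * ‖x‖⁻¹ ^ 2) := by gcongr; linarith
    have h4 : ‖x‖⁻¹ ^ 3 * ‖x‖ = ‖x‖⁻¹ ^ 2 := by linear_combination ‖x‖⁻¹ ^ 2 * h
    rw [h4]
    linarith

lemma contDiffAt_refHarm (α β γ : ℝ) {n m x : E3} (hn : ‖n‖ = 1) (hm : ‖m‖ = 1)
    (hx : x ∈ OmegaBar) : ContDiffAt ℝ 2 (refHarm α β γ n m) x :=
  let ⟨_, h, _⟩ := hasJ_refHarm α β γ hn hm hx
  h.1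

lemma contDiffOn_refHarm (α β γ : ℝ) {n m : E3} (hn : ‖n‖ = 1) (hm : ‖m‖ = 1) :
    ContDiffOn ℝ 2 (refHarm α β γ n m) OmegaBar := fun _ hx =>
  (contDiffAt_refHarm α β γ hn hm hx).contDiffWithinAt

lemma lapl_refHarm (α β γ : ℝ) {n m x : E3} (hn : ‖n‖ = 1) (hm : ‖m‖ = 1) (hx : x ∈ OmegaBar) :
    lapl (refHarm α β γ n m) x = 0 :=
  let ⟨_, h, _⟩ := hasJ_refHarm α β γ hn hm hx
  h.2.2

lemma fderiv_refHarm_self (α β γ : ℝ) {n m x : E3} (hn : ‖n‖ = 1) (hm : ‖m‖ = 1)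
    (hx : x ∈ OmegaBar) :
    fderiv ℝ (refHarm α β γ n m) x x = refHarm (-3 * α) (-β) 0 n m x := by
  obtain ⟨g, h, hg, -⟩ := hasJ_refHarm α β γ hn hm hx
  rw [h.fderiv_apply, hg]

lemma rad_refHarm (α β γ : ℝ) {n m x : E3} (hn : ‖n‖ = 1) (hm : ‖m‖ = 1) (hx : x ∈ OmegaBar) :
    rad (refHarm α β γ n m) x = refHarm (-3 * α) (-β) 0 n m x := by
  rw [← fderiv_refHarm_self α β γ hn hm hx, rad, fderivWithin_eq_fderiv
    (uniqueDiffOn_OmegaBar x hx)]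
  exact (contDiffAt_refHarm α β γ hn hm hx).differentiableAt (by simp)

lemma abs_fderiv_refHarm_le (α β γ : ℝ) {n m x : E3} (hn : ‖n‖ = 1) (hm : ‖m‖ = 1)
    (hx : x ∈ OmegaBar) (v : E3) :
    |fderiv ℝ (refHarm α β γ n m) x v| ≤ (8 * |α| + |β|) * ‖x‖⁻¹ ^ 2 * ‖v‖ := by
  obtain ⟨g, h, -, hg⟩ := hasJ_refHarm α β γ hn hm hx
  rw [h.fderiv_apply]
  exact (abs_real_inner_le_norm g v).trans (by gcongr)

/-- The entries of `n₀ ⊗ n₀ - I / 3` for the direction at infinity. -/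
def axisEntry (i j : Fin 3) : ℝ := outer ez ez i j - (1 / 3 : ℝ) * (1 : Mat3) i j

lemma norm_eb (i : Fin 3) : ‖eb i‖ = 1 := by simp [eb]

lemma abs_axisEntry_le (i j : Fin 3) : |axisEntry i j| ≤ 1 := by
  fin_cases i <;> fin_cases j <;> simp [axisEntry, outer, ez] <;> norm_num [abs_le]

lemma Qinf_apply (a b c : ℝ) (i j : Fin 3) : Qinf a b c i j = sstar a b c * axisEntry i j := by
  simp [Qinf, axisEntry]

lemma abs_Qinf_le {a b c : ℝ} (hb : 0 < b) (hc : 0 < c) (i j : Fin 3) :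
    |Qinf a b c i j| ≤ sstar a b c := by
  have hs := sstar_pos (a := a) hb hc
  rw [Qinf_apply, abs_mul, abs_of_pos hs]
  exact mul_le_of_le_one_right hs.le (abs_axisEntry_le i j)

lemma outer_er_sub (x : E3) (i j : Fin 3) :
    (outer (er x) (er x) - (1 / 3 : ℝ) • (1 : Mat3)) i j
      = ⟪eb i, x⟫ * ⟪eb j, x⟫ * ‖x‖⁻¹ ^ 2 - ⟪eb i, eb j⟫ / 3 := by
  simp only [outer, er, Matrix.sub_apply, Matrix.of_apply, Matrix.smul_apply, Matrix.one_apply, eb,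
    EuclideanSpace.inner_single_left]
  by_cases h : i = j
  · subst h; simp; ring
  · simp [h]; ring

lemma Q0_apply (a b c : ℝ) (w : ℝ≥0∞) (x : E3) (i j : Fin 3) :
    Q0 a b c w x i j = refHarm (sstar a b c * coef3 w) (-(sstar a b c * coef1 w * axisEntry i j))
      (Qinf a b c i j) (eb i) (eb j) x := by
  rw [Q0, Matrix.add_apply, Matrix.smul_apply, outer_er_sub, Qinf_apply, refHarm, quadHarm]
  simp [axisEntry]
  ring

lemma coef_bounds {L : ℝ} (hL : 0 < L) {W : ℝ≥0∞} (hW : 0 < W) :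
    let κ := if W = ⊤ then (0 : ℝ) else L / W.toReal
    let w := W / ENNReal.ofReal L
    0 ≤ κ ∧ κ * coef1 w = 1 - coef1 w ∧ 3 * κ * coef3 w = 1 - coef3 w ∧
      |coef1 w| ≤ 1 ∧ |coef3 w| ≤ 1 := by
  intro κ w
  by_cases h : W = ⊤
  · have hw : w = ⊤ := by simp [w, h, ENNReal.top_div]
    simp [κ, h, hw, coef1, coef3]
  · have hw : w ≠ ⊤ := ENNReal.div_ne_top h (by simpa using hL)
    have hp : 0 < W.toReal := ENNReal.toReal_pos hW.ne' h
    have hwr : w.toReal = W.toReal / L := by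
      simp [w, ENNReal.toReal_div, ENNReal.toReal_ofReal hL.le]
    have hwp : 0 < w.toReal := by rw [hwr]; positivity
    have hκ : κ = w.toReal⁻¹ := by simp [κ, h, hwr]
    rw [hκ]
    simp only [coef1, coef3, hw, if_false]
    refine ⟨by positivity, by field_simp; ring, by field_simp; ring, ?_, ?_⟩
    · rw [abs_of_pos (by positivity), div_le_one (by positivity)]; linarith
    · rw [abs_of_pos (by positivity), div_le_one (by positivity)]; linarith

/-! ### The perturbation of the reference field -/

/-- The entries of the reference field with coefficients `c₁`, `c₃`. -/
def refEntry (a b c c₁ c₃ : ℝ) (i j : Fin 3) : E3 → ℝ :=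
  refHarm (sstar a b c * c₃) (-(sstar a b c * c₁ * axisEntry i j)) (Qinf a b c i j) (eb i) (eb j)

/-- The entries of the perturbation of the reference field. -/
def pertEntry (a b c c₁ c₃ : ℝ) (Q : E3 → Mat3) (i j : Fin 3) (x : E3) : ℝ :=
  Q x i j - refEntry a b c c₁ c₃ i j x

/-- A solution together with the coefficients of the matching reference field. -/
structure LdGPert (a b c L κ c₁ c₃ : ℝ) (Q : E3 → Mat3) : Prop extends LdGSol a b c L κ Q where
  kappa_mul_c₁ : κ * c₁ = 1 - c₁
  kappa_mul_c₃ : 3 * κ * c₃ = 1 - c₃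
  abs_c₁_le : |c₁| ≤ 1
  abs_c₃_le : |c₃| ≤ 1

lemma contDiffOn_refEntry (a b c c₁ c₃ : ℝ) (i j : Fin 3) :
    ContDiffOn ℝ 2 (refEntry a b c c₁ c₃ i j) OmegaBar :=
  contDiffOn_refHarm _ _ _ (norm_eb i) (norm_eb j)

lemma lapl_refEntry (a b c c₁ c₃ : ℝ) (i j : Fin 3) {x : E3} (hx : x ∈ OmegaBar) :
    lapl (refEntry a b c c₁ c₃ i j) x = 0 :=
  lapl_refHarm _ _ _ (norm_eb i) (norm_eb j) hx

namespace LdGPert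

variable {a b c L κ c₁ c₃ : ℝ} {Q : E3 → Mat3}

lemma sstar_pos' (h : LdGPert a b c L κ c₁ c₃ Q) : 0 < sstar a b c := sstar_pos h.b_pos h.c_pos

lemma abs_coef_le (h : LdGPert a b c L κ c₁ c₃ Q) (i j : Fin 3) :
    |sstar a b c * c₃| ≤ sstar a b c ∧ |-(sstar a b c * c₁ * axisEntry i j)| ≤ sstar a b c := by
  have hs := h.sstar_pos'
  rw [abs_neg, abs_mul, abs_mul, abs_mul, abs_of_pos hs, mul_assoc]
  exact ⟨mul_le_of_le_one_right hs.le h.abs_c₃_le, mul_le_of_le_one_right hs.le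
    (mul_le_one₀ h.abs_c₁_le (abs_nonneg _) (abs_axisEntry_le i j))⟩

lemma abs_refEntry_sub_le (h : LdGPert a b c L κ c₁ c₃ Q) (i j : Fin 3) {x : E3}
    (hx : x ∈ OmegaBar) :
    |refEntry a b c c₁ c₃ i j x - Qinf a b c i j| ≤ 3 * sstar a b c * ‖x‖⁻¹ := by
  obtain ⟨h1, h2⟩ := h.abs_coef_le i j
  refine (abs_refHarm_sub_le _ _ _ (norm_eb i) (norm_eb j) hx).trans ?_
  gcongr
  linarith

lemma abs_fderiv_refEntry_le (h : LdGPert a b c L κ c₁ c₃ Q) (i j : Fin 3) {x : E3}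
    (hx : x ∈ OmegaBar) (v : E3) :
    |fderiv ℝ (refEntry a b c c₁ c₃ i j) x v| ≤ 9 * sstar a b c * ‖x‖⁻¹ ^ 2 * ‖v‖ := by
  obtain ⟨h1, h2⟩ := h.abs_coef_le i j
  refine (abs_fderiv_refHarm_le _ _ _ (norm_eb i) (norm_eb j) hx v).trans ?_
  gcongr
  linarith

lemma abs_rad_refEntry_le (h : LdGPert a b c L κ c₁ c₃ Q) (i j : Fin 3) {x : E3}
    (hx : x ∈ OmegaBar) :
    |rad (refEntry a b c c₁ c₃ i j) x| ≤ 9 * sstar a b c := by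
  have hs := h.sstar_pos'
  have hd : DifferentiableAt ℝ (refEntry a b c c₁ c₃ i j) x :=
    (contDiffAt_refHarm _ _ _ (norm_eb i) (norm_eb j) hx).differentiableAt (by simp)
  rw [rad, fderivWithin_eq_fderiv (uniqueDiffOn_OmegaBar x hx) hd]
  refine (h.abs_fderiv_refEntry_le i j hx x).trans ?_
  have h1 := norm_mul_norm_inv (ne_zero_of_mem hx)
  have h2 := norm_inv_le_one hx
  have h3 : ‖x‖⁻¹ ^ 2 * ‖x‖ = ‖x‖⁻¹ := by linear_combination ‖x‖⁻¹ * h1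
  rw [mul_assoc, h3]
  exact mul_le_of_le_one_right (by positivity) h2

lemma smooth (h : LdGPert a b c L κ c₁ c₃ Q) (i j : Fin 3) :
    ContDiffOn ℝ 2 (pertEntry a b c c₁ c₃ Q i j) OmegaBar :=
  (h.reg i j).sub (contDiffOn_refEntry a b c c₁ c₃ i j)

lemma lapl_pert (h : LdGPert a b c L κ c₁ c₃ Q) (i j : Fin 3) {x : E3} (hx : x ∈ Omega) :
    L * lapl (pertEntry a b c c₁ c₃ Q i j) x = gradf a b c (Q x) i j := by
  have h1 := (hasJ_of_contDiffAt (contDiffAt_of_mem (h.reg i j) hx)).sub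
    (hasJ_of_contDiffAt (contDiffAt_of_mem (contDiffOn_refEntry a b c c₁ c₃ i j) hx))
  have h2 : lapl (pertEntry a b c c₁ c₃ Q i j) x = _ := h1.2.2
  rw [h2, lapl_refEntry a b c c₁ c₃ i j (Omega_subset hx), sub_zero, h.lapl_entry hx]

lemma rad_pert (h : LdGPert a b c L κ c₁ c₃ Q) (i j : Fin 3) {x : E3} (hx : x ∈ OmegaBar) :
    rad (pertEntry a b c c₁ c₃ Q i j) x
      = rad (fun y => Q y i j) x - rad (refEntry a b c c₁ c₃ i j) x := by
  have h1 := ((h.reg i j).differentiableOn (by simp) x hx)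
  have h2 := ((contDiffOn_refEntry a b c c₁ c₃ i j).differentiableOn (by simp) x hx)
  have := fderivWithin_fun_sub (uniqueDiffOn_OmegaBar x hx) h1 h2
  rw [rad, rad, rad, ← sub_apply, ← this]
  rfl

lemma robin (h : LdGPert a b c L κ c₁ c₃ Q) (i j : Fin 3) {x : E3} (hx : ‖x‖ = 1) :
    κ * rad (pertEntry a b c c₁ c₃ Q i j) x = pertEntry a b c c₁ c₃ Q i j x := by
  have hx' : x ∈ OmegaBar := mem_OmegaBar.2 hx.ge
  have h1 := h.rad_entry hx i j
  have h2 := rad_refHarm (sstar a b c * c₃) (-(sstar a b c * c₁ * axisEntry i j)) (Qinf a b c i j)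
    (norm_eb i) (norm_eb j) hx'
  have h3 : Qsurf a b c x i j
      = sstar a b c * (⟪eb i, x⟫ * ⟪eb j, x⟫ * ‖x‖⁻¹ ^ 2 - ⟪eb i, eb j⟫ / 3) := by
    rw [← outer_er_sub]; rfl
  rw [h.rad_pert i j hx', mul_sub, h1, pertEntry, refEntry, h2, h3]
  simp only [refHarm, quadHarm, hx, inv_one, one_pow, mul_one, Qinf_apply]
  linear_combination (sstar a b c * axisEntry i j) * (-h.kappa_mul_c₁)
    + sstar a b c * (⟪eb i, x⟫ * ⟪eb j, x⟫ - ⟪eb i, eb j⟫ / 3) * h.kappa_mul_c₃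

lemma abs_Q_sub_Qinf_le (h : LdGPert a b c L κ c₁ c₃ Q) (i j : Fin 3) {x : E3}
    (hx : x ∈ OmegaBar) :
    |Q x i j - Qinf a b c i j|
      ≤ |pertEntry a b c c₁ c₃ Q i j x| + 3 * sstar a b c * ‖x‖⁻¹ := by
  have h1 := h.abs_refEntry_sub_le i j hx
  have h2 : Q x i j - Qinf a b c i j = pertEntry a b c c₁ c₃ Q i j x
      + (refEntry a b c c₁ c₃ i j x - Qinf a b c i j) := by rw [pertEntry]; ring
  rw [h2]
  exact (abs_add_le _ _).trans (by linarith)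

lemma abs_pert_le (h : LdGPert a b c L κ c₁ c₃ Q) {B : ℝ}
    (hB : ∀ x ∈ OmegaBar, ∀ i j, |Q x i j| ≤ B) (i j : Fin 3) {x : E3} (hx : x ∈ OmegaBar) :
    |pertEntry a b c c₁ c₃ Q i j x| ≤ B + 4 * sstar a b c := by
  have hs := h.sstar_pos'
  have h1 := h.abs_refEntry_sub_le i j hx
  have h2 := abs_Qinf_le (a := a) h.b_pos h.c_pos i j
  have h3 := hB x hx i j
  have h4 : 3 * sstar a b c * ‖x‖⁻¹ ≤ 3 * sstar a b c :=
    mul_le_of_le_one_right (by positivity) (norm_inv_le_one hx)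
  rw [pertEntry]
  rw [abs_le] at *
  constructor <;> linarith [h1.1, h1.2, h2.1, h2.2, h3.1, h3.2]

lemma lapl_eq_div (h : LdGPert a b c L κ c₁ c₃ Q) (i j : Fin 3) {x : E3} (hx : x ∈ Omega) :
    lapl (pertEntry a b c c₁ c₃ Q i j) x = gradf a b c (Q x) i j / L := by
  rw [← h.lapl_pert i j hx, mul_div_cancel_left₀ _ h.L_pos.ne']

/-- The gradient bound at a length scale `H` at which the nonlinearity is perturbative. -/
lemma grad_le (h : LdGPert a b c L κ c₁ c₃ Q) {B Cf H m N : ℝ} (hCf : 0 ≤ Cf)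
    (hB : ∀ x ∈ OmegaBar, ∀ i j, |Q x i j| ≤ B)
    (hLip : ∀ P Q : Mat3, (∀ i j, |P i j| ≤ B) → (∀ i j, |Q i j| ≤ B) → ∀ d,
      (∀ i j, |P i j - Q i j| ≤ d) → ∀ i j, |gradf a b c P i j - gradf a b c Q i j| ≤ Cf * d)
    (hH : 0 < H) (hH1 : H ≤ 1 / 10) (hHP : H ^ 2 * (Cf / L) ≤ 1 / 2) (hN : 0 < N)
    (hm : ∀ x ∈ OmegaBar, ∀ i j, |pertEntry a b c c₁ c₃ Q i j x| ≤ m)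
    (hf : ∀ x ∈ Omega, ∀ i j, |gradf a b c (Q x) i j / L| ≤ N) (i j : Fin 3) {x n : E3}
    (hx : x ∈ Omega) (hn : ‖n‖ = 1) :
    |fderiv ℝ (pertEntry a b c c₁ c₃ Q i j) x n|
      ≤ 60 * (m / H + N * H) + 18 * sstar a b c * (H ^ 2 * (Cf / L)) := by
  have hL := h.L_pos
  have hs := h.sstar_pos'
  have hm0 : 0 ≤ m := (abs_nonneg _).trans (hm x (Omega_subset hx) 0 0)
  rcases lt_or_ge ‖x‖ (1 + H) with hxH | hxH
  · have hann : ∀ p : Fin 3 × Fin 3,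
        RobinAnnulus (pertEntry a b c c₁ c₃ Q p.1 p.2) κ H m N := fun p =>
      { smooth := h.smooth p.1 p.2
        kappa_nonneg := h.kappa_nonneg
        robin := fun x hx => h.robin p.1 p.2 hx
        H_pos := hH
        H_le := hH1
        N_pos := hN
        bound := fun x hx _ => hm x hx p.1 p.2
        lapl_bound := fun x hx _ => by rw [h.lapl_eq_div p.1 p.2 hx]; exact hf x hx p.1 p.2 }
    have := system_grad_annulus hann (P := Cf / L) (C₀ := 9 * sstar a b c) (by positivity) hHP
      (by positivity) ?_ (i, j) hx hxH hn
    · linarith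
    · intro M hM p l hl y hy hly
      have hyb : y ∈ OmegaBar := Omega_subset hy
      have hlyΩ : l • y ∈ Omega := smul_mem_Omega hyb hl
      rw [h.lapl_eq_div p.1 p.2 hlyΩ, h.lapl_eq_div p.1 p.2 hy]
      have hdil : ∀ i j, |Q (l • y) i j - Q y i j| ≤ (l - 1) * (M + 9 * sstar a b c) := by
        intro i j
        refine abs_dilation_sub_le (h.reg i j) hyb hl fun s hs => ?_
        have hsy := smul_mem_Omega hyb hs.1
        have h1 := hM (i, j) (s • y) hsy (by
          have : ‖s • y‖ = s * ‖y‖ := by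
            rw [norm_smul, Real.norm_of_nonneg (by linarith [hs.1])]
          rw [this]
          exact (mul_lt_mul_of_pos_right hs.2 (by linarith)).trans hly)
        have h2 := h.abs_rad_refEntry_le i j (Omega_subset hsy)
        have h3 := h.rad_pert i j (Omega_subset hsy)
        have h4 : rad (fun y => Q y i j) (s • y) = rad (pertEntry a b c c₁ c₃ Q i j) (s • y)
          + rad (refEntry a b c c₁ c₃ i j) (s • y) := by linarith
        rw [h4]
        exact (abs_add_le _ _).trans (add_le_add h1 h2)
      have h1 := hLip _ _ (hB _ (Omega_subset hlyΩ)) (hB _ hyb) _ hdil p.1 p.2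
      have h2 := hf _ hlyΩ p.1 p.2
      have hl2 : l ≤ 2 := by nlinarith
      have e : l ^ 2 * (gradf a b c (Q (l • y)) p.1 p.2 / L) - gradf a b c (Q y) p.1 p.2 / L
          = (l - 1) * (l + 1) * (gradf a b c (Q (l • y)) p.1 p.2 / L)
            + (gradf a b c (Q (l • y)) p.1 p.2 - gradf a b c (Q y) p.1 p.2) / L := by ring
      rw [e]
      refine (abs_add_le _ _).trans ?_
      have e1 : |(l - 1) * (l + 1) * (gradf a b c (Q (l • y)) p.1 p.2 / L)| ≤ (l - 1) * 3 * N := by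
        rw [abs_mul, abs_of_nonneg (by nlinarith : 0 ≤ (l - 1) * (l + 1))]
        have : 0 ≤ l - 1 := by linarith
        gcongr
        linarith
      have e2 : |(gradf a b c (Q (l • y)) p.1 p.2 - gradf a b c (Q y) p.1 p.2) / L|
          ≤ (l - 1) * (Cf / L * (M + 9 * sstar a b c)) := by
        rw [abs_div, abs_of_pos hL, div_le_iff₀ hL]
        refine h1.trans_eq ?_
        field_simp
      linarith
  · have hball : ∀ y : E3, ‖y - x‖ ≤ H / 2 → y ∈ Omega := by
      intro y hy
      have := norm_sub_norm_le x y
      rw [norm_sub_rev] at this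
      exact mem_Omega.2 (by linarith)
    have := interior_grad (u := pertEntry a b c c₁ c₃ Q i j) (x₁ := x) (half_pos hH) hN
      (fun y hy => contDiffAt_of_mem (h.smooth i j) (hball y hy))
      (fun y hy => hm y (Omega_subset (hball y hy)) i j)
      (fun y hy => by rw [h.lapl_eq_div i j (hball y hy)]; exact hf y (hball y hy) i j) hn
    refine this.trans ?_
    have e1 : 3 * m / (H / 2) = 6 * (m / H) := by field_simp; ring
    have e2 : 0 ≤ m / H := by positivity
    have e3 : 0 ≤ N * H := by positivity
    have e4 : 0 ≤ 18 * sstar a b c * (H ^ 2 * (Cf / L)) := by positivity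
    rw [e1]
    linarith

end LdGPert

/-! ### Integration by parts against cutoffs -/

/-- `φ` is a `C¹` function with compact support in `Omega`. -/
structure TestFn (φ : E3 → ℝ) : Prop where
  contDiff : ContDiff ℝ 1 φ
  hasCompactSupport : HasCompactSupport φ
  tsupport_subset : tsupport φ ⊆ Omega

lemma integrable_mul_of_tsupport_subset {φ g : E3 → ℝ} (hφ : Continuous φ)
    (hc : HasCompactSupport φ) (hs : tsupport φ ⊆ Omega) (hg : ContinuousOn g Omega) :
    Integrable (fun x => φ x * g x) := by
  refine Continuous.integrable_of_hasCompactSupport ?_ hc.mul_right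
  refine continuous_of_tsupport fun x hx => ?_
  have hx' : x ∈ Omega := hs (tsupport_mul_subset_left hx)
  exact hφ.continuousAt.mul (hg.continuousAt (Omega_mem_nhds hx'))

namespace TestFn

variable {φ : E3 → ℝ}

lemma integrable_mul (hφ : TestFn φ) {g : E3 → ℝ} (hg : ContinuousOn g Omega) :
    Integrable (fun x => φ x * g x) :=
  integrable_mul_of_tsupport_subset hφ.contDiff.continuous hφ.hasCompactSupport
    hφ.tsupport_subset hg

lemma integrable_fderiv_mul (hφ : TestFn φ) (v : E3) {g : E3 → ℝ} (hg : ContinuousOn g Omega) :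
    Integrable (fun x => fderiv ℝ φ x v * g x) := by
  have hsub : tsupport (fun x => fderiv ℝ φ x v) ⊆ tsupport φ :=
    tsupport_fderiv_apply_subset ℝ v
  exact integrable_mul_of_tsupport_subset
    ((hφ.contDiff.continuous_fderiv (by simp)).clm_apply continuous_const)
    (hφ.hasCompactSupport.of_isClosed_subset (isClosed_tsupport _) hsub)
    (hsub.trans hφ.tsupport_subset) hg

lemma integral_mul_fderiv (hφ : TestFn φ) (v : E3) {g : E3 → ℝ} (hg : ContDiffOn ℝ 1 g Omega) :
    ∫ x, φ x * fderiv ℝ g x v = - ∫ x, fderiv ℝ φ x v * g x := by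
  refine integral_mul_fderiv_eq_neg_fderiv_mul_of_integrable
    (hφ.integrable_fderiv_mul v hg.continuousOn) (hφ.integrable_mul ?_)
    (hφ.integrable_mul hg.continuousOn)
    (fun x _ => hφ.contDiff.differentiable (by simp) x)
    fun x hx => (hg.differentiableOn (by simp)).differentiableAt
      (Omega_mem_nhds (hφ.tsupport_subset hx))
  exact (hg.continuousOn_fderiv_of_isOpen isOpen_Omega le_rfl).clm_apply continuousOn_const

lemma eq_zero (hφ : TestFn φ) {x : E3} (hx : x ∉ Omega) : φ x = 0 :=
  image_eq_zero_of_notMem_tsupport fun h => hx (hφ.tsupport_subset h)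

lemma fderiv_eq_zero (hφ : TestFn φ) {x : E3} (hx : x ∉ Omega) : fderiv ℝ φ x = 0 :=
  image_eq_zero_of_notMem_tsupport fun h => hx (hφ.tsupport_subset (tsupport_fderiv_subset ℝ h))

/-- The divergence theorem tested against `φ`. -/
lemma setIntegral_mul_div (hφ : TestFn φ) {V : Fin 3 → E3 → ℝ}
    (hV : ∀ k, ContDiffOn ℝ 1 (V k) Omega) :
    ∫ x in Omega, φ x * ∑ k, fderiv ℝ (V k) x (eb k)
      = - ∫ x in Omega, ∑ k, fderiv ℝ φ x (eb k) * V k x := by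
  rw [setIntegral_eq_integral_of_forall_compl_eq_zero fun x hx => by rw [hφ.eq_zero hx, zero_mul],
    setIntegral_eq_integral_of_forall_compl_eq_zero fun x hx => by simp [hφ.fderiv_eq_zero hx]]
  simp_rw [Finset.mul_sum]
  rw [integral_finsetSum, integral_finsetSum, ← Finset.sum_neg_distrib]
  · exact Finset.sum_congr rfl fun k _ => hφ.integral_mul_fderiv (eb k) (hV k)
  · exact fun k _ => hφ.integrable_fderiv_mul (eb k) (hV k).continuousOn
  · exact fun k _ => hφ.integrable_mul
      (((hV k).continuousOn_fderiv_of_isOpen isOpen_Omega le_rfl).clm_apply continuousOn_const)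

end TestFn

/-! ### Slowly decaying cutoffs -/

lemma hasDerivAt_posPart_sq (t : ℝ) : HasDerivAt (fun t : ℝ => (max t 0) ^ 2) (2 * max t 0) t := by
  rcases lt_trichotomy t 0 with ht | rfl | ht
  · refine ((hasDerivAt_const t (0 : ℝ)).congr_of_eventuallyEq ?_).congr_deriv
      (by rw [max_eq_right ht.le, mul_zero])
    filter_upwards [Iio_mem_nhds ht] with s hs
    rw [max_eq_right (le_of_lt hs)]; norm_num
  · rw [hasDerivAt_iff_isLittleO]
    simp only [max_self, sub_zero, mul_zero, smul_zero, ne_eq, OfNat.ofNat_ne_zero,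
      not_false_eq_true, zero_pow]
    refine (Asymptotics.isBigO_of_le _ fun s => ?_).trans_isLittleO
      (Asymptotics.isLittleO_pow_id one_lt_two)
    rw [norm_pow, norm_pow]
    gcongr
    rw [Real.norm_eq_abs, Real.norm_eq_abs, abs_of_nonneg (le_max_right _ _)]
    exact max_le (le_abs_self s) (abs_nonneg s)
  · refine (((hasDerivAt_id t).fun_pow 2).congr_of_eventuallyEq ?_).congr_deriv
      (by rw [max_eq_left ht.le]; simp)
    filter_upwards [Ioi_mem_nhds ht] with s hs
    rw [max_eq_left (le_of_lt hs)]; rfl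

lemma contDiff_posPart_sq : ContDiff ℝ 1 fun t : ℝ => (max t 0) ^ 2 := by
  rw [contDiff_one_iff_deriv]
  refine ⟨fun t => (hasDerivAt_posPart_sq t).differentiableAt, ?_⟩
  rw [funext fun t => (hasDerivAt_posPart_sq t).deriv]
  fun_prop

/-- A compactly supported approximation of `(1 + δ ‖x‖²)⁻¹`. -/
def decayCut (δ τ : ℝ) (x : E3) : ℝ := (max (1 - τ * (1 + δ * ‖x‖ ^ 2)) 0) ^ 2 / (1 + δ * ‖x‖ ^ 2)

/-- The radial slope of `decayCut`, divided by `-‖x‖`. -/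
def decaySlope (δ τ : ℝ) (x : E3) : ℝ :=
  2 * δ * (max (1 - τ * (1 + δ * ‖x‖ ^ 2)) 0)
    * (2 * τ * (1 + δ * ‖x‖ ^ 2) + max (1 - τ * (1 + δ * ‖x‖ ^ 2)) 0) / (1 + δ * ‖x‖ ^ 2) ^ 2

lemma contDiff_decayCut {δ : ℝ} (τ : ℝ) (hδ : 0 < δ) : ContDiff ℝ 1 (decayCut δ τ) := by
  have h : ContDiff ℝ 1 fun x : E3 => 1 + δ * ‖x‖ ^ 2 :=
    contDiff_const.add (contDiff_const.mul (contDiff_norm_sq ℝ))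
  refine ContDiff.div (contDiff_posPart_sq.comp (contDiff_const.sub (contDiff_const.mul h))) h
    fun x => ?_
  positivity

lemma fderiv_decayCut {δ : ℝ} (τ : ℝ) (hδ : 0 < δ) (x v : E3) :
    fderiv ℝ (decayCut δ τ) x v = -(decaySlope δ τ x * ⟪x, v⟫) := by
  set m := 1 + δ * ‖x‖ ^ 2 with hm
  have hm0 : m ≠ 0 := by positivity
  have h1 : HasDerivAt (fun s => 1 - τ * s) (-τ) m := by
    simpa using ((hasDerivAt_id m).const_mul τ).const_sub 1
  have h2 : HasDerivAt (fun s => (max (1 - τ * s) 0) ^ 2) (2 * max (1 - τ * m) 0 * -τ) m :=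
    HasDerivAt.comp (h := fun s => 1 - τ * s) (h₂ := fun t => (max t 0) ^ 2) m
      (hasDerivAt_posPart_sq (1 - τ * m)) h1
  replace h2 := h2.fun_div (hasDerivAt_id' m) hm0
  have h3 : HasFDerivAt (fun y : E3 => 1 + δ * ‖y‖ ^ 2) (innerSL ℝ (δ • (2 : ℝ) • x)) x :=
    ((HasJ.normSq x).const_mul δ).2.1.const_add 1
  have h4 := h2.comp_hasFDerivAt x h3
  have h5 : fderiv ℝ (decayCut δ τ) x = _ := h4.fderiv
  rw [h5, decaySlope, ← hm]
  simp only [smul_apply, innerSL_apply_apply, inner_smul_left, smul_eq_mul,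
    conj_trivial]
  field_simp
  ring

lemma decay_numeric {z m τ : ℝ} (hm : 1 ≤ m) (hτ : 0 ≤ τ) (hz : z = max (1 - τ * m) 0) :
    0 ≤ z ∧ z ≤ 1 ∧ z * (2 * τ * m + z) ≤ 1 ∧ τ * m * z ≤ 1 := by
  have h0 : 0 ≤ τ * m := by positivity
  rcases le_total (1 - τ * m) 0 with h | h
  · rw [max_eq_right h] at hz; subst hz; norm_num
  · rw [max_eq_left h] at hz
    refine ⟨by linarith, by linarith, ?_, ?_⟩ <;> rw [hz] <;> nlinarith

lemma decayCut_nonneg {δ : ℝ} (τ : ℝ) (hδ : 0 < δ) (x : E3) : 0 ≤ decayCut δ τ x := by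
  unfold decayCut; positivity

lemma decayCut_le_one {δ τ : ℝ} (hδ : 0 < δ) (hτ : 0 ≤ τ) (x : E3) : decayCut δ τ x ≤ 1 := by
  have hm : 1 ≤ 1 + δ * ‖x‖ ^ 2 := le_add_of_nonneg_right (by positivity)
  obtain ⟨h0, h1, -⟩ := decay_numeric hm hτ rfl
  exact div_le_one_of_le₀ ((pow_le_one₀ h0 h1).trans hm) (by positivity)

lemma le_decayCut {δ : ℝ} (τ : ℝ) (hδ : 0 < δ) (x : E3) :
    1 - δ * ‖x‖ ^ 2 - 2 * τ ≤ decayCut δ τ x := by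
  have hm : 1 ≤ 1 + δ * ‖x‖ ^ 2 := le_add_of_nonneg_right (by positivity)
  rw [decayCut, le_div_iff₀ (by positivity)]
  set m := 1 + δ * ‖x‖ ^ 2
  have h1 : δ * ‖x‖ ^ 2 = m - 1 := by simp [m]
  rw [h1]
  have h2 := le_max_left (1 - τ * m) 0
  have h3 := le_max_right (1 - τ * m) 0
  set z := max (1 - τ * m) 0
  nlinarith [sq_nonneg (z - 1), sq_nonneg (m - 1)]

lemma decaySlope_nonneg {δ τ : ℝ} (hδ : 0 < δ) (hτ : 0 ≤ τ) (x : E3) : 0 ≤ decaySlope δ τ x := by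
  unfold decaySlope; positivity

lemma decaySlope_le {δ τ : ℝ} (hδ : 0 < δ) (hτ : 0 ≤ τ) (x : E3) :
    decaySlope δ τ x ≤ 2 * δ / (1 + δ * ‖x‖ ^ 2) ^ 2 := by
  have hm : 1 ≤ 1 + δ * ‖x‖ ^ 2 := le_add_of_nonneg_right (by positivity)
  obtain ⟨-, -, h, -⟩ := decay_numeric hm hτ rfl
  rw [decaySlope, mul_assoc (2 * δ)]
  exact div_le_div_of_nonneg_right (mul_le_of_le_one_right (by positivity) h) (by positivity)

lemma decaySlope_le_two_mul {δ τ : ℝ} (hδ : 0 < δ) (hτ : 0 ≤ τ) (x : E3) :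
    decaySlope δ τ x ≤ 2 * δ :=
  (decaySlope_le hδ hτ x).trans (div_le_self (by positivity)
    (one_le_pow₀ (le_add_of_nonneg_right (by positivity))))

lemma normSq_mul_decaySlope_le {δ τ : ℝ} (hδ : 0 < δ) (hτ : 0 ≤ τ) (x : E3) :
    ‖x‖ ^ 2 * decaySlope δ τ x ≤ 1 / 2 := by
  refine (mul_le_mul_of_nonneg_left (decaySlope_le hδ hτ x) (by positivity)).trans ?_
  rw [← mul_div_assoc, div_le_iff₀ (by positivity)]
  nlinarith [sq_nonneg (1 - δ * ‖x‖ ^ 2)]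

lemma normSq_mul_decaySlope_le_decayCut {δ τ : ℝ} (hδ : 0 < δ) (hτ : 0 ≤ τ) (x : E3) :
    ‖x‖ ^ 2 * decaySlope δ τ x
      ≤ 2 * decayCut δ τ x + 4 * τ * max (1 - τ * (1 + δ * ‖x‖ ^ 2)) 0 := by
  have hm : 1 ≤ 1 + δ * ‖x‖ ^ 2 := le_add_of_nonneg_right (by positivity)
  have hz := le_max_right (1 - τ * (1 + δ * ‖x‖ ^ 2)) 0
  rw [decaySlope, decayCut]
  set m := 1 + δ * ‖x‖ ^ 2
  set z := max (1 - τ * m) 0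
  have h1 : ‖x‖ ^ 2 * (2 * δ * z * (2 * τ * m + z) / m ^ 2)
      = 2 * (m - 1) * (z * (2 * τ * m + z)) / m ^ 2 := by simp only [m]; ring
  have h2 : 2 * (z ^ 2 / m) + 4 * τ * z = 2 * m * (z * (2 * τ * m + z)) / m ^ 2 := by
    field_simp
    ring
  rw [h1, h2]
  gcongr
  linarith

lemma decay_error_le {δ τ : ℝ} (hδ : 0 < δ) (hτ : 0 ≤ τ) (x : E3) :
    4 * τ * max (1 - τ * (1 + δ * ‖x‖ ^ 2)) 0 * ‖x‖ ^ 2 ≤ 4 / δ := by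
  have hm : 1 ≤ 1 + δ * ‖x‖ ^ 2 := le_add_of_nonneg_right (by positivity)
  obtain ⟨h0, -, -, h⟩ := decay_numeric hm hτ rfl
  rw [le_div_iff₀ hδ]
  set z := max (1 - τ * (1 + δ * ‖x‖ ^ 2)) 0
  have : 0 ≤ τ * z := by positivity
  linarith

/-- For an integrable weight the error term in the slope estimate can be made small. -/
lemma exists_decay_error_le {w : E3 → ℝ} (hw : IntegrableOn w Omega) {δ : ℝ} (hδ : 0 < δ) :
    ∃ τ, 0 < τ ∧ τ ≤ δ ∧
      ∫ x in Omega, 4 * τ * max (1 - τ * (1 + δ * ‖x‖ ^ 2)) 0 * ‖x‖ ^ 2 * w x ≤ δ := by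
  set τ : ℕ → ℝ := fun n => δ * (1 / ((n : ℝ) + 1)) with hτ
  have hτ0 : ∀ n, 0 < τ n := fun n => by simp only [hτ]; positivity
  have hτ1 : Tendsto τ atTop (𝓝 0) := by
    simpa [hτ] using tendsto_one_div_add_atTop_nhds_zero_nat.const_mul δ
  have h := tendsto_integral_of_dominated_convergence (μ := volume.restrict Omega)
    (F := fun n x => 4 * τ n * max (1 - τ n * (1 + δ * ‖x‖ ^ 2)) 0 * ‖x‖ ^ 2 * w x)
    (f := fun _ => 0) (fun x => 4 / δ * ‖w x‖)
    (fun n => (Continuous.aestronglyMeasurable (by fun_prop)).mul hw.1)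
    (hw.norm.const_mul _) (fun n => Eventually.of_forall fun x => ?_)
    (Eventually.of_forall fun x => ?_)
  · rw [integral_zero] at h
    obtain ⟨n, hn1, hn2⟩ := ((h.eventually_le_const hδ).and (hτ1.eventually_le_const hδ)).exists
    exact ⟨τ n, hτ0 n, hn2, hn1⟩
  · have h0 := hτ0 n
    rw [norm_mul, Real.norm_of_nonneg (by positivity)]
    gcongr
    exact decay_error_le hδ h0.le x
  · have : Continuous fun t : ℝ => 4 * t * max (1 - t * (1 + δ * ‖x‖ ^ 2)) 0 * ‖x‖ ^ 2 * w x := by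
      fun_prop
    simpa [Function.comp_def] using (this.tendsto 0).comp hτ1

lemma exists_nearCut : ∃ (χ : E3 → ℝ) (K : ℝ), ContDiff ℝ 1 χ ∧ 0 ≤ K ∧
    (∀ x, 0 ≤ χ x) ∧ (∀ x, χ x ≤ 1) ∧ (∀ x, ‖x‖ ≤ 5 / 4 → χ x = 0) ∧
    (∀ x, 2 ≤ ‖x‖ → χ x = 1 ∧ fderiv ℝ χ x = 0) ∧ ∀ x, ‖fderiv ℝ χ x‖ ≤ K := by
  let β : ContDiffBump (0 : E3) := ⟨5 / 4, 7 / 4, by norm_num, by norm_num⟩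
  have hβ : ContDiff ℝ 1 β := β.contDiff
  obtain ⟨K, hK⟩ := (β.hasCompactSupport.fderiv ℝ).exists_bound_of_continuous
    (hβ.continuous_fderiv (by simp))
  refine ⟨fun x => 1 - β x, K, contDiff_const.sub hβ, (norm_nonneg _).trans (hK 0),
    fun x => sub_nonneg.2 β.le_one, fun x => sub_le_self _ β.nonneg, fun x hx => ?_, fun x hx => ?_,
    fun x => ?_⟩
  · exact sub_eq_zero.2 (β.one_of_mem_closedBall (by simpa using hx)).symm
  · have h1 : ∀ y : E3, 7 / 4 ≤ ‖y‖ → 1 - β y = 1 := fun y hy => by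
      rw [β.zero_of_le_dist (by simpa using hy), sub_zero]
    refine ⟨h1 x (by linarith), ?_⟩
    have h2 : (fun y => 1 - β y) =ᶠ[𝓝 x] fun _ => 1 := by
      filter_upwards [(isOpen_lt continuous_const continuous_norm).mem_nhds
        (show 7 / 4 < ‖x‖ by linarith)] with y hy
      exact h1 y (le_of_lt hy)
    rw [h2.fderiv_eq]
    simp
  · rw [fderiv_const_sub, norm_neg]
    exact hK x

/-- A test function equal to one on a large region, with controlled slope. -/
structure FarCutoff (K δ : ℝ) (w : E3 → ℝ) (φ p e : E3 → ℝ) : Prop extends TestFn φ where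
  nonneg : ∀ x, 0 ≤ φ x
  le_one : ∀ x, φ x ≤ 1
  le_self : ∀ x, 2 ≤ ‖x‖ → 1 - δ * ‖x‖ ^ 2 - 2 * δ ≤ φ x
  continuous_slope : Continuous p
  slope_nonneg : ∀ x, 0 ≤ p x
  slope_le : ∀ x, p x ≤ 2 * δ
  normSq_mul_slope_le : ∀ x, ‖x‖ ^ 2 * p x ≤ 1 / 2
  normSq_mul_slope_le_self : ∀ x, ‖x‖ ^ 2 * p x ≤ 2 * φ x + e x
  continuous_error : Continuous e
  error_nonneg : ∀ x, 0 ≤ e x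
  integral_error_le : ∫ x in Omega, e x * ‖x‖ ^ 2 * w x ≤ δ
  error_mul_le : ∃ D, ∀ x, e x * ‖x‖ ^ 2 ≤ D
  abs_fderiv_add_le : ∀ x v, |fderiv ℝ φ x v + p x * ⟪x, v⟫| ≤ K * ‖v‖
  fderiv_eq : ∀ x v, 2 ≤ ‖x‖ → fderiv ℝ φ x v = -(p x * ⟪x, v⟫)

lemma exists_farCutoff : ∃ K, 0 ≤ K ∧ ∀ w : E3 → ℝ, IntegrableOn w Omega → ∀ δ, 0 < δ →
    ∃ φ p e, FarCutoff K δ w φ p e := by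
  obtain ⟨χ, K, hχ, hK, h0, h1, hnear, hfar, hχK⟩ := exists_nearCut
  refine ⟨K, hK, fun w hw δ hδ => ?_⟩
  obtain ⟨τ, hτ0, hτδ, hint⟩ := exists_decay_error_le hw hδ
  have hτ := hτ0.le
  have hderiv : ∀ x v : E3, fderiv ℝ (fun y => χ y * decayCut δ τ y) x v
      = decayCut δ τ x * fderiv ℝ χ x v - χ x * decaySlope δ τ x * ⟪x, v⟫ := by
    intro x v
    rw [fderiv_fun_mul (hχ.differentiable (by simp) x)
      ((contDiff_decayCut τ hδ).differentiable (by simp) x), add_apply, smul_apply, smul_apply,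
      fderiv_decayCut τ hδ, smul_eq_mul, smul_eq_mul]
    ring
  have hG0 := decayCut_nonneg τ hδ
  have hG1 := decayCut_le_one hδ hτ
  have hP0 := decaySlope_nonneg hδ hτ
  refine ⟨fun x => χ x * decayCut δ τ x, fun x => χ x * decaySlope δ τ x,
    fun x => 4 * τ * max (1 - τ * (1 + δ * ‖x‖ ^ 2)) 0,
    { contDiff := hχ.mul (contDiff_decayCut τ hδ)
      hasCompactSupport := ?_
      tsupport_subset := ?_
      nonneg := fun x => mul_nonneg (h0 x) (hG0 x)
      le_one := fun x => mul_le_one₀ (h1 x) (hG0 x) (hG1 x)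
      le_self := fun x hx => ?_
      continuous_slope := ?_
      slope_nonneg := fun x => mul_nonneg (h0 x) (hP0 x)
      slope_le := fun x =>
        (mul_le_of_le_one_left (hP0 x) (h1 x)).trans (decaySlope_le_two_mul hδ hτ x)
      normSq_mul_slope_le := fun x => ?_
      normSq_mul_slope_le_self := fun x => ?_
      continuous_error := by fun_prop
      error_nonneg := fun x => by positivity
      integral_error_le := hint
      error_mul_le := ⟨4 / δ, decay_error_le hδ hτ⟩
      abs_fderiv_add_le := fun x v => ?_
      fderiv_eq := fun x v hx => ?_ }⟩
  · refine HasCompactSupport.mul_left ?_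
    refine HasCompactSupport.intro (isCompact_closedBall 0 (√(1 / (τ * δ)))) fun x hx => ?_
    have h2 : √(1 / (τ * δ)) < ‖x‖ := by simpa using hx
    have h3 : 1 / (τ * δ) < ‖x‖ ^ 2 := (Real.sqrt_lt' ((Real.sqrt_nonneg _).trans_lt h2)).1 h2
    rw [div_lt_iff₀ (by positivity)] at h3
    rw [decayCut, max_eq_right (by nlinarith)]
    simp
  · have h2 : tsupport (fun x => χ x * decayCut δ τ x) ⊆ {x | 5 / 4 ≤ ‖x‖} := by
      refine closure_minimal (fun x hx => ?_) (isClosed_le continuous_const continuous_norm)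
      by_contra h
      exact hx (mul_eq_zero_of_left (hnear x (le_of_lt (not_le.1 h))) _)
    exact fun x hx => mem_Omega.2 (lt_of_lt_of_le (by norm_num) (h2 hx : 5 / 4 ≤ ‖x‖))
  · rw [(hfar x hx).1, one_mul]
    have := le_decayCut τ hδ x
    linarith
  · have : Continuous (decaySlope δ τ) := by
      refine Continuous.div₀ (by fun_prop) (by fun_prop) fun x => ?_
      positivity
    exact hχ.continuous.mul this
  · have h2 := normSq_mul_decaySlope_le hδ hτ x
    rw [mul_left_comm]
    exact (mul_le_of_le_one_left (mul_nonneg (by positivity) (hP0 x)) (h1 x)).trans h2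
  · have h2 := normSq_mul_decaySlope_le_decayCut hδ hτ x
    have h3 : 0 ≤ 4 * τ * max (1 - τ * (1 + δ * ‖x‖ ^ 2)) 0 := by positivity
    have h4 := mul_le_mul_of_nonneg_left h2 (h0 x)
    have h5 := mul_le_of_le_one_left h3 (h1 x)
    linarith
  · rw [hderiv]
    have h2 : |decayCut δ τ x * fderiv ℝ χ x v| ≤ 1 * (K * ‖v‖) := by
      rw [abs_mul, abs_of_nonneg (hG0 x)]
      refine mul_le_mul (hG1 x) ?_ (abs_nonneg _) zero_le_one
      exact (fderiv ℝ χ x).le_of_opNorm_le (hχK x) v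
    simpa using h2
  · rw [hderiv, (hfar x hx).2]
    simp

/-! ### The Pohozaev identity -/

/-- The squared norm of the gradient. -/
def gradNormSq (u : E3 → ℝ) (x : E3) : ℝ := ∑ k, (fderiv ℝ u x (eb k)) ^ 2

lemma gradNormSq_nonneg (u : E3 → ℝ) (x : E3) : 0 ≤ gradNormSq u x :=
  Finset.sum_nonneg fun _ _ => sq_nonneg _

/-- The scalar Pohozaev field of `u` with the dilation correction `h`. -/
def pohoVec (u h : E3 → ℝ) (k : Fin 3) (x : E3) : ℝ :=
  fderiv ℝ u x (eb k) * (fderiv ℝ u x x + h x) - ⟪eb k, x⟫ * (gradNormSq u x / 2)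
    - u x * fderiv ℝ h x (eb k)

lemma sum_inner_eb_mul (ℓ : E3 →L[ℝ] ℝ) (x : E3) : ∑ k, ⟪eb k, x⟫ * ℓ (eb k) = ℓ x := by
  have h : x = ∑ k, ⟪eb k, x⟫ • eb k := by
    ext i
    simp [eb, EuclideanSpace.inner_single_left, Pi.single_apply]
  conv_rhs => rw [h]
  simp

lemma contDiffOn_fderiv {u : E3 → ℝ} (hu : ContDiffOn ℝ 2 u OmegaBar) :
    ContDiffOn ℝ 1 (fderiv ℝ u) Omega :=
  (hu.mono Omega_subset).fderiv_of_isOpen isOpen_Omega (by norm_num)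

lemma contDiffOn_gradNormSq {u : E3 → ℝ} (hu : ContDiffOn ℝ 2 u OmegaBar) :
    ContDiffOn ℝ 1 (gradNormSq u) Omega :=
  ContDiffOn.sum fun _ _ => ((contDiffOn_fderiv hu).clm_apply contDiffOn_const).pow 2

lemma contDiffOn_pohoVec {u h : E3 → ℝ} (hu : ContDiffOn ℝ 2 u OmegaBar)
    (hh : ContDiffOn ℝ 2 h OmegaBar) (k : Fin 3) : ContDiffOn ℝ 1 (pohoVec u h k) Omega := by
  have hu1 := contDiffOn_fderiv hu
  have hu0 : ContDiffOn ℝ 1 u Omega := (hu.of_le (by norm_num)).mono Omega_subset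
  have hh0 : ContDiffOn ℝ 1 h Omega := (hh.of_le (by norm_num)).mono Omega_subset
  have hx : ContDiffOn ℝ 1 (fun x : E3 => ⟪eb k, x⟫) Omega := (innerSL ℝ (eb k)).contDiff.contDiffOn
  exact (((hu1.clm_apply contDiffOn_const).mul ((hu1.clm_apply contDiffOn_id).add hh0)).sub
    (hx.mul ((contDiffOn_gradNormSq hu).div_const 2))).sub
    (hu0.mul ((contDiffOn_fderiv hh).clm_apply contDiffOn_const))

lemma sum_fderiv_pohoVec {u h : E3 → ℝ} {x : E3} (hu : ContDiffAt ℝ 2 u x)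
    (hh : ContDiffAt ℝ 2 h x) (hΔ : lapl h x = 0) :
    ∑ k, fderiv ℝ (pohoVec u h k) x (eb k)
      = lapl u x * (fderiv ℝ u x x + h x) - gradNormSq u x / 2 := by
  set T := fderiv ℝ (fderiv ℝ u) x with hT
  have hTd : HasFDerivAt (fderiv ℝ u) T x := (differentiableAt_fderiv hu).hasFDerivAt
  have hHd : HasFDerivAt (fderiv ℝ h) (fderiv ℝ (fderiv ℝ h) x) x :=
    (differentiableAt_fderiv hh).hasFDerivAt
  have hsymm : ∀ v w, T v w = T w v := fun v w =>
    (hu.isSymmSndFDerivAt (by simp)).eq v w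
  have hu' : HasFDerivAt u (fderiv ℝ u x) x := (hu.differentiableAt (by simp)).hasFDerivAt
  have hh' : HasFDerivAt h (fderiv ℝ h x) x := (hh.differentiableAt (by simp)).hasFDerivAt
  have hD : ∀ v, HasFDerivAt (fun y => fderiv ℝ u y v) (T.flip v) x := fun v => by
    simpa using hTd.clm_apply (hasFDerivAt_const v x)
  have hDh : ∀ v, HasFDerivAt (fun y => fderiv ℝ h y v) ((fderiv ℝ (fderiv ℝ h) x).flip v) x :=
    fun v => by simpa using hHd.clm_apply (hasFDerivAt_const v x)
  have hX : HasFDerivAt (fun y => fderiv ℝ u y y) (fderiv ℝ u x + T.flip x) x := by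
    simpa using hTd.clm_apply (hasFDerivAt_id x)
  have hg : HasFDerivAt (gradNormSq u)
      (∑ l, (2 * fderiv ℝ u x (eb l)) • T.flip (eb l)) x := by
    refine HasFDerivAt.fun_sum fun l _ => ?_
    simpa using (hD (eb l)).pow 2
  have hk : ∀ k, fderiv ℝ (pohoVec u h k) x (eb k)
      = T (eb k) (eb k) * (fderiv ℝ u x x + h x)
        + fderiv ℝ u x (eb k) * T x (eb k) + (fderiv ℝ u x (eb k)) ^ 2 - gradNormSq u x / 2
        - ⟪eb k, x⟫ * ∑ l, fderiv ℝ u x (eb l) * T (eb l) (eb k)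
        - u x * fderiv ℝ (fderiv ℝ h) x (eb k) (eb k) := by
    intro k
    have h1 := (((hD (eb k)).fun_mul (hX.fun_add hh')).fun_sub
      ((innerSL ℝ (eb k)).hasFDerivAt.fun_mul (hg.fun_mul (hasFDerivAt_const (2 : ℝ)⁻¹ x)))).fun_sub
      (hu'.fun_mul (hDh (eb k)))
    have h2 : fderiv ℝ (pohoVec u h k) x = _ := h1.fderiv
    rw [h2]
    have h3 : (⟪eb k, eb k⟫ : ℝ) = 1 := by rw [real_inner_self_eq_norm_sq, norm_eb, one_pow]
    simp only [sub_apply, add_apply, smul_apply, sum_apply, ContinuousLinearMap.flip_apply,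
      smul_eq_mul, innerSL_apply_apply, h3, zero_apply, hsymm (eb k) x]
    simp only [hsymm (eb k), Finset.mul_sum]
    simp only [mul_assoc, ← Finset.mul_sum]
    ring
  simp only [hk]
  have h4 : ∀ l, ∑ k, ⟪eb k, x⟫ * T (eb l) (eb k) = T (eb l) x := fun l =>
    sum_inner_eb_mul (T (eb l)) x
  have h5 : ∑ k, ⟪eb k, x⟫ * ∑ l, fderiv ℝ u x (eb l) * T (eb l) (eb k)
      = ∑ l, fderiv ℝ u x (eb l) * T x (eb l) := by
    simp_rw [Finset.mul_sum]
    rw [Finset.sum_comm]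
    refine Finset.sum_congr rfl fun l _ => ?_
    rw [← hsymm, ← h4, Finset.mul_sum]
    exact Finset.sum_congr rfl fun k _ => by ring
  have h6 : ∑ k, T (eb k) (eb k) = lapl u x := rfl
  have h7 : ∑ k, fderiv ℝ (fderiv ℝ h) x (eb k) (eb k) = 0 := hΔ
  simp only [Finset.sum_add_distrib, Finset.sum_sub_distrib, ← Finset.sum_mul, ← Finset.mul_sum,
    h5, h6, h7]
  simp only [gradNormSq, Finset.sum_const, Finset.card_univ, Fintype.card_fin, nsmul_eq_mul]
  push_cast
  ring

lemma sum_mul_pohoVec (u h : E3 → ℝ) (x : E3) :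
    ∑ k, ⟪eb k, x⟫ * pohoVec u h k x = fderiv ℝ u x x * (fderiv ℝ u x x + h x)
      - ‖x‖ ^ 2 * (gradNormSq u x / 2) - u x * fderiv ℝ h x x := by
  have h1 := sum_inner_eb_mul (fderiv ℝ u x) x
  have h2 := sum_inner_eb_mul (fderiv ℝ h x) x
  have h3 : ∑ k, ⟪eb k, x⟫ * ⟪eb k, x⟫ = ‖x‖ ^ 2 := by
    rw [← sum_sq_inner_eb x]
    exact Finset.sum_congr rfl fun k _ => by rw [real_inner_comm, sq]
  rw [← h1, ← h2, ← h3]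
  simp only [pohoVec, Fin.sum_univ_three, ← h1]
  ring

/-! ### The energy of the perturbation -/

/-- The radial dilation derivative of the reference field. -/
def dilEntry (a b c c₁ c₃ : ℝ) (i j : Fin 3) : E3 → ℝ :=
  refHarm (-3 * (sstar a b c * c₃)) (- -(sstar a b c * c₁ * axisEntry i j)) 0 (eb i) (eb j)

/-- The excess potential energy density. -/
def potDens (a b c L : ℝ) (Q : E3 → Mat3) (x : E3) : ℝ :=
  (gpot a b c (Q x) - gpot a b c (Qinf a b c)) / L

/-- The Dirichlet density of the perturbation. -/
def gradDens (a b c c₁ c₃ : ℝ) (Q : E3 → Mat3) (x : E3) : ℝ :=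
  ∑ i, ∑ j, gradNormSq (pertEntry a b c c₁ c₃ Q i j) x

/-- The squared norm of the perturbation. -/
def pertSq (a b c c₁ c₃ : ℝ) (Q : E3 → Mat3) (x : E3) : ℝ :=
  ∑ i, ∑ j, pertEntry a b c c₁ c₃ Q i j x ^ 2

/-- The Pohozaev field of the system. -/
def pohoField (a b c L c₁ c₃ : ℝ) (Q : E3 → Mat3) (k : Fin 3) (x : E3) : ℝ :=
  ∑ i, ∑ j, pohoVec (pertEntry a b c c₁ c₃ Q i j) (dilEntry a b c c₁ c₃ i j) k x
    - ⟪eb k, x⟫ * potDens a b c L Q x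

lemma contDiffOn_dilEntry (a b c c₁ c₃ : ℝ) (i j : Fin 3) :
    ContDiffOn ℝ 2 (dilEntry a b c c₁ c₃ i j) OmegaBar :=
  contDiffOn_refHarm _ _ _ (norm_eb i) (norm_eb j)

lemma lapl_dilEntry (a b c c₁ c₃ : ℝ) (i j : Fin 3) {x : E3} (hx : x ∈ OmegaBar) :
    lapl (dilEntry a b c c₁ c₃ i j) x = 0 :=
  lapl_refHarm _ _ _ (norm_eb i) (norm_eb j) hx

/-- Directional derivatives of a field with values in `S₀` are in `S₀`. -/
lemma isS0_fderiv {Q : E3 → Mat3} {Q' : Fin 3 → Fin 3 → E3 →L[ℝ] ℝ} {x : E3}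
    (hQ : ∀ i j, HasFDerivAt (fun y => Q y i j) (Q' i j) x) (h : ∀ᶠ y in 𝓝 x, isS0 (Q y)) (v : E3) :
    isS0 (Matrix.of fun i j => Q' i j v) := by
  constructor
  · ext i j
    have h1 : (fun y => Q y j i) =ᶠ[𝓝 x] fun y => Q y i j := h.mono fun y hy => hy.1.apply i j
    have h2 := ((hQ j i).congr_of_eventuallyEq h1.symm).unique (hQ i j)
    simp [h2]
  · have h1 : (fun y => ∑ i, Q y i i) =ᶠ[𝓝 x] fun _ => 0 := h.mono fun y hy => hy.2
    have h2 := ((HasFDerivAt.fun_sum fun i (_ : i ∈ Finset.univ) => hQ i i).congr_of_eventuallyEq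
      h1.symm).unique (hasFDerivAt_const 0 x)
    simpa [Matrix.trace] using congrArg (fun f : E3 →L[ℝ] ℝ => f v) h2

namespace LdGPert

variable {a b c L κ c₁ c₃ : ℝ} {Q : E3 → Mat3}

lemma abs_dilEntry_le (h : LdGPert a b c L κ c₁ c₃ Q) (i j : Fin 3) {x : E3} (hx : x ∈ OmegaBar) :
    |dilEntry a b c c₁ c₃ i j x| ≤ 7 * sstar a b c * ‖x‖⁻¹ := by
  obtain ⟨h1, h2⟩ := h.abs_coef_le i j
  have := abs_refHarm_sub_le (-3 * (sstar a b c * c₃)) (- -(sstar a b c * c₁ * axisEntry i j)) 0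
    (norm_eb i) (norm_eb j) hx
  rw [sub_zero, abs_neg, abs_mul (-3), abs_of_neg (by norm_num : (-3 : ℝ) < 0)] at this
  refine this.trans ?_
  gcongr
  linarith

lemma abs_fderiv_dilEntry_le (h : LdGPert a b c L κ c₁ c₃ Q) (i j : Fin 3) {x : E3}
    (hx : x ∈ OmegaBar) (v : E3) :
    |fderiv ℝ (dilEntry a b c c₁ c₃ i j) x v| ≤ 25 * sstar a b c * ‖x‖⁻¹ ^ 2 * ‖v‖ := by
  obtain ⟨h1, h2⟩ := h.abs_coef_le i j
  have := abs_fderiv_refHarm_le (-3 * (sstar a b c * c₃)) (- -(sstar a b c * c₁ * axisEntry i j)) 0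
    (norm_eb i) (norm_eb j) hx v
  rw [abs_neg, abs_mul (-3), abs_of_neg (by norm_num : (-3 : ℝ) < 0)] at this
  refine this.trans ?_
  gcongr
  linarith

lemma hasFDerivAt_entry (h : LdGPert a b c L κ c₁ c₃ Q) (i j : Fin 3) {x : E3} (hx : x ∈ Omega) :
    HasFDerivAt (fun y => Q y i j) (fderiv ℝ (pertEntry a b c c₁ c₃ Q i j) x
      + fderiv ℝ (refEntry a b c c₁ c₃ i j) x) x := by
  have h1 := ((contDiffAt_of_mem (h.smooth i j) hx).differentiableAt (by simp)).hasFDerivAt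
  have h2 := ((contDiffAt_of_mem (contDiffOn_refEntry a b c c₁ c₃ i j) hx).differentiableAt
    (by simp)).hasFDerivAt
  refine (h1.fun_add h2).congr_of_eventuallyEq (Eventually.of_forall fun y => ?_)
  simp [pertEntry]

lemma hasFDerivAt_potDens (h : LdGPert a b c L κ c₁ c₃ Q) {x : E3} (hx : x ∈ Omega) :
    HasFDerivAt (potDens a b c L Q) (L⁻¹ • ∑ i, ∑ j, gradf a b c (Q x) i j •
      (fderiv ℝ (pertEntry a b c c₁ c₃ Q i j) x + fderiv ℝ (refEntry a b c c₁ c₃ i j) x)) x := by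
  have h1 : ∀ᶠ y in 𝓝 x, isS0 (Q y) := mem_of_superset (OmegaBar_mem_nhds hx) h.mem.1
  have h2 := fun i j => h.hasFDerivAt_entry i j hx
  refine (((hasFDerivAt_gpot a b c h2 (isS0_fderiv h2 h1)).sub_const
    (gpot a b c (Qinf a b c))).const_mul L⁻¹).congr_of_eventuallyEq
    (Eventually.of_forall fun y => ?_)
  simp only [potDens]
  ring

lemma contDiffOn_potDens (h : LdGPert a b c L κ c₁ c₃ Q) :
    ContDiffOn ℝ 1 (potDens a b c L Q) Omega := by
  have h1 : ContDiffOn ℝ 1 (fun x => (fun i j => Q x i j : Fin 3 → Fin 3 → ℝ)) Omega :=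
    contDiffOn_pi.2 fun i => contDiffOn_pi.2 fun j =>
      ((h.reg i j).of_le (by norm_num)).mono Omega_subset
  exact (((contDiff_gpot a b c).comp_contDiffOn h1).sub contDiffOn_const).div_const L

lemma potDens_nonneg (h : LdGPert a b c L κ c₁ c₃ Q) {x : E3} (hx : x ∈ OmegaBar) :
    0 ≤ potDens a b c L Q x :=
  div_nonneg (sub_nonneg.2 (gpot_Qinf_le h.a_nonneg h.b_pos h.c_pos (h.mem.1 x hx))) h.L_pos.le

lemma contDiffOn_pohoField (h : LdGPert a b c L κ c₁ c₃ Q) (k : Fin 3) :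
    ContDiffOn ℝ 1 (pohoField a b c L c₁ c₃ Q k) Omega := by
  have h1 : ContDiffOn ℝ 1 (fun x : E3 => ⟪eb k, x⟫) Omega := (innerSL ℝ (eb k)).contDiff.contDiffOn
  exact (ContDiffOn.sum fun i _ => ContDiffOn.sum fun j _ =>
    contDiffOn_pohoVec (h.smooth i j) (contDiffOn_dilEntry a b c c₁ c₃ i j) k).sub
      (h1.mul h.contDiffOn_potDens)

lemma sum_fderiv_pohoField (h : LdGPert a b c L κ c₁ c₃ Q) {x : E3} (hx : x ∈ Omega) :
    ∑ k, fderiv ℝ (pohoField a b c L c₁ c₃ Q k) x (eb k)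
      = -(gradDens a b c c₁ c₃ Q x / 2 + 3 * potDens a b c L Q x) := by
  have h1 : ∀ i j, ∑ k, fderiv ℝ (pohoVec (pertEntry a b c c₁ c₃ Q i j)
      (dilEntry a b c c₁ c₃ i j) k) x (eb k) = gradf a b c (Q x) i j / L
        * (fderiv ℝ (pertEntry a b c c₁ c₃ Q i j) x + fderiv ℝ (refEntry a b c c₁ c₃ i j) x) x
        - gradNormSq (pertEntry a b c c₁ c₃ Q i j) x / 2 := by
    intro i j
    rw [sum_fderiv_pohoVec (contDiffAt_of_mem (h.smooth i j) hx)
      (contDiffAt_of_mem (contDiffOn_dilEntry a b c c₁ c₃ i j) hx)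
      (lapl_dilEntry a b c c₁ c₃ i j (Omega_subset hx)), h.lapl_eq_div i j hx, add_apply]
    congr 3
    exact (fderiv_refHarm_self _ _ _ (norm_eb i) (norm_eb j) (Omega_subset hx)).symm
  have hF := h.hasFDerivAt_potDens hx
  have hd : ∀ i j k, DifferentiableAt ℝ (pohoVec (pertEntry a b c c₁ c₃ Q i j)
      (dilEntry a b c c₁ c₃ i j) k) x := fun i j k =>
    ((contDiffOn_pohoVec (h.smooth i j) (contDiffOn_dilEntry a b c c₁ c₃ i j)
      k).differentiableOn (by simp)).differentiableAt (Omega_mem_nhds hx)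
  have h2 : ∀ k, fderiv ℝ (pohoField a b c L c₁ c₃ Q k) x (eb k)
      = ∑ i, ∑ j, fderiv ℝ (pohoVec (pertEntry a b c c₁ c₃ Q i j)
        (dilEntry a b c c₁ c₃ i j) k) x (eb k)
        - (⟪eb k, x⟫ * fderiv ℝ (potDens a b c L Q) x (eb k) + potDens a b c L Q x) := by
    intro k
    have h3 := (HasFDerivAt.fun_sum fun i (_ : i ∈ Finset.univ) =>
      HasFDerivAt.fun_sum fun j (_ : j ∈ Finset.univ) => (hd i j k).hasFDerivAt).fun_sub
      ((innerSL ℝ (eb k)).hasFDerivAt.fun_mul hF.differentiableAt.hasFDerivAt)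
    have h4 : fderiv ℝ (pohoField a b c L c₁ c₃ Q k) x = _ := h3.fderiv
    rw [h4]
    simp
  simp only [h2, Finset.sum_sub_distrib, Finset.sum_add_distrib, sum_inner_eb_mul]
  rw [Finset.sum_comm]
  have h6 : ∑ i, ∑ k, ∑ j, fderiv ℝ (pohoVec (pertEntry a b c c₁ c₃ Q i j)
      (dilEntry a b c c₁ c₃ i j) k) x (eb k) = ∑ i, ∑ j, (gradf a b c (Q x) i j / L
        * (fderiv ℝ (pertEntry a b c c₁ c₃ Q i j) x + fderiv ℝ (refEntry a b c c₁ c₃ i j) x) x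
        - gradNormSq (pertEntry a b c c₁ c₃ Q i j) x / 2) := by
    refine Finset.sum_congr rfl fun i _ => ?_
    rw [Finset.sum_comm]
    exact Finset.sum_congr rfl fun j _ => h1 i j
  rw [h6, hF.fderiv, gradDens]
  simp only [Finset.sum_sub_distrib, smul_apply, sum_apply, smul_eq_mul, ← Finset.sum_div,
    Finset.sum_const, Finset.card_univ, Fintype.card_fin, nsmul_eq_mul, div_mul_eq_mul_div]
  push_cast
  ring

/-- The tested Pohozaev identity. -/
lemma energy_identity (h : LdGPert a b c L κ c₁ c₃ Q) {φ : E3 → ℝ} (hφ : TestFn φ) :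
    ∫ x in Omega, φ x * (gradDens a b c c₁ c₃ Q x / 2 + 3 * potDens a b c L Q x)
      = ∫ x in Omega, ∑ k, fderiv ℝ φ x (eb k) * pohoField a b c L c₁ c₃ Q k x := by
  have h1 := hφ.setIntegral_mul_div h.contDiffOn_pohoField
  rw [setIntegral_congr_fun isOpen_Omega.measurableSet (g := fun x => -(φ x *
    (gradDens a b c c₁ c₃ Q x / 2 + 3 * potDens a b c L Q x)))
    (fun x hx => by simp only [h.sum_fderiv_pohoField hx]; ring), integral_neg] at h1
  exact neg_inj.1 h1

end LdGPert

/-! ### The energy estimate -/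

/-- The integrable density controlling the far part of the Pohozaev identity. -/
def remDens (a b c c₁ c₃ : ℝ) (Q : E3 → Mat3) (x : E3) : ℝ :=
  gradDens a b c c₁ c₃ Q x / 2 + pertSq a b c c₁ c₃ Q x / ‖x‖ ^ 2
    + 1600 * sstar a b c ^ 2 / ‖x‖ ^ 4

lemma integrableOn_norm_inv_pow_four : IntegrableOn (fun x : E3 => 1 / ‖x‖ ^ 4) Omega := by
  have h1 : Integrable (fun x : E3 => 16 * (1 + ‖x‖) ^ (-(4 : ℝ))) :=
    (integrable_one_add_norm (by simp; norm_num)).const_mul 16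
  refine h1.integrableOn.mono' ?_ ?_
  · refine ContinuousOn.aestronglyMeasurable ?_ isOpen_Omega.measurableSet
    refine continuousOn_const.div (by fun_prop) fun x hx => ?_
    have : 1 < ‖x‖ := hx
    positivity
  · refine (ae_restrict_iff' isOpen_Omega.measurableSet).2 (Eventually.of_forall fun x hx => ?_)
    have hx1 : 1 < ‖x‖ := hx
    rw [Real.norm_of_nonneg (by positivity), Real.rpow_neg (by positivity),
      show (4 : ℝ) = (4 : ℕ) by norm_num, Real.rpow_natCast, ← div_eq_mul_inv,
      div_le_div_iff₀ (by positivity) (by positivity), one_mul]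
    calc (1 + ‖x‖) ^ 4 ≤ (2 * ‖x‖) ^ 4 := by gcongr; linarith
      _ = _ := by ring

namespace FarCutoff

variable {K δ : ℝ} {w φ p e : E3 → ℝ}

lemma norm_normSq_mul_slope_le (hφ : FarCutoff K δ w φ p e) (x : E3) :
    ‖‖x‖ ^ 2 * p x‖ ≤ 1 / 2 := by
  rw [Real.norm_of_nonneg (mul_nonneg (by positivity) (hφ.slope_nonneg x))]
  exact hφ.normSq_mul_slope_le x

lemma integrableOn_slope_mul (hφ : FarCutoff K δ w φ p e) {f : E3 → ℝ}
    (hf : IntegrableOn f Omega) : IntegrableOn (fun x => ‖x‖ ^ 2 * p x * f x) Omega :=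
  hf.bdd_mul (((continuous_norm.pow 2).mul hφ.continuous_slope).aestronglyMeasurable)
    (Eventually.of_forall hφ.norm_normSq_mul_slope_le)

lemma integrableOn_error_mul (hφ : FarCutoff K δ w φ p e) {f : E3 → ℝ}
    (hf : IntegrableOn f Omega) : IntegrableOn (fun x => e x * ‖x‖ ^ 2 * f x) Omega := by
  obtain ⟨D, hD⟩ := hφ.error_mul_le
  refine hf.bdd_mul ((hφ.continuous_error.mul (continuous_norm.pow 2)).aestronglyMeasurable)
    (c := D) (Eventually.of_forall fun x => ?_)
  rw [Real.norm_of_nonneg (mul_nonneg (hφ.error_nonneg x) (by positivity))]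
  exact hD x

/-- Along cutoffs with `δ → 0` the slope terms vanish. -/
lemma tendsto_integral_slope {φ p e : ℕ → E3 → ℝ}
    (hφ : ∀ n : ℕ, FarCutoff K (1 / ((n : ℝ) + 1)) w (φ n) (p n) (e n)) {f : E3 → ℝ}
    (hf : IntegrableOn f Omega) :
    Tendsto (fun n => ∫ x in Omega, ‖x‖ ^ 2 * p n x * f x) atTop (𝓝 0) := by
  have hlim : ∀ x, Tendsto (fun n => ‖x‖ ^ 2 * p n x * f x) atTop (𝓝 0) := by
    intro x
    have h1 : Tendsto (fun n => p n x) atTop (𝓝 0) := by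
      refine squeeze_zero (fun n => (hφ n).slope_nonneg x) (fun n => (hφ n).slope_le x) ?_
      simpa using (tendsto_one_div_add_atTop_nhds_zero_nat (𝕜 := ℝ)).const_mul 2
    simpa using (h1.const_mul (‖x‖ ^ 2)).mul_const (f x)
  have := tendsto_integral_of_dominated_convergence (μ := volume.restrict Omega)
    (F := fun n x => ‖x‖ ^ 2 * p n x * f x) (f := fun _ => 0) (fun x => ‖f x‖)
    (fun n => ((hφ n).integrableOn_slope_mul hf).aestronglyMeasurable) hf.norm
    (fun n => Eventually.of_forall fun x => ?_) (Eventually.of_forall hlim)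
  · simpa using this
  · rw [norm_mul]
    have := (hφ n).norm_normSq_mul_slope_le x
    exact mul_le_of_le_one_left (norm_nonneg _) (by linarith)

/-- The derivative of the cutoff paired with a vector field. -/
lemma sum_fderiv_mul_le (hφ : FarCutoff K δ w φ p e) (hK : 0 ≤ K) {V : Fin 3 → ℝ} {M : ℝ}
    {x : E3} (hV : ‖x‖ ≤ 2 → ∀ k, |V k| ≤ M) :
    ∑ k, fderiv ℝ φ x (eb k) * V k ≤ (closedBall 0 2).indicator (fun _ => 3 * K * M) x
      - p x * ∑ k, ⟪eb k, x⟫ * V k := by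
  have h1 : ∑ k, fderiv ℝ φ x (eb k) * V k = ∑ k, (fderiv ℝ φ x (eb k) + p x * ⟪x, eb k⟫) * V k
      - p x * ∑ k, ⟪eb k, x⟫ * V k := by
    rw [Finset.mul_sum, ← Finset.sum_sub_distrib]
    refine Finset.sum_congr rfl fun k _ => ?_
    rw [real_inner_comm x (eb k)]
    ring
  rw [h1]
  gcongr
  rcases le_or_gt ‖x‖ 2 with hx | hx
  · rw [indicator_of_mem (by simpa using hx)]
    calc ∑ k, (fderiv ℝ φ x (eb k) + p x * ⟪x, eb k⟫) * V k ≤ ∑ _k : Fin 3, K * M := by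
          refine Finset.sum_le_sum fun k _ => (le_abs_self _).trans ?_
          rw [abs_mul]
          have := hφ.abs_fderiv_add_le x (eb k)
          rw [norm_eb, mul_one] at this
          exact mul_le_mul this (hV hx k) (abs_nonneg _) hK
      _ = _ := by simp; ring
  · rw [indicator_of_notMem (by simpa using hx)]
    simp [hφ.fderiv_eq x _ hx.le]

end FarCutoff

namespace LdGPert

variable {a b c L κ c₁ c₃ : ℝ} {Q : E3 → Mat3}

lemma neg_sum_mul_pohoField_le (h : LdGPert a b c L κ c₁ c₃ Q) {x : E3} (hx : x ∈ Omega) :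
    -∑ k, ⟪eb k, x⟫ * pohoField a b c L c₁ c₃ Q k x
      ≤ ‖x‖ ^ 2 * (remDens a b c c₁ c₃ Q x + potDens a b c L Q x) := by
  have hx1 : 1 < ‖x‖ := hx
  have hs := h.sstar_pos'
  set s := sstar a b c
  have hsq : ∑ k, ⟪eb k, x⟫ * ⟪eb k, x⟫ = ‖x‖ ^ 2 := by
    rw [← sum_sq_inner_eb x]
    exact Finset.sum_congr rfl fun k _ => by rw [real_inner_comm, sq]
  have h1 : ∑ k, ⟪eb k, x⟫ * pohoField a b c L c₁ c₃ Q k x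
      = ∑ i, ∑ j, ∑ k, ⟪eb k, x⟫ * pohoVec (pertEntry a b c c₁ c₃ Q i j)
        (dilEntry a b c c₁ c₃ i j) k x - ‖x‖ ^ 2 * potDens a b c L Q x := by
    simp only [pohoField, mul_sub, Finset.sum_sub_distrib, ← mul_assoc, ← Finset.sum_mul, hsq,
      Finset.mul_sum]
    rw [Finset.sum_comm]
    congr 1
    exact Finset.sum_congr rfl fun i _ => Finset.sum_comm
  have h2 : ∀ i j, -(∑ k, ⟪eb k, x⟫ * pohoVec (pertEntry a b c c₁ c₃ Q i j)
        (dilEntry a b c c₁ c₃ i j) k x)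
      ≤ ‖x‖ ^ 2 / 2 * gradNormSq (pertEntry a b c c₁ c₃ Q i j) x
        + (pertEntry a b c c₁ c₃ Q i j x ^ 2 + 1600 / 9 * s ^ 2 * ‖x‖⁻¹ ^ 2) := by
    intro i j
    rw [sum_mul_pohoVec]
    have h3 := h.abs_dilEntry_le i j (Omega_subset hx)
    have h4 := h.abs_fderiv_dilEntry_le i j (Omega_subset hx) x
    have h5 : ‖x‖⁻¹ ^ 2 * ‖x‖ = ‖x‖⁻¹ := by field_simp
    rw [mul_assoc (25 * s), h5] at h4
    set X := fderiv ℝ (pertEntry a b c c₁ c₃ Q i j) x x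
    set u := pertEntry a b c c₁ c₃ Q i j x
    set d := dilEntry a b c c₁ c₃ i j x
    set D := fderiv ℝ (dilEntry a b c c₁ c₃ i j) x x
    have h6 : d ^ 2 ≤ (7 * s * ‖x‖⁻¹) ^ 2 := sq_le_sq' (abs_le.1 h3).1 (abs_le.1 h3).2
    have h7 : D ^ 2 ≤ (25 * s * ‖x‖⁻¹) ^ 2 :=
      sq_le_sq' (by linarith [(abs_le.1 h4).1]) (by linarith [(abs_le.1 h4).2])
    have h8 : 0 ≤ s ^ 2 * ‖x‖⁻¹ ^ 2 := by positivity
    nlinarith [sq_nonneg (X + d / 2), sq_nonneg (u - D / 2)]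
  have h3 : -∑ i, ∑ j, ∑ k, ⟪eb k, x⟫ * pohoVec (pertEntry a b c c₁ c₃ Q i j)
        (dilEntry a b c c₁ c₃ i j) k x ≤ ∑ i, ∑ j,
      (‖x‖ ^ 2 / 2 * gradNormSq (pertEntry a b c c₁ c₃ Q i j) x
        + (pertEntry a b c c₁ c₃ Q i j x ^ 2 + 1600 / 9 * s ^ 2 * ‖x‖⁻¹ ^ 2)) := by
    simp only [← Finset.sum_neg_distrib]
    refine Finset.sum_le_sum fun i _ => Finset.sum_le_sum fun j _ => ?_
    rw [Finset.sum_neg_distrib]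
    exact h2 i j
  have h4 : ∑ i, ∑ j, (‖x‖ ^ 2 / 2 * gradNormSq (pertEntry a b c c₁ c₃ Q i j) x
        + (pertEntry a b c c₁ c₃ Q i j x ^ 2 + 1600 / 9 * s ^ 2 * ‖x‖⁻¹ ^ 2))
      = ‖x‖ ^ 2 * remDens a b c c₁ c₃ Q x := by
    simp only [Finset.sum_add_distrib, ← Finset.mul_sum, Finset.sum_const, Finset.card_univ,
      Fintype.card_fin, nsmul_eq_mul]
    rw [remDens, gradDens, pertSq]
    field_simp
    push_cast
    ring
  rw [h1, neg_sub]
  linarith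

lemma sq_fderiv_pert_le (h : LdGPert a b c L κ c₁ c₃ Q) (i j : Fin 3) {x : E3}
    (hx : x ∈ Omega) (k : Fin 3) :
    fderiv ℝ (pertEntry a b c c₁ c₃ Q i j) x (eb k) ^ 2
      ≤ 2 * fderiv ℝ (fun y => Q y i j) x (eb k) ^ 2
        + 162 * sstar a b c ^ 2 * (1 / ‖x‖ ^ 4) := by
  have h1 := h.abs_fderiv_refEntry_le i j (Omega_subset hx) (eb k)
  rw [norm_eb, mul_one] at h1
  have h2 := sq_le_sq' (abs_le.1 h1).1 (abs_le.1 h1).2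
  rw [(h.hasFDerivAt_entry i j hx).fderiv, add_apply]
  have h3 : (9 * sstar a b c * ‖x‖⁻¹ ^ 2) ^ 2 = 81 * sstar a b c ^ 2 * (1 / ‖x‖ ^ 4) := by
    rw [one_div, ← inv_pow]; ring
  nlinarith [sq_nonneg (fderiv ℝ (pertEntry a b c c₁ c₃ Q i j) x (eb k)
    + 2 * fderiv ℝ (refEntry a b c c₁ c₃ i j) x (eb k))]

lemma integrableOn_gradDens (h : LdGPert a b c L κ c₁ c₃ Q) :
    IntegrableOn (gradDens a b c c₁ c₃ Q) Omega := by
  have hc : ContinuousOn (gradDens a b c c₁ c₃ Q) Omega :=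
    continuousOn_finsetSum _ fun i _ => continuousOn_finsetSum _ fun j _ =>
      (contDiffOn_gradNormSq (h.smooth i j)).continuousOn
  refine ((h.mem.2.1.const_mul 2).add (integrableOn_norm_inv_pow_four.const_mul
    (27 * (162 * sstar a b c ^ 2)))).mono' (hc.aestronglyMeasurable isOpen_Omega.measurableSet)
    ((ae_restrict_iff' isOpen_Omega.measurableSet).2 (Eventually.of_forall fun x hx => ?_))
  have h0 : 0 ≤ gradDens a b c c₁ c₃ Q x :=
    Finset.sum_nonneg fun i _ => Finset.sum_nonneg fun j _ => gradNormSq_nonneg _ _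
  rw [Real.norm_of_nonneg h0]
  calc gradDens a b c c₁ c₃ Q x ≤ ∑ i, ∑ j, ∑ k : Fin 3,
        (2 * fderiv ℝ (fun y => Q y i j) x (eb k) ^ 2
          + 162 * sstar a b c ^ 2 * (1 / ‖x‖ ^ 4)) :=
        Finset.sum_le_sum fun i _ => Finset.sum_le_sum fun j _ => Finset.sum_le_sum fun k _ =>
          h.sq_fderiv_pert_le i j hx k
    _ = _ := by
        simp only [Finset.sum_add_distrib, ← Finset.mul_sum, gradSq, pd_eq _ hx, Pi.add_apply,
          Finset.sum_const, Finset.card_univ, Fintype.card_fin, nsmul_eq_mul]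
        push_cast
        ring

lemma integrableOn_pertSq_div (h : LdGPert a b c L κ c₁ c₃ Q) :
    IntegrableOn (fun x => pertSq a b c c₁ c₃ Q x / ‖x‖ ^ 2) Omega := by
  have hc : ContinuousOn (fun x => pertSq a b c c₁ c₃ Q x / ‖x‖ ^ 2) Omega := by
    refine ContinuousOn.div (continuousOn_finsetSum _ fun i _ => continuousOn_finsetSum _
      fun j _ => (((h.smooth i j).continuousOn).mono Omega_subset).pow 2) (by fun_prop)
      fun x hx => ?_
    have : 1 < ‖x‖ := hx
    positivity
  refine ((h.mem.2.2.const_mul 2).add (integrableOn_norm_inv_pow_four.const_mul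
    (162 * sstar a b c ^ 2))).mono' (hc.aestronglyMeasurable isOpen_Omega.measurableSet)
    ((ae_restrict_iff' isOpen_Omega.measurableSet).2 (Eventually.of_forall fun x hx => ?_))
  have hx1 : 1 < ‖x‖ := hx
  have h0 : 0 ≤ pertSq a b c c₁ c₃ Q x :=
    Finset.sum_nonneg fun i _ => Finset.sum_nonneg fun j _ => sq_nonneg _
  rw [Real.norm_of_nonneg (by positivity), div_le_iff₀ (by positivity)]
  have h1 : ∀ i j, pertEntry a b c c₁ c₃ Q i j x ^ 2
      ≤ 2 * (Q x - Qinf a b c) i j ^ 2 + 18 * sstar a b c ^ 2 * ‖x‖⁻¹ ^ 2 := by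
    intro i j
    have h2 := h.abs_refEntry_sub_le i j (Omega_subset hx)
    have h3 := sq_le_sq' (abs_le.1 h2).1 (abs_le.1 h2).2
    have h4 : pertEntry a b c c₁ c₃ Q i j x = (Q x - Qinf a b c) i j
        - (refEntry a b c c₁ c₃ i j x - Qinf a b c i j) := by
      simp [pertEntry]
    rw [h4]
    nlinarith [sq_nonneg ((Q x - Qinf a b c) i j
        + (refEntry a b c c₁ c₃ i j x - Qinf a b c i j))]
  calc pertSq a b c c₁ c₃ Q x ≤ ∑ i, ∑ j, (2 * (Q x - Qinf a b c) i j ^ 2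
        + 18 * sstar a b c ^ 2 * ‖x‖⁻¹ ^ 2) :=
        Finset.sum_le_sum fun i _ => Finset.sum_le_sum fun j _ => h1 i j
    _ = _ := by
        simp only [Finset.sum_add_distrib, ← Finset.mul_sum, Pi.add_apply,
          ((h.mem.1 x (Omega_subset hx)).sub isS0_Qinf).mnormSq_eq,
          Finset.sum_const, Finset.card_univ, Fintype.card_fin, nsmul_eq_mul]
        field_simp
        push_cast
        ring

lemma integrableOn_remDens (h : LdGPert a b c L κ c₁ c₃ Q) :
    IntegrableOn (remDens a b c c₁ c₃ Q) Omega := by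
  refine ((h.integrableOn_gradDens.div_const 2).add h.integrableOn_pertSq_div).add
    ((integrableOn_norm_inv_pow_four.const_mul (1600 * sstar a b c ^ 2)).congr
      (Eventually.of_forall fun x => ?_))
  ring

lemma continuousOn_gradDens (h : LdGPert a b c L κ c₁ c₃ Q) :
    ContinuousOn (gradDens a b c c₁ c₃ Q) Omega :=
  continuousOn_finsetSum _ fun i _ => continuousOn_finsetSum _ fun j _ =>
    (contDiffOn_gradNormSq (h.smooth i j)).continuousOn

/-- The energy is controlled by the Pohozaev field in `‖x‖ ≤ 2`, up to vanishing terms. -/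
lemma energy_le (h : LdGPert a b c L κ c₁ c₃ Q) {Cg K δ M : ℝ} {φ p e : E3 → ℝ}
    (hpot : ∀ x ∈ Omega, gpot a b c (Q x) - gpot a b c (Qinf a b c)
      ≤ Cg * mnormSq (Q x - Qinf a b c)) (hK : 0 ≤ K)
    (hφ : FarCutoff K δ (fun x => Cg / L * (mnormSq (Q x - Qinf a b c) / ‖x‖ ^ 2)) φ p e)
    (hV : ∀ x ∈ Omega, ‖x‖ ≤ 2 → ∀ k, |pohoField a b c L c₁ c₃ Q k x| ≤ M) :
    ∫ x in Omega, φ x * (gradDens a b c c₁ c₃ Q x / 2 + potDens a b c L Q x)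
      ≤ 3 * K * M * volume.real (closedBall (0 : E3) 2)
        + (∫ x in Omega, ‖x‖ ^ 2 * p x * remDens a b c c₁ c₃ Q x) + δ := by
  have hM : 0 ≤ M := by
    have hx : (3 / 2 : ℝ) • eb 0 ∈ Omega := by
      simp only [mem_Omega, norm_smul, norm_eb]; norm_num
    exact (abs_nonneg _).trans (hV _ hx (by simp only [norm_smul, norm_eb]; norm_num) 0)
  set w : E3 → ℝ := fun x => Cg / L * (mnormSq (Q x - Qinf a b c) / ‖x‖ ^ 2)
  have hw : IntegrableOn w Omega := h.mem.2.2.const_mul _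
  have hgc := h.continuousOn_gradDens
  have hpc := h.contDiffOn_potDens.continuousOn
  have i1 : IntegrableOn (fun x => (closedBall (0 : E3) 2).indicator
      (fun _ => 3 * K * M) x) Omega :=
    ((integrable_indicator_iff measurableSet_closedBall).2
      (integrableOn_const (measure_closedBall_lt_top).ne)).integrableOn
  have i2 := hφ.integrableOn_slope_mul h.integrableOn_remDens
  have i3 : IntegrableOn (fun x => φ x * (2 * potDens a b c L Q x)) Omega :=
    (hφ.integrable_mul (continuousOn_const.mul hpc)).integrableOn
  have i4 := hφ.integrableOn_error_mul hw
  have i5 : IntegrableOn (fun x => φ x * (gradDens a b c c₁ c₃ Q x / 2 + potDens a b c L Q x))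
      Omega := (hφ.integrable_mul ((hgc.div_const 2).add hpc)).integrableOn
  have hpt : ∀ x ∈ Omega, ∑ k, fderiv ℝ φ x (eb k) * pohoField a b c L c₁ c₃ Q k x
      ≤ (((closedBall (0 : E3) 2).indicator (fun _ => 3 * K * M) x
        + ‖x‖ ^ 2 * p x * remDens a b c c₁ c₃ Q x)
        + φ x * (2 * potDens a b c L Q x)) + e x * ‖x‖ ^ 2 * w x := by
    intro x hx
    have hx1 : 1 < ‖x‖ := hx
    have h1 := hφ.sum_fderiv_mul_le hK (V := fun k => pohoField a b c L c₁ c₃ Q k x) (M := M)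
      (x := x) (hV x hx)
    have h2 := mul_le_mul_of_nonneg_left (h.neg_sum_mul_pohoField_le hx) (hφ.slope_nonneg x)
    have h3 := mul_le_mul_of_nonneg_right (hφ.normSq_mul_slope_le_self x)
      (h.potDens_nonneg (Omega_subset hx))
    have h4 : potDens a b c L Q x ≤ ‖x‖ ^ 2 * w x := by
      have := div_le_div_of_nonneg_right (hpot x hx) h.L_pos.le
      refine this.trans_eq ?_
      simp only [w]
      field_simp
    have h5 := mul_le_mul_of_nonneg_left h4 (hφ.error_nonneg x)
    linarith
  have h1 := h.energy_identity hφ.toTestFn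
  have h2 : ∫ x in Omega, φ x * (gradDens a b c c₁ c₃ Q x / 2 + 3 * potDens a b c L Q x)
      = (∫ x in Omega, φ x * (gradDens a b c c₁ c₃ Q x / 2 + potDens a b c L Q x))
        + ∫ x in Omega, φ x * (2 * potDens a b c L Q x) := by
    rw [← integral_add i5 i3]
    exact integral_congr_ae (Eventually.of_forall fun x => by simp only; ring)
  have i6 : IntegrableOn (fun x => ∑ k, fderiv ℝ φ x (eb k) * pohoField a b c L c₁ c₃ Q k x)
      Omega := integrable_finsetSum _ fun k _ => (hφ.integrable_fderiv_mul (eb k)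
        (h.contDiffOn_pohoField k).continuousOn).integrableOn
  have h3 := setIntegral_mono_on i6 (((i1.add i2).add i3).add i4) isOpen_Omega.measurableSet hpt
  have h4 : ∫ x in Omega, ((((closedBall (0 : E3) 2).indicator (fun _ => 3 * K * M) x
        + ‖x‖ ^ 2 * p x * remDens a b c c₁ c₃ Q x)
        + φ x * (2 * potDens a b c L Q x)) + e x * ‖x‖ ^ 2 * w x)
      = (∫ x in Omega, (closedBall (0 : E3) 2).indicator (fun _ => 3 * K * M) x)
        + (∫ x in Omega, ‖x‖ ^ 2 * p x * remDens a b c c₁ c₃ Q x)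
        + (∫ x in Omega, φ x * (2 * potDens a b c L Q x))
        + ∫ x in Omega, e x * ‖x‖ ^ 2 * w x :=
    (integral_add ((i1.add i2).add i3) i4).trans (congrArg (· + _)
      ((integral_add (i1.add i2) i3).trans (congrArg (· + _) (integral_add i1 i2))))
  have h5 : ∫ x in Omega, (closedBall (0 : E3) 2).indicator (fun _ => 3 * K * M) x
      ≤ 3 * K * M * volume.real (closedBall (0 : E3) 2) := by
    have h6 : Integrable (fun x => (closedBall (0 : E3) 2).indicator (fun _ => 3 * K * M) x) :=
      (integrable_indicator_iff measurableSet_closedBall).2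
        (integrableOn_const (measure_closedBall_lt_top).ne)
    refine (setIntegral_le_integral h6 (Eventually.of_forall fun x =>
      indicator_nonneg (fun _ _ => by positivity) x)).trans_eq ?_
    rw [integral_indicator measurableSet_closedBall, setIntegral_const, smul_eq_mul, mul_comm]
  have h6 := hφ.integral_error_le
  have h7 := h3.trans_eq h4
  linarith

end LdGPert

/-! ### A Hardy inequality and the pointwise bound by the energy -/

/-- A regularized version of `‖x - x₀‖⁻²`. -/
def hardyWeight (x₀ : E3) (R : ℝ) (x : E3) : ℝ := (‖x - x₀‖ ^ 2 + R ^ 2)⁻¹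

/-- The vector field of the Hardy inequality. -/
def hardyField (x₀ : E3) (R : ℝ) (k : Fin 3) (x : E3) : ℝ :=
  ⟪eb k, x - x₀⟫ * hardyWeight x₀ R x

section Hardy

variable {x₀ : E3} {R : ℝ}

lemma hardyWeight_pos (hR : 0 < R) (x : E3) : 0 < hardyWeight x₀ R x := by
  unfold hardyWeight; positivity

lemma contDiff_hardyWeight (hR : 0 < R) : ContDiff ℝ 1 (hardyWeight x₀ R) := by
  refine ContDiff.inv ?_ fun x => by positivity
  exact ((contDiff_id.sub contDiff_const).norm_sq ℝ).add contDiff_const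

lemma contDiff_hardyField (hR : 0 < R) (k : Fin 3) : ContDiff ℝ 1 (hardyField x₀ R k) :=
  ((innerSL ℝ (eb k)).contDiff.comp (contDiff_id.sub contDiff_const)).mul (contDiff_hardyWeight hR)

lemma sum_sq_hardyField (x₀ : E3) (R : ℝ) (x : E3) :
    ∑ k, hardyField x₀ R k x ^ 2 = ‖x - x₀‖ ^ 2 * hardyWeight x₀ R x ^ 2 := by
  rw [← sum_sq_inner_eb, Finset.sum_mul]
  exact Finset.sum_congr rfl fun k _ => by rw [hardyField, mul_pow, real_inner_comm]

lemma normSq_mul_hardyWeight_le (hR : 0 < R) (x : E3) :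
    ‖x - x₀‖ ^ 2 * hardyWeight x₀ R x ≤ 1 := by
  rw [hardyWeight, ← div_eq_mul_inv, div_le_one (by positivity)]
  nlinarith

lemma norm_mul_hardyWeight_le (hR : 0 < R) (x : E3) :
    ‖x - x₀‖ * hardyWeight x₀ R x ≤ 1 / (2 * R) := by
  rw [hardyWeight, ← div_eq_mul_inv, div_le_div_iff₀ (by positivity) (by positivity)]
  nlinarith [sq_nonneg (‖x - x₀‖ - R)]

lemma abs_hardyField_le (hR : 0 < R) (k : Fin 3) (x : E3) :
    |hardyField x₀ R k x| ≤ 1 / (2 * R) := by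
  rw [hardyField, abs_mul, abs_of_pos (hardyWeight_pos hR x)]
  refine le_trans ?_ (norm_mul_hardyWeight_le (x₀ := x₀) hR x)
  gcongr
  · exact (hardyWeight_pos hR x).le
  · simpa [norm_eb] using abs_real_inner_le_norm (eb k) (x - x₀)

lemma sum_inner_mul_hardyField_le (hR : 0 < R) (x : E3) :
    ∑ k, ⟪eb k, x⟫ * hardyField x₀ R k x ≤ 1 + ‖x₀‖ / (2 * R) := by
  have h1 : ∑ k, ⟪eb k, x⟫ * hardyField x₀ R k x = ⟪x, x - x₀⟫ * hardyWeight x₀ R x := by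
    rw [← sum_inner_eb, Finset.sum_mul]
    refine Finset.sum_congr rfl fun k _ => ?_
    rw [hardyField, real_inner_comm (eb k) x, real_inner_comm (eb k) (x - x₀), mul_assoc]
  have h2 : ⟪x, x - x₀⟫ ≤ (‖x - x₀‖ + ‖x₀‖) * ‖x - x₀‖ := by
    refine (real_inner_le_norm _ _).trans ?_
    gcongr
    simpa using norm_add_le (x - x₀) x₀
  have h3 := mul_le_mul_of_nonneg_right h2 (hardyWeight_pos (x₀ := x₀) hR x).le
  have h4 := normSq_mul_hardyWeight_le (x₀ := x₀) hR x
  have h5 := mul_le_mul_of_nonneg_left (norm_mul_hardyWeight_le (x₀ := x₀) hR x) (norm_nonneg x₀)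
  rw [h1]
  calc _ ≤ _ := h3
    _ = ‖x - x₀‖ ^ 2 * hardyWeight x₀ R x + ‖x₀‖ * (‖x - x₀‖ * hardyWeight x₀ R x) := by ring
    _ ≤ 1 + ‖x₀‖ * (1 / (2 * R)) := add_le_add h4 h5
    _ = _ := by ring

lemma hardyWeight_le_sum_fderiv (hR : 0 < R) (x : E3) :
    hardyWeight x₀ R x ≤ ∑ k, fderiv ℝ (hardyField x₀ R k) x (eb k) := by
  have hn : HasFDerivAt (fun y : E3 => ‖y - x₀‖ ^ 2 + R ^ 2) (2 • innerSL ℝ (x - x₀)) x := by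
    have := (((hasFDerivAt_id x).sub_const x₀).norm_sq).add_const (R ^ 2)
    simpa using this
  have hne : ‖x - x₀‖ ^ 2 + R ^ 2 ≠ 0 := by positivity
  have hw : HasFDerivAt (hardyWeight x₀ R)
      (-((‖x - x₀‖ ^ 2 + R ^ 2) ^ 2)⁻¹ • (2 • innerSL ℝ (x - x₀))) x :=
    (hasDerivAt_inv hne).comp_hasFDerivAt x hn
  have hl : ∀ k, HasFDerivAt (fun y : E3 => (⟪eb k, y - x₀⟫ : ℝ)) (innerSL ℝ (eb k)) x :=
      fun k => by
    have := (innerSL ℝ (eb k)).hasFDerivAt.comp x ((hasFDerivAt_id x).sub_const x₀)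
    rwa [ContinuousLinearMap.comp_id] at this
  have hk : ∀ k, fderiv ℝ (hardyField x₀ R k) x (eb k)
      = hardyWeight x₀ R x - 2 * (⟪x - x₀, eb k⟫ ^ 2 * hardyWeight x₀ R x ^ 2) := by
    intro k
    have h1 : fderiv ℝ (hardyField x₀ R k) x = _ := ((hl k).fun_mul hw).fderiv
    rw [h1]
    simp [hardyWeight, inner_sub_left, inner_sub_right, real_inner_comm x (eb k),
      real_inner_comm x₀ (eb k)]
    ring
  have h2 : ∑ k, ⟪x - x₀, eb k⟫ ^ 2 * hardyWeight x₀ R x ^ 2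
      = ‖x - x₀‖ ^ 2 * hardyWeight x₀ R x ^ 2 := by rw [← Finset.sum_mul, sum_sq_inner_eb]
  have h3 := mul_le_mul_of_nonneg_right (normSq_mul_hardyWeight_le (x₀ := x₀) hR x)
    (hardyWeight_pos (x₀ := x₀) hR x).le
  simp only [hk, Finset.sum_sub_distrib, ← Finset.mul_sum, h2, Finset.sum_const, Finset.card_univ,
    Fintype.card_fin, nsmul_eq_mul]
  push_cast
  linarith

/-- The Hardy inequality against a cutoff, pointwise form. -/
lemma sum_fderiv_sq_mul_hardyField_ge (hR : 0 < R) {u : E3 → ℝ} {x : E3}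
    (hu : DifferentiableAt ℝ u x) :
    u x ^ 2 * hardyWeight x₀ R x / 2 - 2 * gradNormSq u x
      ≤ ∑ k, fderiv ℝ (fun y => u y ^ 2 * hardyField x₀ R k y) x (eb k) := by
  have hk : ∀ k, fderiv ℝ (fun y => u y ^ 2 * hardyField x₀ R k y) x (eb k)
      = u x ^ 2 * fderiv ℝ (hardyField x₀ R k) x (eb k)
        + 2 * u x * (hardyField x₀ R k x * fderiv ℝ u x (eb k)) := by
    intro k
    have h1 : HasFDerivAt (fun y => u y ^ 2) _ x := hu.hasFDerivAt.pow 2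
    have h2 := ((contDiff_hardyField (x₀ := x₀) hR k).differentiable (by simp) x).hasFDerivAt
    rw [(h1.fun_mul h2).fderiv]
    simp
    ring
  simp only [hk, Finset.sum_add_distrib, ← Finset.mul_sum]
  have h1 := mul_le_mul_of_nonneg_left (hardyWeight_le_sum_fderiv (x₀ := x₀) hR x) (sq_nonneg (u x))
  have hq := hardyWeight_pos (x₀ := x₀) hR x
  have hCS : (∑ k, hardyField x₀ R k x * fderiv ℝ u x (eb k)) ^ 2
      ≤ hardyWeight x₀ R x * gradNormSq u x := by
    refine (Finset.sum_mul_sq_le_sq_mul_sq _ _ _).trans ?_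
    rw [sum_sq_hardyField]
    refine mul_le_mul_of_nonneg_right ?_ (gradNormSq_nonneg u x)
    calc _ = ‖x - x₀‖ ^ 2 * hardyWeight x₀ R x * hardyWeight x₀ R x := by ring
      _ ≤ 1 * hardyWeight x₀ R x := by
        gcongr
        exact normSq_mul_hardyWeight_le hR x
      _ = _ := one_mul _
  set P := ∑ k, hardyField x₀ R k x * fderiv ℝ u x (eb k)
  set q := hardyWeight x₀ R x
  have h3 : 0 ≤ u x ^ 2 * q / 2 + 2 * u x * P + 2 * gradNormSq u x := by
    have h4 : 0 ≤ q * (u x ^ 2 * q / 2 + 2 * u x * P + 2 * gradNormSq u x) := by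
      nlinarith [sq_nonneg (u x * q + 2 * P)]
    exact nonneg_of_mul_nonneg_right h4 hq
  linarith

end Hardy

namespace LdGPert

variable {a b c L κ c₁ c₃ : ℝ} {Q : E3 → Mat3}

lemma sq_le_pertSq (i j : Fin 3) (x : E3) :
    pertEntry a b c c₁ c₃ Q i j x ^ 2 ≤ pertSq a b c c₁ c₃ Q x :=
  (Finset.single_le_sum (f := fun j => pertEntry a b c c₁ c₃ Q i j x ^ 2)
    (fun _ _ => sq_nonneg _) (Finset.mem_univ j)).trans
    (Finset.single_le_sum (f := fun i => ∑ j, pertEntry a b c c₁ c₃ Q i j x ^ 2)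
      (fun _ _ => Finset.sum_nonneg fun _ _ => sq_nonneg _) (Finset.mem_univ i))

lemma gradNormSq_le_gradDens (i j : Fin 3) (x : E3) :
    gradNormSq (pertEntry a b c c₁ c₃ Q i j) x ≤ gradDens a b c c₁ c₃ Q x :=
  (Finset.single_le_sum (f := fun j => gradNormSq (pertEntry a b c c₁ c₃ Q i j) x)
    (fun _ _ => gradNormSq_nonneg _ _) (Finset.mem_univ j)).trans
    (Finset.single_le_sum (f := fun i => ∑ j, gradNormSq (pertEntry a b c c₁ c₃ Q i j) x)
      (fun _ _ => Finset.sum_nonneg fun _ _ => gradNormSq_nonneg _ _) (Finset.mem_univ i))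

lemma pertSq_div_le_remDens (a b c c₁ c₃ : ℝ) (Q : E3 → Mat3) (x : E3) :
    pertSq a b c c₁ c₃ Q x / ‖x‖ ^ 2 ≤ remDens a b c c₁ c₃ Q x := by
  have h0 : 0 ≤ gradDens a b c c₁ c₃ Q x :=
    Finset.sum_nonneg fun i _ => Finset.sum_nonneg fun j _ => gradNormSq_nonneg _ _
  have h1 : 0 ≤ 1600 * sstar a b c ^ 2 / ‖x‖ ^ 4 := by positivity
  unfold remDens
  linarith

/-- The Hardy inequality for an entry of the perturbation. -/
lemma hardy_le (h : LdGPert a b c L κ c₁ c₃ Q) {K δ S R : ℝ} {w φ p e : E3 → ℝ} (x₀ : E3)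
    (hK : 0 ≤ K) (hφ : FarCutoff K δ w φ p e) (hR : 0 < R) (i j : Fin 3)
    (hS : ∀ x ∈ Omega, |pertEntry a b c c₁ c₃ Q i j x| ≤ S) :
    ∫ x in Omega, φ x * (pertEntry a b c c₁ c₃ Q i j x ^ 2 * hardyWeight x₀ R x)
      ≤ 8 * (∫ x in Omega, φ x * (gradDens a b c c₁ c₃ Q x / 2 + potDens a b c L Q x))
        + 3 * K * (S ^ 2 / R) * volume.real (closedBall (0 : E3) 2)
        + (2 + ‖x₀‖ / R) * ∫ x in Omega, ‖x‖ ^ 2 * p x * remDens a b c c₁ c₃ Q x := by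
  set u := pertEntry a b c c₁ c₃ Q i j
  have hu2 : ContDiffOn ℝ 1 u Omega := ((h.smooth i j).of_le (by norm_num)).mono Omega_subset
  have hV : ∀ k, ContDiffOn ℝ 1 (fun y => u y ^ 2 * hardyField x₀ R k y) Omega := fun k =>
    (hu2.pow 2).mul (contDiff_hardyField hR k).contDiffOn
  have hgc := h.continuousOn_gradDens
  have hpc := h.contDiffOn_potDens.continuousOn
  have i1 : IntegrableOn (fun x => φ x * (u x ^ 2 * hardyWeight x₀ R x)) Omega :=
    (hφ.integrable_mul ((hu2.continuousOn.pow 2).mul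
      (contDiff_hardyWeight hR).continuous.continuousOn)).integrableOn
  have i2 : IntegrableOn (fun x => φ x * (gradDens a b c c₁ c₃ Q x / 2 + potDens a b c L Q x))
      Omega := (hφ.integrable_mul ((hgc.div_const 2).add hpc)).integrableOn
  have i3 : IntegrableOn (fun x => (closedBall (0 : E3) 2).indicator
      (fun _ => 3 * K * (S ^ 2 / R)) x) Omega :=
    ((integrable_indicator_iff measurableSet_closedBall).2
      (integrableOn_const (measure_closedBall_lt_top).ne)).integrableOn
  have i4 := (hφ.integrableOn_slope_mul h.integrableOn_remDens).const_mul (2 + ‖x₀‖ / R)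
  have i5 : IntegrableOn (fun x => ∑ k, fderiv ℝ φ x (eb k) * (u x ^ 2 * hardyField x₀ R k x))
      Omega := integrable_finsetSum _ fun k _ => (hφ.integrable_fderiv_mul (eb k)
        (hV k).continuousOn).integrableOn
  have i6 : IntegrableOn (fun x => φ x * ∑ k, fderiv ℝ (fun y => u y ^ 2 * hardyField x₀ R k y) x
      (eb k)) Omega := (hφ.integrable_mul (continuousOn_finsetSum _ fun k _ =>
        ((hV k).continuousOn_fderiv_of_isOpen isOpen_Omega le_rfl).clm_apply
          continuousOn_const)).integrableOn
  have hpt1 : ∀ x ∈ Omega, φ x * (u x ^ 2 * hardyWeight x₀ R x)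
      ≤ 2 * (φ x * ∑ k, fderiv ℝ (fun y => u y ^ 2 * hardyField x₀ R k y) x (eb k))
        + 8 * (φ x * (gradDens a b c c₁ c₃ Q x / 2 + potDens a b c L Q x)) := by
    intro x hx
    have h1 := sum_fderiv_sq_mul_hardyField_ge (x₀ := x₀) hR
      ((hu2.differentiableOn (by simp)).differentiableAt (Omega_mem_nhds hx))
    have h2 := gradNormSq_le_gradDens (a := a) (b := b) (c := c) (c₁ := c₁) (c₃ := c₃) (Q := Q)
      i j x
    have h3 := h.potDens_nonneg (Omega_subset hx)
    have h4 := mul_le_mul_of_nonneg_left (a := φ x)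
      (show u x ^ 2 * hardyWeight x₀ R x
        ≤ 2 * (∑ k, fderiv ℝ (fun y => u y ^ 2 * hardyField x₀ R k y) x (eb k))
        + 8 * (gradDens a b c c₁ c₃ Q x / 2 + potDens a b c L Q x) by linarith) (hφ.nonneg x)
    linarith
  have hpt2 : ∀ x ∈ Omega, -(2 * ∑ k, fderiv ℝ φ x (eb k) * (u x ^ 2 * hardyField x₀ R k x))
      ≤ (closedBall (0 : E3) 2).indicator (fun _ => 3 * K * (S ^ 2 / R)) x
        + (2 + ‖x₀‖ / R) * (‖x‖ ^ 2 * p x * remDens a b c c₁ c₃ Q x) := by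
    intro x hx
    have hx1 : 1 < ‖x‖ := hx
    have hu : u x ^ 2 ≤ S ^ 2 := sq_le_sq' (abs_le.1 (hS x hx)).1 (abs_le.1 (hS x hx)).2
    have h1 := hφ.sum_fderiv_mul_le hK (V := fun k => -(2 * (u x ^ 2 * hardyField x₀ R k x)))
      (M := S ^ 2 / R) (x := x) fun _ k => by
        rw [abs_neg, abs_mul, abs_mul, abs_of_nonneg (sq_nonneg (u x)), abs_two]
        have := mul_le_mul hu (abs_hardyField_le (x₀ := x₀) hR k x) (abs_nonneg _) (sq_nonneg S)
        calc _ ≤ 2 * (S ^ 2 * (1 / (2 * R))) := by linarith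
          _ = _ := by field_simp
    have h2 : ∑ k, fderiv ℝ φ x (eb k) * -(2 * (u x ^ 2 * hardyField x₀ R k x))
        = -(2 * ∑ k, fderiv ℝ φ x (eb k) * (u x ^ 2 * hardyField x₀ R k x)) := by
      rw [Finset.mul_sum, ← Finset.sum_neg_distrib]
      exact Finset.sum_congr rfl fun k _ => by ring
    have h3 : ∑ k, ⟪eb k, x⟫ * -(2 * (u x ^ 2 * hardyField x₀ R k x))
        = -(2 * u x ^ 2 * ∑ k, ⟪eb k, x⟫ * hardyField x₀ R k x) := by
      rw [Finset.mul_sum, ← Finset.sum_neg_distrib]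
      exact Finset.sum_congr rfl fun k _ => by ring
    have h4 : u x ^ 2 ≤ ‖x‖ ^ 2 * remDens a b c c₁ c₃ Q x := by
      have h5 := (sq_le_pertSq i j x).trans_eq
        (show pertSq a b c c₁ c₃ Q x = ‖x‖ ^ 2 * (pertSq a b c c₁ c₃ Q x / ‖x‖ ^ 2) by field_simp)
      exact h5.trans (mul_le_mul_of_nonneg_left (pertSq_div_le_remDens a b c c₁ c₃ Q x)
        (by positivity))
    have h5 : p x * (2 * u x ^ 2 * ∑ k, ⟪eb k, x⟫ * hardyField x₀ R k x)
        ≤ p x * (2 * (‖x‖ ^ 2 * remDens a b c c₁ c₃ Q x) * (1 + ‖x₀‖ / (2 * R))) := by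
      refine mul_le_mul_of_nonneg_left ?_ (hφ.slope_nonneg x)
      calc _ ≤ 2 * u x ^ 2 * (1 + ‖x₀‖ / (2 * R)) := by
            gcongr
            exact sum_inner_mul_hardyField_le hR x
        _ ≤ _ := by gcongr
    rw [h2, h3] at h1
    have h6 : p x * (2 * (‖x‖ ^ 2 * remDens a b c c₁ c₃ Q x) * (1 + ‖x₀‖ / (2 * R)))
        = (2 + ‖x₀‖ / R) * (‖x‖ ^ 2 * p x * remDens a b c c₁ c₃ Q x) := by
      field_simp
    linarith
  have h1 := hφ.setIntegral_mul_div hV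
  have h2 := setIntegral_mono_on i1 ((i6.const_mul 2).add (i2.const_mul 8))
    isOpen_Omega.measurableSet hpt1
  have h3 := setIntegral_mono_on (i5.const_mul 2).neg (i3.add i4) isOpen_Omega.measurableSet hpt2
  have h4 := h2.trans_eq (integral_add (i6.const_mul 2) (i2.const_mul 8))
  have h5 := h3.trans_eq (integral_add i3 i4)
  have h6 : ∫ x in Omega, (closedBall (0 : E3) 2).indicator (fun _ => 3 * K * (S ^ 2 / R)) x
      ≤ 3 * K * (S ^ 2 / R) * volume.real (closedBall (0 : E3) 2) := by
    have h7 : Integrable (fun x => (closedBall (0 : E3) 2).indicator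
        (fun _ => 3 * K * (S ^ 2 / R)) x) :=
      (integrable_indicator_iff measurableSet_closedBall).2
        (integrableOn_const (measure_closedBall_lt_top).ne)
    refine (setIntegral_le_integral h7 (Eventually.of_forall fun x =>
      indicator_nonneg (fun _ _ => by positivity) x)).trans_eq ?_
    rw [integral_indicator measurableSet_closedBall, setIntegral_const, smul_eq_mul, mul_comm]
  rw [integral_const_mul, integral_const_mul] at h4
  simp only [Pi.neg_apply] at h5
  rw [integral_neg, integral_const_mul, integral_const_mul] at h5
  linarith

lemma mnormSq_sub_Qinf_le (h : LdGPert a b c L κ c₁ c₃ Q) {η : ℝ} {x : E3} (hx : x ∈ OmegaBar)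
    (hη : ∀ i j, |pertEntry a b c c₁ c₃ Q i j x| ≤ η) :
    mnormSq (Q x - Qinf a b c) ≤ 9 * (η + 3 * sstar a b c) ^ 2 := by
  refine ((h.mem.1 x hx).sub isS0_Qinf).mnormSq_le fun i j => ?_
  have h1 := h.abs_Q_sub_Qinf_le i j hx
  have h2 : 3 * sstar a b c * ‖x‖⁻¹ ≤ 3 * sstar a b c :=
    mul_le_of_le_one_right (by linarith [h.sstar_pos']) (norm_inv_le_one hx)
  rw [Matrix.sub_apply]
  linarith [hη i j]

/-- The Pohozaev field near the unit ball is controlled by `C¹` bounds on the perturbation. -/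
lemma abs_pohoField_le (h : LdGPert a b c L κ c₁ c₃ Q) {Cg η : ℝ} (hCg : 0 ≤ Cg)
    (hpot : ∀ x ∈ Omega, gpot a b c (Q x) - gpot a b c (Qinf a b c)
      ≤ Cg * mnormSq (Q x - Qinf a b c)) {x : E3} (hx : x ∈ Omega) (hx2 : ‖x‖ ≤ 2)
    (hη : ∀ i j, |pertEntry a b c c₁ c₃ Q i j x| ≤ η)
    (hdη : ∀ i j n, ‖n‖ = 1 → |fderiv ℝ (pertEntry a b c c₁ c₃ Q i j) x n| ≤ η) (k : Fin 3) :
    |pohoField a b c L c₁ c₃ Q k x|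
      ≤ 9 * (η * (5 * η + 32 * sstar a b c)) + 18 * (Cg / L) * (η + 3 * sstar a b c) ^ 2 := by
  have hx1 : 1 < ‖x‖ := hx
  have hs := h.sstar_pos'
  have hη0 : 0 ≤ η := (abs_nonneg _).trans (hη 0 0)
  set s := sstar a b c
  have hinv := norm_inv_le_one (Omega_subset hx)
  have hin : |⟪eb k, x⟫| ≤ 2 := by
    have := abs_real_inner_le_norm (eb k) x
    rw [norm_eb, one_mul] at this
    exact this.trans hx2
  have h1 : ∀ i j, |pohoVec (pertEntry a b c c₁ c₃ Q i j) (dilEntry a b c c₁ c₃ i j) k x|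
      ≤ η * (5 * η + 32 * s) := by
    intro i j
    have e1 := hdη i j (eb k) (norm_eb k)
    have e2 : |fderiv ℝ (pertEntry a b c c₁ c₃ Q i j) x x| ≤ 2 * η := by
      have := hdη i j (‖x‖⁻¹ • x) (by rw [norm_smul, norm_inv, norm_norm]; field_simp)
      rw [map_smul, smul_eq_mul, abs_mul, abs_of_pos (by positivity), inv_mul_le_iff₀
        (by positivity)] at this
      exact this.trans (mul_le_mul_of_nonneg_right hx2 hη0)
    have e3 : |dilEntry a b c c₁ c₃ i j x| ≤ 7 * s :=
      (h.abs_dilEntry_le i j (Omega_subset hx)).trans (mul_le_of_le_one_right (by positivity) hinv)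
    have e4 : |fderiv ℝ (dilEntry a b c c₁ c₃ i j) x (eb k)| ≤ 25 * s := by
      refine (h.abs_fderiv_dilEntry_le i j (Omega_subset hx) (eb k)).trans ?_
      rw [norm_eb, mul_one]
      exact mul_le_of_le_one_right (by positivity) (pow_le_one₀ (by positivity) hinv)
    have e5 : gradNormSq (pertEntry a b c c₁ c₃ Q i j) x ≤ 3 * η ^ 2 := by
      refine (Finset.sum_le_sum fun l _ => sq_le_sq' (abs_le.1 (hdη i j (eb l) (norm_eb l))).1
        (abs_le.1 (hdη i j (eb l) (norm_eb l))).2).trans_eq ?_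
      simp
    have e6 := gradNormSq_nonneg (pertEntry a b c c₁ c₃ Q i j) x
    have t1 : |fderiv ℝ (pertEntry a b c c₁ c₃ Q i j) x (eb k)
        * (fderiv ℝ (pertEntry a b c c₁ c₃ Q i j) x x + dilEntry a b c c₁ c₃ i j x)|
        ≤ η * (2 * η + 7 * s) := by
      rw [abs_mul]
      exact mul_le_mul e1 ((abs_add_le _ _).trans (add_le_add e2 e3)) (abs_nonneg _) hη0
    have t2 : |⟪eb k, x⟫ * (gradNormSq (pertEntry a b c c₁ c₃ Q i j) x / 2)|
        ≤ 2 * (3 * η ^ 2 / 2) := by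
      rw [abs_mul, abs_of_nonneg (by positivity : 0 ≤
        gradNormSq (pertEntry a b c c₁ c₃ Q i j) x / 2)]
      exact mul_le_mul hin (by linarith) (by positivity) (by norm_num)
    have t3 : |pertEntry a b c c₁ c₃ Q i j x * fderiv ℝ (dilEntry a b c c₁ c₃ i j) x (eb k)|
        ≤ η * (25 * s) := by
      rw [abs_mul]
      exact mul_le_mul (hη i j) e4 (abs_nonneg _) hη0
    rw [pohoVec]
    refine (abs_sub _ _).trans ?_
    have := abs_sub (fderiv ℝ (pertEntry a b c c₁ c₃ Q i j) x (eb k)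
        * (fderiv ℝ (pertEntry a b c c₁ c₃ Q i j) x x + dilEntry a b c c₁ c₃ i j x))
      (⟪eb k, x⟫ * (gradNormSq (pertEntry a b c c₁ c₃ Q i j) x / 2))
    nlinarith
  have h2 : |∑ i, ∑ j, pohoVec (pertEntry a b c c₁ c₃ Q i j) (dilEntry a b c c₁ c₃ i j) k x|
      ≤ 9 * (η * (5 * η + 32 * s)) := by
    refine (Finset.abs_sum_le_sum_abs _ _).trans ((Finset.sum_le_sum fun i _ =>
      (Finset.abs_sum_le_sum_abs _ _).trans (Finset.sum_le_sum fun j _ => h1 i j)).trans_eq ?_)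
    simp
    ring
  have h3 : |⟪eb k, x⟫ * potDens a b c L Q x| ≤ 18 * (Cg / L) * (η + 3 * s) ^ 2 := by
    have e1 : potDens a b c L Q x ≤ Cg / L * (9 * (η + 3 * s) ^ 2) := by
      refine (div_le_div_of_nonneg_right ((hpot x hx).trans (mul_le_mul_of_nonneg_left
        (h.mnormSq_sub_Qinf_le (Omega_subset hx) hη) hCg)) h.L_pos.le).trans_eq ?_
      ring
    rw [abs_mul, abs_of_nonneg (h.potDens_nonneg (Omega_subset hx))]
    have e2 := mul_le_mul hin e1 (h.potDens_nonneg (Omega_subset hx)) zero_le_two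
    linarith
  exact (abs_sub _ _).trans (add_le_add h2 h3)

end LdGPert

/-- A lower bound for an entry of the perturbation on a ball is controlled by the Pohozaev field
near the unit ball. -/
lemma exists_ball_bound : ∃ K, 0 ≤ K ∧ ∀ {a b c L κ c₁ c₃ : ℝ} {Q : E3 → Mat3},
    LdGPert a b c L κ c₁ c₃ Q → ∀ {Cg M S R ρ m : ℝ} {x₀ : E3} {i j : Fin 3},
    (∀ x ∈ Omega, gpot a b c (Q x) - gpot a b c (Qinf a b c) ≤ Cg * mnormSq (Q x - Qinf a b c)) →
    (∀ x ∈ Omega, ‖x‖ ≤ 2 → ∀ k, |pohoField a b c L c₁ c₃ Q k x| ≤ M) →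
    (∀ x ∈ Omega, |pertEntry a b c c₁ c₃ Q i j x| ≤ S) → 0 < R → 0 < ρ → 0 ≤ m →
    (∀ x ∈ closedBall x₀ ρ, 2 ≤ ‖x‖ ∧ m ≤ |pertEntry a b c c₁ c₃ Q i j x|) →
    ρ ^ 3 * m ^ 2 ≤ K * (ρ ^ 2 + R ^ 2) * (M + S ^ 2 / R) := by
  obtain ⟨K, hK, hcut⟩ := exists_farCutoff
  have hv1 : 0 < volume.real (ball (0 : E3) 1) :=
    ENNReal.toReal_pos (measure_ball_pos _ _ one_pos).ne' measure_ball_lt_top.ne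
  set v := volume.real (closedBall (0 : E3) 2)
  refine ⟨48 * K * v / volume.real (ball (0 : E3) 1), by positivity, ?_⟩
  intro a b c L κ c₁ c₃ Q h Cg M S R ρ m x₀ i j hpot hV hS hR hρ hm hball
  choose φ p e hφ using fun n : ℕ => hcut
    (fun x => Cg / L * (mnormSq (Q x - Qinf a b c) / ‖x‖ ^ 2)) (h.mem.2.2.const_mul _)
    (1 / ((n : ℝ) + 1)) Nat.one_div_pos_of_nat
  set u := pertEntry a b c c₁ c₃ Q i j
  set J : ℕ → ℝ := fun n => ∫ x in Omega, ‖x‖ ^ 2 * p n x * remDens a b c c₁ c₃ Q x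
  have hJ : Tendsto J atTop (𝓝 0) := FarCutoff.tendsto_integral_slope hφ h.integrableOn_remDens
  have hδ := tendsto_one_div_add_atTop_nhds_zero_nat (𝕜 := ℝ)
  have hsub : closedBall x₀ ρ ⊆ Omega := fun x hx => by
    rw [mem_Omega]; linarith [(hball x hx).1]
  have hvol : volume.real (closedBall x₀ ρ) = ρ ^ 3 * volume.real (ball (0 : E3) 1) := by
    simpa using Measure.addHaar_real_closedBall (volume : Measure E3) x₀ hρ.le
  have hlow : ∀ᶠ n in atTop, ρ ^ 3 * volume.real (ball (0 : E3) 1)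
      * (1 / 2 * (m ^ 2 * (ρ ^ 2 + R ^ 2)⁻¹))
      ≤ 8 * (3 * K * M * v + J n + 1 / ((n : ℝ) + 1)) + 3 * K * (S ^ 2 / R) * v
        + (2 + ‖x₀‖ / R) * J n := by
    have hsmall : ∀ᶠ n : ℕ in atTop, 1 / ((n : ℝ) + 1) * ((‖x₀‖ + ρ) ^ 2 + 2) ≤ 1 / 2 := by
      have := hδ.mul_const ((‖x₀‖ + ρ) ^ 2 + 2)
      rw [zero_mul] at this
      exact this.eventually (eventually_le_nhds (by norm_num))
    filter_upwards [hsmall] with n hn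
    have h1 := h.hardy_le x₀ hK (hφ n) hR i j hS
    have h2 := h.energy_le hpot hK (hφ n) hV
    have hu2 : ContinuousOn u Omega := (h.smooth i j).continuousOn.mono Omega_subset
    have i1 : IntegrableOn (fun x => φ n x * (u x ^ 2 * hardyWeight x₀ R x)) Omega :=
      ((hφ n).integrable_mul ((hu2.pow 2).mul
        (contDiff_hardyWeight hR).continuous.continuousOn)).integrableOn
    have h3 : ρ ^ 3 * volume.real (ball (0 : E3) 1) * (1 / 2 * (m ^ 2 * (ρ ^ 2 + R ^ 2)⁻¹))
        ≤ ∫ x in Omega, φ n x * (u x ^ 2 * hardyWeight x₀ R x) := by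
      have h4 : ∫ x in closedBall x₀ ρ, φ n x * (u x ^ 2 * hardyWeight x₀ R x)
          ≤ ∫ x in Omega, φ n x * (u x ^ 2 * hardyWeight x₀ R x) :=
        setIntegral_mono_set i1 (Eventually.of_forall fun x => mul_nonneg ((hφ n).nonneg x)
          (mul_nonneg (sq_nonneg _) (hardyWeight_pos hR x).le)) hsub.eventuallyLE
      refine le_trans ?_ h4
      rw [← hvol]
      have h5 := setIntegral_mono_on (μ := volume) (s := closedBall x₀ ρ)
        (f := fun _ => 1 / 2 * (m ^ 2 * (ρ ^ 2 + R ^ 2)⁻¹))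
        (g := fun x => φ n x * (u x ^ 2 * hardyWeight x₀ R x))
        (integrableOn_const measure_closedBall_lt_top.ne) (i1.mono_set hsub)
        measurableSet_closedBall fun x hx => ?_
      · rwa [setIntegral_const, smul_eq_mul] at h5
      · have hxρ : ‖x - x₀‖ ≤ ρ := by simpa [dist_eq_norm] using hx
        have hx0 : ‖x‖ ≤ ‖x₀‖ + ρ := by
          have := norm_add_le (x - x₀) x₀
          rw [sub_add_cancel] at this
          linarith
        have e1 : 1 / 2 ≤ φ n x := by
          refine le_trans ?_ ((hφ n).le_self x (hball x hx).1)
          have e2 : ‖x‖ ^ 2 ≤ (‖x₀‖ + ρ) ^ 2 := by gcongr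
          have e3 := mul_le_mul_of_nonneg_left e2 (Nat.one_div_pos_of_nat (α := ℝ) (n := n)).le
          linarith
        have e4 : m ^ 2 ≤ u x ^ 2 := by
          rw [← sq_abs (u x)]
          exact pow_le_pow_left₀ hm (hball x hx).2 2
        have e5 : (ρ ^ 2 + R ^ 2)⁻¹ ≤ hardyWeight x₀ R x := by
          unfold hardyWeight
          gcongr
        exact mul_le_mul e1 (mul_le_mul e4 e5 (by positivity) (sq_nonneg _)) (by positivity)
          ((hφ n).nonneg x)
    linarith
  have hlim : Tendsto (fun n : ℕ => 8 * (3 * K * M * v + J n + 1 / ((n : ℝ) + 1))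
      + 3 * K * (S ^ 2 / R) * v + (2 + ‖x₀‖ / R) * J n) atTop
      (𝓝 (8 * (3 * K * M * v + 0 + 0) + 3 * K * (S ^ 2 / R) * v + (2 + ‖x₀‖ / R) * 0)) :=
    ((((hJ.const_add _).add hδ).const_mul 8).add_const _).add (hJ.const_mul _)
  have h1 := ge_of_tendsto hlim hlow
  have h2 : 0 ≤ K * v * (S ^ 2 / R) := by positivity
  have h3 : ρ ^ 3 * volume.real (ball (0 : E3) 1) * (1 / 2 * (m ^ 2 * (ρ ^ 2 + R ^ 2)⁻¹))
      ≤ 24 * K * v * (M + S ^ 2 / R) := by linarith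
  have hq : 0 < ρ ^ 2 + R ^ 2 := by positivity
  have h4 : ρ ^ 3 * m ^ 2 = 2 * (ρ ^ 2 + R ^ 2) / volume.real (ball (0 : E3) 1)
      * (ρ ^ 3 * volume.real (ball (0 : E3) 1) * (1 / 2 * (m ^ 2 * (ρ ^ 2 + R ^ 2)⁻¹))) := by
    field_simp
  rw [h4]
  refine (mul_le_mul_of_nonneg_left h3 (by positivity)).trans_eq ?_
  ring

/-! ### The supremum bound at the coherence length -/

/-- A solution at coherence length `R`, with constants controlling the nonlinearity. -/
structure LdGScaled (a b c L κ c₁ c₃ B Cf Cg R : ℝ) (Q : E3 → Mat3) : Prop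
    extends LdGPert a b c L κ c₁ c₃ Q where
  Cf_pos : 0 < Cf
  Cg_nonneg : 0 ≤ Cg
  R_pos : 0 < R
  L_eq : L = Cf * R ^ 2
  sstar_le : sstar a b c ≤ B
  entry_le : ∀ x ∈ OmegaBar, ∀ i j, |Q x i j| ≤ B
  lipschitz : ∀ P Q : Mat3, (∀ i j, |P i j| ≤ B) → (∀ i j, |Q i j| ≤ B) → ∀ d,
    (∀ i j, |P i j - Q i j| ≤ d) → ∀ i j, |gradf a b c P i j - gradf a b c Q i j| ≤ Cf * d
  gpot_le : ∀ x ∈ Omega,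
    gpot a b c (Q x) - gpot a b c (Qinf a b c) ≤ Cg * mnormSq (Q x - Qinf a b c)

/-- A radial barrier for functions with a Robin condition on the unit sphere. -/
lemma le_radial_barrier {u : E3 → ℝ} {κ R μ α β : ℝ} (hu : ContDiffOn ℝ 2 u OmegaBar)
    (hκ : 0 ≤ κ) (hrobin : ∀ x, ‖x‖ = 1 → κ * rad u x = u x) (hμ : 0 ≤ μ) (hα : 0 ≤ α)
    (hβ : 0 ≤ β) (hR : ∀ x ∈ OmegaBar, ‖x‖ = R → u x ≤ μ)
    (hl : ∀ x ∈ Omega, -(6 * α + 2 * β * ‖x‖⁻¹) < lapl u x) {x : E3} (hx : x ∈ OmegaBar)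
    (hxR : ‖x‖ ≤ R) :
    u x ≤ μ + α * (R ^ 2 - ‖x‖ ^ 2) + β * (R - ‖x‖) := by
  set w : E3 → ℝ := fun x => u x - (μ + α * (R ^ 2 - ‖x‖ ^ 2) + β * (R - ‖x‖)) with hw
  set K : Set E3 := {x | 1 ≤ ‖x‖ ∧ ‖x‖ ≤ R} with hK
  have hKsub : K ⊆ OmegaBar := fun x hx => hx.1
  suffices key : ∀ y ∈ K, w y ≤ 0 by
    have := key x ⟨hx, hxR⟩
    simp only [hw] at this
    linarith
  refine forall_nonpos_of_max (isCompact_annulus _ _) ?_ fun y hy hmax => ?_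
  · have := hu.continuousOn.mono hKsub
    fun_prop
  by_contra! hpos
  rcases hy.2.eq_or_lt with h2 | h2
  · have := hR y hy.1 h2
    simp only [hw, h2] at hpos
    linarith
  rcases hy.1.eq_or_lt with h1 | h1
  · have hr : rad u y ≤ -(2 * α + β) := by
      have hp : HasDerivAt (fun s : ℝ => μ + α * (R ^ 2 - s ^ 2) + β * (R - s))
          (-(2 * α + β)) 1 := by
        refine ((((((hasDerivAt_id (1 : ℝ)).fun_pow 2).const_sub (R ^ 2)).const_mul α).const_add
          μ).fun_add (((hasDerivAt_id (1 : ℝ)).const_sub R).const_mul β)).congr_deriv ?_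
        simp
        ring
      refine rad_nonpos_of_max hy.1 ((hu.differentiableOn (by simp)) y hy.1) hp ?_
      have : ∀ᶠ s in 𝓝[>] (1 : ℝ), s < R := nhdsWithin_le_nhds (gt_mem_nhds (by linarith))
      filter_upwards [this, self_mem_nhdsWithin] with s hs hs1
      have hs1' : (1 : ℝ) < s := hs1
      have hn : ‖s • y‖ = s := by
        rw [norm_smul, ← h1, mul_one, Real.norm_of_nonneg (by linarith)]
      have hle : w (s • y) ≤ w y := hmax (show s • y ∈ K from
        ⟨by rw [hn]; exact hs1'.le, by rw [hn]; exact hs.le⟩)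
      simp only [hw, hn, ← h1] at hle
      exact hle
    have e := hrobin y h1.symm
    have e1 := mul_nonneg hκ (by linarith : 0 ≤ -rad u y)
    have e2 : 0 ≤ α * (R ^ 2 - 1) := mul_nonneg hα (by nlinarith)
    have e3 : 0 ≤ β * (R - 1) := mul_nonneg hβ (by linarith)
    simp only [hw, ← h1] at hpos
    norm_num at hpos
    linarith
  · have hy0 : y ≠ 0 := ne_zero_of_mem hy.1
    have hn : HasJ (fun z => ‖z‖) y (‖y‖ ^ 2 • (-(‖y‖⁻¹ ^ 3) • y) + ‖y‖⁻¹ • ((2 : ℝ) • y))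
        (2 * ‖y‖⁻¹) := by
      refine (((HasJ.normSq y).mul (HasJ.norm_inv hy0)).congr_val rfl ?_).congr_fun ?_
      · have := norm_mul_norm_inv hy0
        simp only [inner_smul_left, inner_smul_right, real_inner_self_eq_norm_sq, conj_trivial]
        linear_combination (-4) * ‖y‖⁻¹ * (‖y‖ * ‖y‖⁻¹ + 1) * this
      · filter_upwards [isOpen_ne.mem_nhds hy0] with z hz
        have := norm_mul_norm_inv hz
        linear_combination (-‖z‖) * this
    have hJ := (hasJ_of_contDiffAt (contDiffAt_of_mem hu h1)).sub
      ((((HasJ.const μ).add (((HasJ.const (R ^ 2)).sub (HasJ.normSq y)).const_mul α))).add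
        (((HasJ.const R).sub hn).const_mul β))
    have hm := lapl_nonpos_of_isLocalMax hJ.1 (hmax.isLocalMax (annulus_mem_nhds h1 h2))
    rw [hJ.2.2] at hm
    have := hl y h1
    linarith

namespace LdGScaled

variable {a b c L κ c₁ c₃ B Cf Cg R : ℝ} {Q : E3 → Mat3}

lemma div_eq (h : LdGScaled a b c L κ c₁ c₃ B Cf Cg R Q) : Cf / L = 1 / R ^ 2 := by
  have h1 := h.Cf_pos
  have h2 := h.R_pos
  rw [h.L_eq]
  field_simp

lemma abs_gradf_div_le (h : LdGScaled a b c L κ c₁ c₃ B Cf Cg R Q) {x : E3} (hx : x ∈ Omega)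
    {m : ℝ} (hm : ∀ i j, |pertEntry a b c c₁ c₃ Q i j x| ≤ m) (i j : Fin 3) :
    |gradf a b c (Q x) i j / L| ≤ (m + 3 * sstar a b c * ‖x‖⁻¹) / R ^ 2 := by
  have h1 := h.lipschitz (Q x) (Qinf a b c) (h.entry_le x (Omega_subset hx))
    (fun k l => (abs_Qinf_le h.b_pos h.c_pos k l).trans h.sstar_le)
    (m + 3 * sstar a b c * ‖x‖⁻¹)
    (fun k l => (h.abs_Q_sub_Qinf_le k l (Omega_subset hx)).trans
      (add_le_add_left (hm k l) _)) i j
  rw [gradf_Qinf h.a_nonneg h.c_pos] at h1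
  have h2 : (m + 3 * sstar a b c * ‖x‖⁻¹) / R ^ 2
      = Cf * (m + 3 * sstar a b c * ‖x‖⁻¹) / L := by
    rw [mul_div_right_comm, h.div_eq]; ring
  rw [abs_div, abs_of_pos h.L_pos, h2]
  have h3 := h.L_pos
  gcongr
  simpa using h1

lemma abs_gradf_div_le' (h : LdGScaled a b c L κ c₁ c₃ B Cf Cg R Q) {x : E3} (hx : x ∈ Omega)
    {m : ℝ} (hm : ∀ i j, |pertEntry a b c c₁ c₃ Q i j x| ≤ m) (i j : Fin 3) :
    |gradf a b c (Q x) i j / L| ≤ (m + 3 * sstar a b c) / R ^ 2 := by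
  refine (h.abs_gradf_div_le hx hm i j).trans ?_
  have := h.sstar_pos'
  have h1 : 3 * sstar a b c * ‖x‖⁻¹ ≤ 3 * sstar a b c :=
    mul_le_of_le_one_right (by positivity) (norm_inv_le_one (Omega_subset hx))
  gcongr

/-- The gradient bound at scale `H`, in terms of a supremum bound. -/
lemma abs_fderiv_le (h : LdGScaled a b c L κ c₁ c₃ B Cf Cg R Q) {H S : ℝ} (hH : 0 < H)
    (hH1 : H ≤ 1 / 10) (hHR : H ≤ R / 2)
    (hS : ∀ x ∈ OmegaBar, ∀ i j, |pertEntry a b c c₁ c₃ Q i j x| ≤ S) (i j : Fin 3) {x n : E3}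
    (hx : x ∈ Omega) (hn : ‖n‖ = 1) :
    |fderiv ℝ (pertEntry a b c c₁ c₃ Q i j) x n|
      ≤ 60 * (S / H + (S + 3 * sstar a b c) / R ^ 2 * H)
        + 18 * sstar a b c * (H / R) ^ 2 := by
  have hR := h.R_pos
  have hs := h.sstar_pos'
  have hS0 : 0 ≤ S := (abs_nonneg _).trans (hS x (Omega_subset hx) 0 0)
  have h1 : (H / R) ^ 2 = H ^ 2 * (Cf / L) := by rw [h.div_eq]; field_simp
  have h2 : H / R ≤ 1 / 2 := by rw [div_le_iff₀ hR]; linarith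
  have h3 : 0 ≤ H / R := by positivity
  have := h.grad_le h.Cf_pos.le h.entry_le h.lipschitz hH hH1 (by rw [← h1]; nlinarith)
    (N := (S + 3 * sstar a b c) / R ^ 2) (by positivity) hS
    (fun y hy => h.abs_gradf_div_le' hy (hS y (Omega_subset hy))) i j hx hn
  rwa [h1]

/-- The barrier on the annulus between the unit sphere and the sphere of radius `R`. -/
lemma abs_le_of_sphere (h : LdGScaled a b c L κ c₁ c₃ B Cf Cg R Q) {S μ : ℝ} (hμ : 0 ≤ μ)
    (hS : ∀ x ∈ OmegaBar, ∀ i j, |pertEntry a b c c₁ c₃ Q i j x| ≤ S)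
    (hμR : ∀ x ∈ OmegaBar, ‖x‖ = R → ∀ i j, |pertEntry a b c c₁ c₃ Q i j x| ≤ μ) (i j : Fin 3)
    {x : E3} (hx : x ∈ OmegaBar) (hxR : ‖x‖ ≤ R) :
    |pertEntry a b c c₁ c₃ Q i j x| ≤ μ + S / 6 + 2 * sstar a b c / R := by
  have hR := h.R_pos
  have hs := h.sstar_pos'
  have hS0 : 0 ≤ S := (abs_nonneg _).trans (hS x hx i j)
  have hα : 0 ≤ S / (6 * R ^ 2) := by positivity
  have hβ : 0 ≤ 2 * sstar a b c / R ^ 2 := by positivity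
  have hl : ∀ y ∈ Omega, |lapl (pertEntry a b c c₁ c₃ Q i j) y|
      < 6 * (S / (6 * R ^ 2)) + 2 * (2 * sstar a b c / R ^ 2) * ‖y‖⁻¹ := fun y hy => by
    rw [h.lapl_eq_div i j hy]
    refine (h.abs_gradf_div_le hy (hS y (Omega_subset hy)) i j).trans_lt ?_
    have hy0 : 0 < ‖y‖⁻¹ := inv_pos.2 (norm_pos_iff.2 (ne_zero_of_mem (Omega_subset hy)))
    have : 6 * (S / (6 * R ^ 2)) + 2 * (2 * sstar a b c / R ^ 2) * ‖y‖⁻¹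
        - (S + 3 * sstar a b c * ‖y‖⁻¹) / R ^ 2 = sstar a b c * ‖y‖⁻¹ / R ^ 2 := by
      field_simp
      ring
    have : 0 < sstar a b c * ‖y‖⁻¹ / R ^ 2 := by positivity
    linarith
  have e1 := le_radial_barrier (h.smooth i j) h.kappa_nonneg (fun y hy => h.robin i j hy) hμ hα hβ
    (fun y hy hyR => (abs_le.1 (hμR y hy hyR i j)).2) (fun y hy => (abs_lt.1 (hl y hy)).1) hx hxR
  have e2 := le_radial_barrier (u := fun y => -pertEntry a b c c₁ c₃ Q i j y) (h.smooth i j).neg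
    h.kappa_nonneg (fun y hy => by rw [rad_neg hy.ge, mul_neg, h.robin i j hy]) hμ hα hβ
    (fun y hy hyR => neg_le.1 (abs_le.1 (hμR y hy hyR i j)).1) (fun y hy => by
      have hJ := (hasJ_of_contDiffAt (contDiffAt_of_mem (h.smooth i j) hy)).neg
      rw [hJ.2.2]
      exact neg_lt_neg (abs_lt.1 (hl y hy)).2) hx hxR
  have e3 : S / (6 * R ^ 2) * (R ^ 2 - ‖x‖ ^ 2) ≤ S / 6 :=
    (mul_le_mul_of_nonneg_left (sub_le_self _ (sq_nonneg _)) hα).trans_eq (by field_simp)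
  have e4 : 2 * sstar a b c / R ^ 2 * (R - ‖x‖) ≤ 2 * sstar a b c / R :=
    (mul_le_mul_of_nonneg_left (sub_le_self _ (norm_nonneg _)) hβ).trans_eq (by field_simp)
  exact abs_le.2 ⟨by linarith, by linarith⟩

end LdGScaled

/-- The supremum of a bounded family, together with a point where it is nearly attained. -/
lemma exists_sup_abs {A : Set E3} (hA : A.Nonempty) {F : Fin 3 → Fin 3 → E3 → ℝ} {S₀ : ℝ}
    (hF : ∀ x ∈ A, ∀ i j, |F i j x| ≤ S₀) :
    ∃ m, 0 ≤ m ∧ (∀ x ∈ A, ∀ i j, |F i j x| ≤ m) ∧ (∃ x ∈ A, ∃ i j, m ≤ 2 * |F i j x|) ∧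
      ∀ m', (∀ x ∈ A, ∀ i j, |F i j x| ≤ m') → m ≤ m' := by
  obtain ⟨x₁, hx₁⟩ := hA
  set T : Set ℝ := {t | ∃ x ∈ A, ∃ i j, t = |F i j x|} with hT
  have hne : T.Nonempty := ⟨_, x₁, hx₁, 0, 0, rfl⟩
  have hbdd : BddAbove T := ⟨S₀, by rintro t ⟨x, hx, i, j, rfl⟩; exact hF x hx i j⟩
  have hle : ∀ x ∈ A, ∀ i j, |F i j x| ≤ sSup T := fun x hx i j =>
    le_csSup hbdd ⟨x, hx, i, j, rfl⟩
  have h0 : 0 ≤ sSup T := (abs_nonneg _).trans (hle x₁ hx₁ 0 0)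
  refine ⟨sSup T, h0, hle, ?_, fun m' hm' => csSup_le hne ?_⟩
  · rcases h0.eq_or_lt with h0 | h0
    · exact ⟨x₁, hx₁, 0, 0, by rw [← h0]; positivity⟩
    · obtain ⟨t, ⟨x, hx, i, j, rfl⟩, ht⟩ := exists_lt_of_lt_csSup hne (half_lt_self h0)
      exact ⟨x, hx, i, j, by linarith⟩
  · rintro t ⟨x, hx, i, j, rfl⟩
    exact hm' x hx i j

namespace LdGScaled

variable {a b c L κ c₁ c₃ B Cf Cg R : ℝ} {Q : E3 → Mat3}

/-- Away from the unit ball, an entry of size `μ` stays of size `μ / 4` on a ball whose radius is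
a fixed multiple of the coherence length. -/
lemma le_abs_of_mem_closedBall (h : LdGScaled a b c L κ c₁ c₃ B Cf Cg R Q) (hR4 : 4 ≤ R) {μ : ℝ}
    (hμR : sstar a b c / R ≤ μ)
    (hS : ∀ x ∈ OmegaBar, ∀ i j, |pertEntry a b c c₁ c₃ Q i j x| ≤ 6 * μ) {i j : Fin 3} {x₀ : E3}
    (hx₀ : R ≤ ‖x₀‖) (hμ : μ ≤ 2 * |pertEntry a b c c₁ c₃ Q i j x₀|) {x : E3}
    (hx : x ∈ closedBall x₀ (R / 400)) :
    2 ≤ ‖x‖ ∧ μ / 4 ≤ |pertEntry a b c c₁ c₃ Q i j x| := by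
  have hR := h.R_pos
  have hs := h.sstar_pos'
  have hμ0 : 0 < μ := lt_of_lt_of_le (by positivity) hμR
  have hnorm : ∀ y, dist y x₀ ≤ R / 2 → R / 2 ≤ ‖y‖ := fun y hy => by
    have := norm_sub_norm_le x₀ y
    rw [dist_comm, dist_eq_norm] at hy
    linarith
  have hxd := mem_closedBall.1 hx
  refine ⟨by linarith [hnorm x (by linarith)], ?_⟩
  have hmem : ∀ y, dist y x₀ ≤ R / 2 → y ∈ Omega := fun y hy => by
    have := hnorm y hy
    exact mem_Omega.2 (by linarith)
  have hN : ∀ y, dist y x₀ ≤ R / 2 →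
      |lapl (pertEntry a b c c₁ c₃ Q i j) y| ≤ 12 * μ / R ^ 2 := fun y hy => by
    rw [h.lapl_eq_div i j (hmem y hy)]
    refine (h.abs_gradf_div_le (hmem y hy) (hS y (Omega_subset (hmem y hy))) i j).trans ?_
    have h1 : ‖y‖⁻¹ ≤ (R / 2)⁻¹ := inv_anti₀ (by positivity) (hnorm y hy)
    have h2 : 3 * sstar a b c * ‖y‖⁻¹ ≤ 3 * sstar a b c * (R / 2)⁻¹ := by gcongr
    have h3 : 3 * sstar a b c * (R / 2)⁻¹ = 6 * (sstar a b c / R) := by field_simp; ring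
    gcongr
    linarith
  have hgrad : ∀ y ∈ closedBall x₀ (R / 4), ‖fderiv ℝ (pertEntry a b c c₁ c₃ Q i j) y‖
      ≤ 80 * μ / R := fun y hy => by
    have hy' : ∀ z, ‖z - y‖ ≤ R / 4 → dist z x₀ ≤ R / 2 := fun z hz => by
      have := dist_triangle z y x₀
      rw [← dist_eq_norm] at hz
      linarith [mem_closedBall.1 hy]
    refine ContinuousLinearMap.opNorm_le_of_unit_norm (by positivity) fun n hn => ?_
    have := interior_grad (d := R / 4) (m := 6 * μ) (N := 12 * μ / R ^ 2) (by positivity)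
      (by positivity) (fun z hz => contDiffAt_of_mem (h.smooth i j) (hmem z (hy' z hz)))
      (fun z hz => hS z (Omega_subset (hmem z (hy' z hz))) i j)
      (fun z hz => hN z (hy' z hz)) hn
    refine this.trans ?_
    have h1 : 3 * (6 * μ) / (R / 4) + 12 * μ / R ^ 2 * (R / 4) = 75 * μ / R := by
      field_simp
      ring
    rw [h1]
    gcongr
    norm_num
  have hlip := (convex_closedBall x₀ (R / 4)).norm_image_sub_le_of_norm_fderiv_le (𝕜 := ℝ)
    (f := pertEntry a b c c₁ c₃ Q i j) (C := 80 * μ / R) (fun y hy =>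
      (contDiffAt_of_mem (h.smooth i j) (hmem y ((mem_closedBall.1 hy).trans
        (by linarith)))).differentiableAt (by simp)) hgrad
    (mem_closedBall_self (by positivity)) (closedBall_subset_closedBall (by linarith) hx)
  rw [← dist_eq_norm, ← dist_eq_norm] at hlip
  have h1 : 80 * μ / R * dist x x₀ ≤ μ / 5 := by
    refine (mul_le_mul_of_nonneg_left hxd (by positivity)).trans_eq ?_
    field_simp
    ring
  rw [Real.dist_eq] at hlip
  have := abs_sub_abs_le_abs_sub (pertEntry a b c c₁ c₃ Q i j x₀) (pertEntry a b c c₁ c₃ Q i j x)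
  rw [abs_sub_comm] at this
  linarith

lemma abs_fderiv_le_of_four_le (h : LdGScaled a b c L κ c₁ c₃ B Cf Cg R Q) (hR4 : 4 ≤ R) {S : ℝ}
    (hS : ∀ x ∈ OmegaBar, ∀ i j, |pertEntry a b c c₁ c₃ Q i j x| ≤ S) (i j : Fin 3) {x n : E3}
    (hx : x ∈ Omega) (hn : ‖n‖ = 1) :
    |fderiv ℝ (pertEntry a b c c₁ c₃ Q i j) x n| ≤ 606 * S + 19 * (sstar a b c / R) := by
  have hR := h.R_pos
  have hs := h.sstar_pos'
  have hS0 : 0 ≤ S := (abs_nonneg _).trans (hS x (Omega_subset hx) 0 0)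
  refine (h.abs_fderiv_le (H := 1 / 10) (by norm_num) le_rfl (by linarith) hS i j hx hn).trans ?_
  have h1 : (S + 3 * sstar a b c) / R ^ 2 ≤ S + 3 * (sstar a b c / R) := by
    have h2 : S / R ^ 2 ≤ S := div_le_self hS0 (by nlinarith)
    have h3 : sstar a b c / R ^ 2 ≤ sstar a b c / R := by gcongr; nlinarith
    rw [add_div, mul_div_assoc]
    linarith
  have h4 : sstar a b c * (1 / 10 / R) ^ 2 ≤ sstar a b c / R / 100 := by
    have : (1 / 10 / R) ^ 2 ≤ 1 / R / 100 := by
      rw [div_pow, div_div, div_le_div_iff₀ (by positivity) (by positivity)]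
      nlinarith
    calc _ ≤ sstar a b c * (1 / R / 100) := by gcongr
      _ = _ := by ring
  have h5 : 0 ≤ sstar a b c / R := by positivity
  linarith

/-- The gradient bound for solutions with bounded coherence length. -/
lemma abs_fderiv_le_of_le_four (h : LdGScaled a b c L κ c₁ c₃ B Cf Cg R Q) (hR4 : R ≤ 4)
    (i j : Fin 3) {x n : E3} (hx : x ∈ Omega) (hn : ‖n‖ = 1) :
    |fderiv ℝ (pertEntry a b c c₁ c₃ Q i j) x n| ≤ (2500 * B + 11000 * sstar a b c) / R := by
  have hR := h.R_pos
  have hs := h.sstar_pos'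
  have hB : 0 ≤ B := hs.le.trans h.sstar_le
  refine (h.abs_fderiv_le (H := R / 40) (by positivity) (by linarith) (by linarith)
    (fun y hy k l => h.abs_pert_le h.entry_le k l hy) i j hx hn).trans ?_
  rw [le_div_iff₀ hR]
  have h1 : (60 * ((B + 4 * sstar a b c) / (R / 40) + (B + 4 * sstar a b c + 3 * sstar a b c)
      / R ^ 2 * (R / 40)) + 18 * sstar a b c * (R / 40 / R) ^ 2) * R
      = 2401.5 * B + 9610.5 * sstar a b c + 18 / 1600 * (sstar a b c * R) := by
    field_simp
    ring
  rw [h1]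
  nlinarith

/-- The far-field size of the perturbation is controlled by the inverse coherence length. -/
lemma exists_far_bound (a b c B Cf Cg : ℝ) :
    ∃ C, ∀ {L κ c₁ c₃ R : ℝ} {Q : E3 → Mat3}, LdGScaled a b c L κ c₁ c₃ B Cf Cg R Q → 4 ≤ R →
      ∀ {μ : ℝ}, sstar a b c / R ≤ μ → μ ≤ B + 4 * sstar a b c →
      (∀ x ∈ OmegaBar, ∀ i j, |pertEntry a b c c₁ c₃ Q i j x| ≤ 6 * μ) →
      ∀ {i j : Fin 3} {x₀ : E3}, R ≤ ‖x₀‖ → μ ≤ 2 * |pertEntry a b c c₁ c₃ Q i j x₀| →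
      μ * R ≤ C := by
  obtain ⟨K, hK, hball⟩ := exists_ball_bound
  set s := sstar a b c
  set S₀ := B + 4 * s
  set C₁ := 36000 * (20000 * S₀ + 32 * s) + 18 * (Cg / Cf / (4 * s)) * (4000 * S₀ + 3 * s) ^ 2
  refine ⟨32 * 400 ^ 3 * K * (C₁ + 36 * S₀), ?_⟩
  intro L κ c₁ c₃ R Q h hR4 μ hμR hμS hS i j x₀ hx₀ hμ
  have hR := h.R_pos
  have hs : 0 < s := h.sstar_pos'
  have hCf := h.Cf_pos
  have hCg := h.Cg_nonneg
  have hμ0 : 0 < μ := lt_of_lt_of_le (by positivity) hμR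
  have hη : ∀ x ∈ Omega, ∀ k l n, ‖n‖ = 1 →
      |fderiv ℝ (pertEntry a b c c₁ c₃ Q k l) x n| ≤ 4000 * μ := fun x hx k l n hn =>
    (h.abs_fderiv_le_of_four_le hR4 hS k l hx hn).trans (by linarith)
  have hM : ∀ x ∈ Omega, ‖x‖ ≤ 2 → ∀ k, |pohoField a b c L c₁ c₃ Q k x| ≤ C₁ * μ := by
    intro x hx hx2 k
    refine (h.abs_pohoField_le hCg h.gpot_le hx hx2 (fun k l => (hS x (Omega_subset hx) k l).trans
      (by linarith)) (fun k l n hn => hη x hx k l n hn) k).trans ?_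
    have h1 : Cg / L ≤ Cg / Cf / (4 * s) * μ := by
      have h2 : Cg / L = Cg / Cf / s * (s / R) * (1 / R) := by rw [h.L_eq]; field_simp
      have h3 : 1 / R ≤ 1 / 4 := by gcongr
      rw [h2]
      calc _ ≤ Cg / Cf / s * μ * (1 / 4) := by gcongr
        _ = _ := by field_simp
    calc _ ≤ 9 * (4000 * μ * (5 * (4000 * S₀) + 32 * s))
          + 18 * (Cg / Cf / (4 * s) * μ) * (4000 * S₀ + 3 * s) ^ 2 := by gcongr
      _ = _ := by ring
  have key := hball h.toLdGPert (M := C₁ * μ) (S := 6 * μ) (R := R) (ρ := R / 400) (m := μ / 4)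
    (x₀ := x₀) (i := i) (j := j) h.gpot_le hM (fun x hx => hS x (Omega_subset hx) i j) hR
    (by positivity) (by positivity) (fun x hx => h.le_abs_of_mem_closedBall hR4 hμR hS hx₀ hμ hx)
  have hS₀ : 0 ≤ S₀ := hμ0.le.trans hμS
  have hC₁ : 0 ≤ C₁ := by positivity
  have h1 : (6 * μ) ^ 2 / R ≤ 36 * S₀ * μ := by
    rw [div_le_iff₀ hR]
    have : μ * μ ≤ S₀ * μ := by gcongr
    have : S₀ * μ ≤ S₀ * μ * R := le_mul_of_one_le_right (by positivity) (by linarith)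
    linarith
  have h2 : K * ((R / 400) ^ 2 + R ^ 2) * (C₁ * μ + (6 * μ) ^ 2 / R)
      ≤ K * (2 * R ^ 2) * (C₁ * μ + 36 * S₀ * μ) := by
    gcongr
    nlinarith
  have h3 : (R ^ 2 * μ) * (μ * R)
      ≤ (R ^ 2 * μ) * (32 * 400 ^ 3 * K * (C₁ + 36 * S₀)) := by
    linarith
  exact le_of_mul_le_mul_left h3 (by positivity)

/-- The uniform gradient bound at coherence length `R`. -/
lemma exists_abs_fderiv_le (a b c B Cf Cg : ℝ) :
    ∃ C, ∀ {L κ c₁ c₃ R : ℝ} {Q : E3 → Mat3}, LdGScaled a b c L κ c₁ c₃ B Cf Cg R Q →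
      ∀ (i j : Fin 3) {x n : E3}, x ∈ Omega → ‖n‖ = 1 →
      |fderiv ℝ (pertEntry a b c c₁ c₃ Q i j) x n| ≤ C / R := by
  obtain ⟨C₂, hfar⟩ := exists_far_bound a b c B Cf Cg
  set s := sstar a b c
  set C₃ := max C₂ s + 2 * s
  refine ⟨max (2500 * B + 11000 * s) (606 * (6 / 5 * C₃) + 19 * s), ?_⟩
  intro L κ c₁ c₃ R Q h i j x n hx hn
  have hR := h.R_pos
  have hs : 0 < s := h.sstar_pos'
  rcases le_total R 4 with hR4 | hR4
  · refine (h.abs_fderiv_le_of_le_four hR4 i j hx hn).trans ?_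
    gcongr
    exact le_max_left _ _
  have hbd : ∀ x ∈ OmegaBar, ∀ i j, |pertEntry a b c c₁ c₃ Q i j x| ≤ B + 4 * s :=
    fun x hx i j => h.abs_pert_le h.entry_le i j hx
  have hsub : ∀ x : E3, R ≤ ‖x‖ → x ∈ OmegaBar := fun x hx => mem_OmegaBar.2 (by linarith)
  obtain ⟨S, -, hS, -, hSmin⟩ := exists_sup_abs ⟨x, Omega_subset hx⟩ hbd
  obtain ⟨μ, hμ0, hμ, ⟨x₀, hx₀, k, l, hμx⟩, hμmin⟩ := exists_sup_abs (A := {x : E3 | R ≤ ‖x‖})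
    ⟨R • eb 0, by simp [norm_smul, abs_of_pos hR]⟩ (fun x hx => hbd x (hsub x hx))
  have hSμ : S ≤ μ + S / 6 + 2 * s / R := hSmin _ fun y hy p q => by
    rcases le_total ‖y‖ R with hyR | hyR
    · exact h.abs_le_of_sphere hμ0 hS (fun z _ hzR => hμ z hzR.ge) p q hy hyR
    · have := (abs_nonneg _).trans (hS y hy p q)
      exact (hμ y hyR p q).trans (by linarith [show 0 ≤ 2 * s / R by positivity])
  have hμC : μ * R ≤ max C₂ s := by
    rcases le_total μ (s / R) with h1 | h1
    · exact ((le_div_iff₀ hR).1 h1).trans (le_max_right _ _)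
    · rw [mul_div_assoc] at hSμ
      exact (hfar h hR4 h1 (hμmin _ fun y hy => hbd y (hsub y hy))
        (fun y hy p q => (hS y hy p q).trans (by linarith)) hx₀ hμx).trans (le_max_left _ _)
  have hSR : S * R ≤ 6 / 5 * C₃ := by
    have := mul_le_mul_of_nonneg_right hSμ hR.le
    rw [add_mul, div_mul_cancel₀ _ hR.ne'] at this
    linarith
  refine (h.abs_fderiv_le_of_four_le hR4 hS i j hx hn).trans
    (le_trans ?_ (div_le_div_of_nonneg_right (le_max_right _ _) hR.le))
  rw [le_div_iff₀ hR, add_mul, mul_assoc, mul_assoc, div_mul_cancel₀ _ hR.ne']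
  linarith

end LdGScaled

/-- The gradient bound for the entries, in terms of the elastic constant. -/
lemma exists_abs_fderiv_pert_le {a b c : ℝ} (ha : 0 ≤ a) (hb : 0 < b) (hc : 0 < c) :
    ∃ C, ∀ {L κ c₁ c₃ : ℝ} {Q : E3 → Mat3}, LdGPert a b c L κ c₁ c₃ Q →
      ∀ (i j : Fin 3) {x n : E3}, x ∈ Omega → ‖n‖ = 1 →
      |fderiv ℝ (pertEntry a b c c₁ c₃ Q i j) x n| ≤ C / √L := by
  obtain ⟨B, hB1, hB⟩ := exists_entry_bound ha hb hc
  obtain ⟨Cf, hCf, hLip⟩ := exists_gradf_lipschitz a b c (B + sstar a b c)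
  obtain ⟨Cg, hCg, hpot⟩ := exists_gpot_sub_le a b c ha hc (B + sstar a b c)
  obtain ⟨C, hC⟩ := LdGScaled.exists_abs_fderiv_le a b c (B + sstar a b c) (Cf + 1) Cg
  refine ⟨C * √(Cf + 1), fun {L κ c₁ c₃ Q} h i j x n hx hn => ?_⟩
  have hs := h.sstar_pos'
  have hL := h.L_pos
  have hentry : ∀ x ∈ OmegaBar, ∀ i j, |Q x i j| ≤ B + sstar a b c := fun x hx i j =>
    (hB L κ Q h.toLdGSol x hx i j).trans (by linarith)
  refine (hC (R := √L / √(Cf + 1))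
    { toLdGPert := h
      Cf_pos := by linarith
      Cg_nonneg := hCg
      R_pos := by positivity
      L_eq := by
        rw [div_pow, Real.sq_sqrt hL.le, Real.sq_sqrt (by linarith)]
        field_simp
      sstar_le := by linarith
      entry_le := hentry
      lipschitz := fun P P' hP hP' d hd k l => (hLip P P' hP hP' d hd k l).trans
        (mul_le_mul_of_nonneg_right (by linarith) ((abs_nonneg _).trans (hd 0 0)))
      gpot_le := fun y hy => hpot _ (h.mem.1 y (Omega_subset hy)) (hentry y (Omega_subset hy)) }
    i j hx hn).trans_eq (by field_simp)

/-- uniform gradient estimate `‖∇(Q − Q_{0,W/L})‖_{L∞(Ω)} ≤ C/√L` for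
solutions of the Euler–Lagrange equations with weak anchoring, where `C` depends only on
`a`, `b`, `c` and a lower bound `δ ≤ W/L` on the anchoring ratio. -/
theorem gradient_estimate
    (a b c : ℝ) (ha : 0 ≤ a) (hb : 0 < b) (hc : 0 < c) :
    ∀ δ : ℝ, 0 < δ → ∃ C : ℝ, 0 < C ∧
      ∀ (L : ℝ) (W : ℝ≥0∞) (Q : E3 → Mat3),
        0 < L → 0 < W → ENNReal.ofReal δ ≤ W / ENNReal.ofReal L →
        RegC 2 Q → memH a b c Q → isEL a b c L Q →
        (∀ x : E3, ‖x‖ = 1 →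
          (if W = ⊤ then (0 : ℝ) else L / W.toReal) • nuDeriv Q x = Qsurf a b c x - Q x) →
        ∀ x ∈ Omega,
          Real.sqrt (gradSq (fun y => Q y - Q0 a b c (W / ENNReal.ofReal L) y) x)
            ≤ C / Real.sqrt L := by
  intro δ _
  obtain ⟨C, hC⟩ := exists_abs_fderiv_pert_le ha hb hc
  refine ⟨√27 * (|C| + 1), by positivity, ?_⟩
  intro L W Q hL hW _ hreg hmem hel hanchor x hx
  obtain ⟨hκ, hc₁, hc₃, hc₁', hc₃'⟩ := coef_bounds hL hW
  have h : LdGPert a b c L (if W = ⊤ then (0 : ℝ) else L / W.toReal)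
      (coef1 (W / ENNReal.ofReal L)) (coef3 (W / ENNReal.ofReal L)) Q :=
    { a_nonneg := ha
      b_pos := hb
      c_pos := hc
      L_pos := hL
      kappa_nonneg := hκ
      reg := hreg
      mem := hmem
      el := hel
      anchor := hanchor
      kappa_mul_c₁ := hc₁
      kappa_mul_c₃ := hc₃
      abs_c₁_le := hc₁'
      abs_c₃_le := hc₃' }
  have hentry : ∀ i j, (fun y => (Q y - Q0 a b c (W / ENNReal.ofReal L) y) i j)
      = pertEntry a b c (coef1 (W / ENNReal.ofReal L)) (coef3 (W / ENNReal.ofReal L)) Q i j :=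
    fun i j => funext fun y => by rw [Matrix.sub_apply, Q0_apply, pertEntry, refEntry]
  have hterm : ∀ i j k, pd (fun y => (Q y - Q0 a b c (W / ENNReal.ofReal L) y) i j) k x ^ 2
      ≤ ((|C| + 1) / √L) ^ 2 := fun i j k => by
    rw [hentry, pd_eq k hx]
    refine sq_le_sq' ?_ ?_ <;>
    have := abs_le.1 ((hC h i j hx (norm_eb k)).trans
      (div_le_div_of_nonneg_right ((le_abs_self C).trans (le_add_of_nonneg_right zero_le_one))
        (Real.sqrt_nonneg L))) <;>
    linarith [this.1, this.2]
  have hsum : gradSq (fun y => Q y - Q0 a b c (W / ENNReal.ofReal L) y) x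
      ≤ 27 * ((|C| + 1) / √L) ^ 2 := by
    refine (Finset.sum_le_sum fun i _ => Finset.sum_le_sum fun j _ =>
      Finset.sum_le_sum fun k _ => hterm i j k).trans_eq ?_
    simp only [Finset.sum_const, Finset.card_univ, Fintype.card_fin, nsmul_eq_mul]
    push_cast
    ring
  refine (Real.sqrt_le_sqrt hsum).trans_eq ?_
  rw [Real.sqrt_mul (by norm_num), Real.sqrt_sq (by positivity), mul_div_assoc]
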